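/- Let f be a loxodromic automorphism of ℂ² and let γ : 𝔻 → ℂ² be a transversal to J⁺, with associated Julia slice E_γ = 𝔻 ∩ ∂(γ⁻¹(K⁺)). Then E_γ is not a C¹ curve: there is no open interval I ⊆ ℝ and no injective continuously differentiable map η : I → ℂ with nowhere-vanishing derivative such that η(I) = E_γ. -/

import Mathlib

open Function Set Filter Topology

noncomputable section

/-- A polynomial map of `ℂ²`. -/
def IsPolyMap (F : ℂ × ℂ → ℂ × ℂ) : Prop :=
  ∃ P Q : MvPolynomial (Fin 2) ℂ, ∀ z : ℂ × ℂ,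
    F z = (MvPolynomial.eval ![z.1, z.2] P, MvPolynomial.eval ![z.1, z.2] Q)

/-- A polynomial automorphism of `ℂ²`. -/
def IsPolyAuto (F : ℂ × ℂ → ℂ × ℂ) : Prop :=
  IsPolyMap F ∧ ∃ G : ℂ × ℂ → ℂ × ℂ, IsPolyMap G ∧
    (∀ z, G (F z) = z) ∧ (∀ z, F (G z) = z)

/-- A generalized Hénon map. -/
def IsHenon (h : ℂ × ℂ → ℂ × ℂ) : Prop :=
  ∃ (p : Polynomial ℂ) (a : ℂ), a ≠ 0 ∧ 2 ≤ p.natDegree ∧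
    ∀ z : ℂ × ℂ, h z = (Polynomial.eval z.1 p - a * z.2, z.1)

/-- A loxodromic automorphism of `ℂ²`. -/
def IsLoxodromic (f : ℂ × ℂ → ℂ × ℂ) : Prop :=
  IsPolyAuto f ∧
  ∃ (u uinv : ℂ × ℂ → ℂ × ℂ) (hs : List (ℂ × ℂ → ℂ × ℂ)),
    IsPolyAuto u ∧ (∀ z, uinv (u z) = z) ∧ (∀ z, u (uinv z) = z) ∧
    hs ≠ [] ∧ (∀ h ∈ hs, IsHenon h) ∧
    ∀ z, f z = uinv (hs.foldr (fun h acc => h ∘ acc) id (u z))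

/-- The set of points with bounded forward orbit. -/
def Kplus (f : ℂ × ℂ → ℂ × ℂ) : Set (ℂ × ℂ) :=
  {z | ∃ C : ℝ, ∀ n : ℕ, ‖f^[n] z‖ ≤ C}

/-- `lam` is an eigenvalue of the continuous linear map `T`. -/
def IsEigenvalue (T : (ℂ × ℂ) →L[ℂ] ℂ × ℂ) (lam : ℂ) : Prop :=
  ∃ v : ℂ × ℂ, v ≠ 0 ∧ T v = lam • v

/-- `p` is a saddle periodic point of period `n` with stable multiplier `ls`
and unstable multiplier `lu`. -/
def IsSaddle (f : ℂ × ℂ → ℂ × ℂ) (p : ℂ × ℂ) (n : ℕ) (ls lu : ℂ) : Prop :=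
  1 ≤ n ∧ f^[n] p = p ∧
  IsEigenvalue (fderiv ℂ (f^[n]) p) ls ∧ IsEigenvalue (fderiv ℂ (f^[n]) p) lu ∧
  ‖ls‖ < 1 ∧ 1 < ‖lu‖

/-- Coordinatewise complex conjugation `σ(x,y) = (x̄, ȳ)`. -/
def conjMap (z : ℂ × ℂ) : ℂ × ℂ := (starRingEnd ℂ z.1, starRingEnd ℂ z.2)

/-- The open unit disk in `ℂ`. -/
def unitDisk : Set ℂ := Metric.ball 0 1

/-- `γ` is a transversal to `J⁺`. -/
def IsTransversal (f : ℂ × ℂ → ℂ × ℂ) (γ : ℂ → ℂ × ℂ) : Prop :=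
  Set.InjOn γ unitDisk ∧ DifferentiableOn ℂ γ unitDisk ∧
  (∃ z ∈ unitDisk, γ z ∈ Kplus f) ∧ ¬ (∀ z ∈ unitDisk, γ z ∈ Kplus f)

/-- The Julia slice associated to a transversal. -/
def juliaSlice (f : ℂ × ℂ → ℂ × ℂ) (γ : ℂ → ℂ × ℂ) : Set ℂ :=
  unitDisk ∩ frontier {z | z ∈ unitDisk ∧ γ z ∈ Kplus f}

/-- An unstable parametrization of a saddle periodic point. -/
def IsUnstableParam (f : ℂ × ℂ → ℂ × ℂ) (n : ℕ) (lu : ℂ) (p : ℂ × ℂ) (ψ : ℂ → ℂ × ℂ) : Prop :=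
  Function.Injective ψ ∧ Differentiable ℂ ψ ∧ ψ 0 = p ∧
  ∀ ζ : ℂ, f^[n] (ψ ζ) = ψ (lu * ζ)

/-- `S` is contained in a proper real-analytic subvariety of `ℂ²`. -/
def ContainedInProperRealAnalyticSubvariety (S : Set (ℂ × ℂ)) : Prop :=
  ∃ V : Set (ℂ × ℂ), IsClosed V ∧ V ≠ Set.univ ∧ S ⊆ V ∧
    ∀ x ∈ V, ∃ (U : Set (ℂ × ℂ)) (g : ℂ × ℂ → ℝ),
      IsOpen U ∧ x ∈ U ∧ (∀ y ∈ U, AnalyticAt ℝ g y) ∧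
      (∃ y ∈ U, g y ≠ 0) ∧ ∀ y ∈ V ∩ U, g y = 0



structure Sys where
  p : ℤ → Polynomial ℂ
  a : ℤ → ℂ
  k : ℕ
  D : ℤ → ℝ
  kpos : 0 < k
  hp : ∀ j, p (j + k) = p j
  ha : ∀ j, a (j + k) = a j
  ane : ∀ j, a j ≠ 0
  deg : ∀ j, 2 ≤ (p j).natDegree
  D0 : D 0 = 1
  Dpos : ∀ j, 0 < D j
  Dsucc : ∀ j, D (j + 1) = (p j).natDegree * D j

namespace Sys
variable (S : Sys)

def d (j : ℤ) : ℕ := (S.p j).natDegree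

def stp (j : ℤ) (x y : ℂ) : ℂ := (S.p j).eval x - S.a j * y

def IsOrb (x : ℤ → ℂ) : Prop := ∀ j, x (j + 1) = S.stp j (x j) (x (j - 1))

structure Cst (M B C : ℝ) : Prop where
  M2 : 2 ≤ M
  B0 : 0 ≤ B
  C0 : 0 ≤ C
  BM : B / M ≤ 1 / 2
  step1 : ∀ j x y, M ≤ ‖x‖ → ‖y‖ ≤ ‖x‖ → 2 * ‖x‖ ≤ ‖S.stp j x y‖
  step2 : ∀ j x y, M ≤ ‖x‖ → ‖y‖ ≤ ‖x‖ →
    ‖S.stp j x y / ((S.p j).leadingCoeff * x ^ (S.d j)) - 1‖ ≤ B / ‖x‖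
  logb : ∀ j x y, ‖y‖ ≤ max M ‖x‖ →
    |Real.log (max M ‖S.stp j x y‖) - S.d j * Real.log (max M ‖x‖)| ≤ C

lemma periodic_bdd (F : ℤ → ℝ) (k : ℕ) (hk : 0 < k) (hF : ∀ j, F (j + k) = F j) :
    ∃ b, 0 ≤ b ∧ ∀ j, F j ≤ b := by
  have hP : Function.Periodic F (k : ℤ) := hF
  refine ⟨∑ i ∈ Finset.range k, |F i|, Finset.sum_nonneg (fun _ _ => abs_nonneg _), fun j => ?_⟩
  have h1 : F j = F (j % k) := by
    have := hP.sub_zsmul_eq (x := j) (j / k)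
    rw [← this]
    congr 1
    have := Int.emod_add_mul_ediv j k
    simp only [smul_eq_mul]
    linarith [mul_comm (k : ℤ) (j / k)]
  have h2 : 0 ≤ j % k := Int.emod_nonneg _ (by omega)
  have h3 : j % k < k := Int.emod_lt_of_pos _ (by omega)
  obtain ⟨i, hi⟩ := Int.eq_ofNat_of_zero_le h2
  rw [h1, hi]
  refine (le_abs_self _).trans ?_
  exact Finset.single_le_sum (f := fun i : ℕ => |F i|) (fun _ _ => abs_nonneg _)
    (Finset.mem_range.2 (by omega))

def sumc (q : Polynomial ℂ) : ℝ := ∑ i ∈ Finset.range (q.natDegree + 1), ‖q.coeff i‖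

lemma sumc_nonneg (q : Polynomial ℂ) : 0 ≤ sumc q := Finset.sum_nonneg (fun _ _ => norm_nonneg _)

lemma eval_le (q : Polynomial ℂ) (x : ℂ) (r : ℝ) (hr : 1 ≤ r) (hx : ‖x‖ ≤ r) :
    ‖q.eval x‖ ≤ sumc q * r ^ q.natDegree := by
  rw [Polynomial.eval_eq_sum_range, sumc, Finset.sum_mul]
  refine (norm_sum_le _ _).trans (Finset.sum_le_sum fun i hi => ?_)
  rw [norm_mul, norm_pow]
  have : i ≤ q.natDegree := by simp at hi; omega
  gcongr
  calc ‖x‖ ^ i ≤ r ^ i := by gcongr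
    _ ≤ r ^ q.natDegree := pow_le_pow_right₀ hr this

lemma eval_sub_lead (q : Polynomial ℂ) (hq : 2 ≤ q.natDegree) (x : ℂ) (hx : 1 ≤ ‖x‖) :
    ‖q.eval x - q.leadingCoeff * x ^ q.natDegree‖ ≤ sumc q * ‖x‖ ^ (q.natDegree - 1) := by
  rw [Polynomial.eval_eq_sum_range, Finset.sum_range_succ, Polynomial.coeff_natDegree,
    add_sub_cancel_right]
  have : ∑ i ∈ Finset.range q.natDegree, ‖q.coeff i‖ ≤ sumc q := by
    rw [sumc, Finset.sum_range_succ]; linarith [norm_nonneg (q.coeff q.natDegree)]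
  refine le_trans ?_ (mul_le_mul_of_nonneg_right this (by positivity))
  rw [Finset.sum_mul]
  refine (norm_sum_le _ _).trans (Finset.sum_le_sum fun i hi => ?_)
  rw [norm_mul, norm_pow]
  have : i ≤ q.natDegree - 1 := by simp at hi; omega
  gcongr

lemma lc_ne (j : ℤ) : (S.p j).leadingCoeff ≠ 0 := by
  intro h
  have := S.deg j
  rw [Polynomial.leadingCoeff_eq_zero] at h
  simp [h] at this

lemma exists_cst (M0 : ℝ) : ∃ M B C, M0 ≤ M ∧ S.Cst M B C := by
  obtain ⟨B, hB0, hB⟩ := periodic_bdd (fun j => (sumc (S.p j) + ‖S.a j‖) / ‖(S.p j).leadingCoeff‖)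
    S.k S.kpos (by intro j; simp only [S.hp, S.ha])
  obtain ⟨m, hm0, hm⟩ := periodic_bdd (fun j => 4 / ‖(S.p j).leadingCoeff‖)
    S.k S.kpos (by intro j; simp only [S.hp])
  set M := max M0 (2 + 2 * B + m) with hM
  have hM1 : 2 + 2 * B + m ≤ M := le_max_right _ _
  obtain ⟨C, hC0, hC⟩ := periodic_bdd (fun j => |Real.log ‖(S.p j).leadingCoeff‖| + Real.log 2 +
      |Real.log (max M (sumc (S.p j) * M ^ (S.p j).natDegree + ‖S.a j‖ * M))| +
      (S.p j).natDegree * Real.log M)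
    S.k S.kpos (by intro j; simp only [S.hp, S.ha])
  have s2 : ∀ j x y, M ≤ ‖x‖ → ‖y‖ ≤ ‖x‖ →
    ‖S.stp j x y / ((S.p j).leadingCoeff * x ^ (S.d j)) - 1‖ ≤ B / ‖x‖ := by
    intro j x y hx hy
    have hl : 0 < ‖(S.p j).leadingCoeff‖ := norm_pos_iff.2 (S.lc_ne j)
    have hx1 : 1 ≤ ‖x‖ := by linarith
    have hx0 : x ≠ 0 := norm_pos_iff.1 (by linarith)
    have hd := S.deg j
    have hne : (S.p j).leadingCoeff * x ^ (S.d j) ≠ 0 := mul_ne_zero (S.lc_ne j) (pow_ne_zero _ hx0)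
    rw [div_sub_one hne, norm_div, norm_mul, norm_pow]
    have e1 := eval_sub_lead (S.p j) hd x hx1
    have e2 : ‖S.stp j x y - (S.p j).leadingCoeff * x ^ (S.d j)‖ ≤
        (sumc (S.p j) + ‖S.a j‖) * ‖x‖ ^ (S.d j - 1) := by
      have : S.stp j x y - (S.p j).leadingCoeff * x ^ (S.d j) =
        ((S.p j).eval x - (S.p j).leadingCoeff * x ^ (S.p j).natDegree) - S.a j * y := by
        simp [stp, d]; ring
      rw [this]
      refine (norm_sub_le _ _).trans ?_
      rw [norm_mul, add_mul]
      refine add_le_add e1 ?_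
      gcongr
      calc ‖y‖ ≤ ‖x‖ := hy
        _ = ‖x‖ ^ 1 := (pow_one _).symm
        _ ≤ ‖x‖ ^ (S.d j - 1) := pow_le_pow_right₀ hx1 (by simp only [d]; omega)
    have e3 : ‖x‖ ^ (S.d j) = ‖x‖ ^ (S.d j - 1) * ‖x‖ := by
      rw [← pow_succ]; congr 1; simp only [d]; omega
    have hpos : 0 < ‖x‖ ^ (S.d j - 1) := by positivity
    have hxp : 0 < ‖x‖ := by linarith
    have hBj := hB j
    rw [div_le_iff₀ hl] at hBj
    rw [div_le_div_iff₀ (by positivity) hxp, e3]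
    calc _ ≤ ((sumc (S.p j) + ‖S.a j‖) * ‖x‖ ^ (S.d j - 1)) * ‖x‖ := by gcongr
      _ ≤ ((B * ‖(S.p j).leadingCoeff‖) * ‖x‖ ^ (S.d j - 1)) * ‖x‖ := by gcongr
      _ = _ := by ring
  have hMp : 0 < M := by linarith
  have hBM : B / M ≤ 1 / 2 := by rw [div_le_div_iff₀ hMp (by norm_num)]; linarith
  have hBx : ∀ x : ℂ, M ≤ ‖x‖ → B / ‖x‖ ≤ 1 / 2 := fun x hx =>
    (div_le_div_of_nonneg_left hB0 hMp hx).trans hBM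
  -- norm bounds
  have nb : ∀ j x y, M ≤ ‖x‖ → ‖y‖ ≤ ‖x‖ →
      ‖(S.p j).leadingCoeff‖ * ‖x‖ ^ (S.d j) / 2 ≤ ‖S.stp j x y‖ ∧
      ‖S.stp j x y‖ ≤ 2 * (‖(S.p j).leadingCoeff‖ * ‖x‖ ^ (S.d j)) := by
    intro j x y hx hy
    have h := (s2 j x y hx hy).trans (hBx x hx)
    have hx0 : x ≠ 0 := norm_pos_iff.1 (by linarith)
    have hne : (S.p j).leadingCoeff * x ^ (S.d j) ≠ 0 := mul_ne_zero (S.lc_ne j) (pow_ne_zero _ hx0)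
    set w := S.stp j x y / ((S.p j).leadingCoeff * x ^ (S.d j)) with hw
    have hz : S.stp j x y = w * ((S.p j).leadingCoeff * x ^ (S.d j)) := by
      rw [hw, div_mul_cancel₀ _ hne]
    have hw1 : 1 / 2 ≤ ‖w‖ := by
      have : ‖(1:ℂ)‖ ≤ ‖w‖ + ‖w - 1‖ := by
        have := norm_sub_le w (w - 1); simpa using this
      simp at this; linarith
    have hw2 : ‖w‖ ≤ 2 := by
      have : ‖w‖ ≤ ‖w - 1‖ + ‖(1:ℂ)‖ := by
        have := norm_add_le (w - 1) 1; simpa using this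
      simp at this; linarith
    rw [hz, norm_mul, norm_mul, norm_pow]
    have : 0 ≤ ‖(S.p j).leadingCoeff‖ * ‖x‖ ^ S.d j := by positivity
    constructor <;> nlinarith
  have s1 : ∀ j x y, M ≤ ‖x‖ → ‖y‖ ≤ ‖x‖ → 2 * ‖x‖ ≤ ‖S.stp j x y‖ := by
    intro j x y hx hy
    refine le_trans ?_ (nb j x y hx hy).1
    have hl : 0 < ‖(S.p j).leadingCoeff‖ := norm_pos_iff.2 (S.lc_ne j)
    have h4 := hm j
    rw [div_le_iff₀ hl] at h4
    have hx2 : ‖x‖ ^ 2 ≤ ‖x‖ ^ (S.d j) := pow_le_pow_right₀ (by linarith) (S.deg j)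
    have h5 : 4 ≤ ‖x‖ * ‖(S.p j).leadingCoeff‖ := h4.trans (by gcongr; linarith)
    have : 4 * ‖x‖ ≤ ‖(S.p j).leadingCoeff‖ * ‖x‖ ^ 2 := by nlinarith [norm_nonneg x]
    have : ‖(S.p j).leadingCoeff‖ * ‖x‖ ^ 2 ≤ ‖(S.p j).leadingCoeff‖ * ‖x‖ ^ (S.d j) := by gcongr
    linarith
  refine ⟨M, B, C, le_max_left _ _, by linarith, hB0, hC0, hBM, s1, s2, ?_⟩
  intro j x y hy
  refine le_trans ?_ (hC j)
  have hlog2 : 0 < Real.log 2 := Real.log_pos (by norm_num)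
  have hlogM : 0 < Real.log M := Real.log_pos (by linarith)
  rcases le_total M ‖x‖ with hx | hx
  · rw [max_eq_right hx] at hy ⊢
    have h1 := s1 j x y hx hy
    rw [max_eq_right (by linarith)]
    obtain ⟨n1, n2⟩ := nb j x y hx hy
    have hl : 0 < ‖(S.p j).leadingCoeff‖ := norm_pos_iff.2 (S.lc_ne j)
    have hxp : 0 < ‖x‖ := by linarith
    have hzp : 0 < ‖S.stp j x y‖ := by linarith
    have l1 := Real.log_le_log (by positivity) n1
    have l2 := Real.log_le_log hzp n2
    rw [Real.log_div (by positivity) (by norm_num), Real.log_mul (by positivity) (by positivity),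
      Real.log_pow] at l1
    rw [Real.log_mul (by norm_num) (by positivity), Real.log_mul (by positivity) (by positivity),
      Real.log_pow] at l2
    have k1 := le_abs_self (Real.log ‖(S.p j).leadingCoeff‖)
    have k2 := neg_abs_le (Real.log ‖(S.p j).leadingCoeff‖)
    have k3 := abs_nonneg (Real.log (max M (sumc (S.p j) * M ^ (S.p j).natDegree + ‖S.a j‖ * M)))
    have k4 : 0 ≤ (S.p j).natDegree * Real.log M := by positivity
    rw [abs_le]; constructor <;> linarith
  · rw [max_eq_left hx] at hy ⊢
    have u1 : ‖S.stp j x y‖ ≤ sumc (S.p j) * M ^ (S.p j).natDegree + ‖S.a j‖ * M := by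
      refine (norm_sub_le _ _).trans (add_le_add (eval_le _ _ _ (by linarith) hx) ?_)
      rw [norm_mul]; gcongr
    have l1 : Real.log M ≤ Real.log (max M ‖S.stp j x y‖) :=
      Real.log_le_log hMp (le_max_left _ _)
    have l2 : Real.log (max M ‖S.stp j x y‖) ≤
        Real.log (max M (sumc (S.p j) * M ^ (S.p j).natDegree + ‖S.a j‖ * M)) :=
      Real.log_le_log (lt_max_of_lt_left hMp) (max_le_max le_rfl u1)
    have k1 := le_abs_self (Real.log (max M (sumc (S.p j) * M ^ (S.p j).natDegree + ‖S.a j‖ * M)))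
    have k3 := abs_nonneg (Real.log ‖(S.p j).leadingCoeff‖)
    have k4 : 0 ≤ (S.p j).natDegree * Real.log M := by positivity
    rw [abs_le]; simp only [d]; constructor <;> linarith

/-- Tame orbit from index `N`. -/
structure Tame (M : ℝ) (x : ℤ → ℂ) (N : ℤ) : Prop where
  orb : S.IsOrb x
  ini : ‖x (N - 1)‖ ≤ max M ‖x N‖

variable {S} {M B C : ℝ}

lemma Tame.all (hc : S.Cst M B C) {x : ℤ → ℂ} {N : ℤ} (h : S.Tame M x N) {j : ℤ} (hj : N ≤ j) :
    ‖x (j - 1)‖ ≤ max M ‖x j‖ := by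
  induction j, hj using Int.leInduction with
  | base => exact h.ini
  | succ j hj ih =>
    rw [add_sub_cancel_right]
    rcases le_total ‖x j‖ M with hM | hM
    · exact hM.trans (le_max_left _ _)
    · rw [max_eq_right hM] at ih
      have := hc.step1 j _ _ hM ih
      rw [← h.orb j] at this
      exact le_max_of_le_right (by linarith [norm_nonneg (x j)])

lemma Tame.grow (hc : S.Cst M B C) {x : ℤ → ℂ} {N : ℤ} (h : S.Tame M x N) {j : ℤ} (hj : N ≤ j) (hM : M ≤ ‖x j‖) :
    2 * ‖x j‖ ≤ ‖x (j + 1)‖ := by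
  have h1 := h.all hc hj
  rw [max_eq_right hM] at h1
  rw [h.orb j]
  exact hc.step1 j _ _ hM h1

lemma Tame.grow' (hc : S.Cst M B C) {x : ℤ → ℂ} {N : ℤ} (h : S.Tame M x N) {j i : ℤ} (hj : N ≤ j) (hM : M ≤ ‖x j‖)
    (hi : j ≤ i) : ‖x j‖ ≤ ‖x i‖ := by
  induction i, hi using Int.leInduction with
  | base => exact le_rfl
  | succ i hi ih =>
    have := h.grow hc (hj.trans hi) (hM.trans ih)
    linarith [norm_nonneg (x i)]

lemma Tame.mono {x : ℤ → ℂ} {N N' : ℤ} (hc : S.Cst M B C) (h : S.Tame M x N) (hj : N ≤ N') :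
    S.Tame M x N' := ⟨h.orb, h.all hc hj⟩

variable (S) in
def LL (M : ℝ) (x : ℤ → ℂ) (j : ℤ) : ℝ := Real.log (max M ‖x j‖)

variable (S) in
def pot (M : ℝ) (x : ℤ → ℂ) : ℝ := limUnder atTop (fun j : ℤ => LL M x j / S.D j)

lemma D_two (j : ℤ) : 2 * S.D j ≤ S.D (j + 1) := by
  rw [S.Dsucc]
  have : (2 : ℝ) ≤ (S.p j).natDegree := by exact_mod_cast S.deg j
  nlinarith [S.Dpos j]

lemma D_two_pow (j : ℤ) (n : ℕ) : 2 ^ n * S.D j ≤ S.D (j + n) := by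
  induction n with
  | zero => simp
  | succ n ih =>
    have := S.D_two (j + n)
    push_cast
    rw [← add_assoc, pow_succ]
    linarith

lemma tendsto_D : Tendsto S.D atTop atTop := by
  have h1 : Tendsto (fun n : ℕ => S.D n) atTop atTop := by
    refine tendsto_atTop_mono (fun n => ?_) (tendsto_pow_atTop_atTop_of_one_lt (one_lt_two (α := ℝ)))
    have := S.D_two_pow 0 n
    rw [S.D0] at this; simpa using this
  refine tendsto_atTop.2 fun b => ?_
  obtain ⟨n, hn⟩ := (tendsto_atTop.1 h1 b).exists_forall_of_atTop
  filter_upwards [eventually_ge_atTop (n : ℤ)] with j hj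
  obtain ⟨i, rfl⟩ := Int.eq_ofNat_of_zero_le (show (0:ℤ) ≤ j by omega)
  exact hn i (by omega)

lemma D_mono {i j : ℤ} (h : i ≤ j) : S.D i ≤ S.D j := by
  induction j, h using Int.leInduction with
  | base => exact le_rfl
  | succ i hi ih => linarith [S.D_two i, S.Dpos i]

lemma pot_aux (hc : S.Cst M B C) {x : ℤ → ℂ} {N : ℤ} (h : S.Tame M x N) {j : ℤ} (hj : N ≤ j) :
    Tendsto (fun j : ℤ => LL M x j / S.D j) atTop (𝓝 (S.pot M x)) ∧
    |S.D j * S.pot M x - LL M x j| ≤ C := by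
  have key : ∀ i, N ≤ i → |LL M x (i+1) - S.d i * LL M x i| ≤ C := fun i hi => by
    have := hc.logb i (x i) (x (i-1)) (h.all hc hi)
    rwa [← h.orb i] at this
  have st : ∀ j, N ≤ j → ∀ n : ℕ, dist (LL M x (j + n) / S.D (j+n)) (LL M x (j + (n+1:ℕ)) / S.D (j+(n+1:ℕ)))
      ≤ (C / S.D j) / 2 / 2 ^ n := by
    intro j hj n
    have k := key (j + n) (by omega)
    have d1 := S.Dpos (j+n)
    have d2 := S.Dpos (j+n+1)
    have d3 := S.Dpos j
    have e : S.D (j + n + 1) = S.d (j+n) * S.D (j+n) := S.Dsucc _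
    have hdp : (S.d (j+n) : ℝ) ≠ 0 := by
      have := S.deg (j+n); simp only [d]; positivity
    push_cast
    rw [← add_assoc, dist_comm, Real.dist_eq]
    have : LL M x (j + n + 1) / S.D (j + n + 1) - LL M x (j+n) / S.D (j+n) =
      (LL M x (j+n+1) - S.d (j+n) * LL M x (j+n)) / S.D (j+n+1) := by
      rw [e]; field_simp
    rw [this, abs_div, abs_of_pos d2, div_div, div_div]
    have := S.D_two_pow j (n+1)
    push_cast at this; rw [← add_assoc, pow_succ] at this
    refine div_le_div₀ hc.C0 k (by positivity) (by linarith)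
  have lim : ∀ j, N ≤ j → ∃ l, Tendsto (fun i : ℤ => LL M x i / S.D i) atTop (𝓝 l) ∧
      |S.D j * l - LL M x j| ≤ C := by
    intro j hj
    obtain ⟨l, hl⟩ := cauchySeq_tendsto_of_complete (cauchySeq_of_le_geometric_two (st j hj))
    have hd := dist_le_of_le_geometric_two_of_tendsto₀ (st j hj) hl
    refine ⟨l, ?_, ?_⟩
    · have h2 : Tendsto (fun i : ℤ => (i - j).toNat) atTop atTop := by
        refine tendsto_atTop.2 fun b => ?_
        filter_upwards [eventually_ge_atTop (j + b)] with i hi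
        omega
      refine (hl.comp h2).congr' ?_
      filter_upwards [eventually_ge_atTop j] with i hi
      have : j + ((i - j).toNat : ℤ) = i := by omega
      simp only [Function.comp, this]
    · simp only [Nat.cast_zero, add_zero] at hd
      rw [dist_comm, Real.dist_eq] at hd
      have d3 := S.Dpos j
      have : S.D j * l - LL M x j = S.D j * (l - LL M x j / S.D j) := by field_simp
      rw [this, abs_mul, abs_of_pos d3]
      calc S.D j * |l - LL M x j / S.D j| ≤ S.D j * (C / S.D j) := by gcongr
        _ = C := by field_simp
  obtain ⟨l, h1, h2⟩ := lim j hj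
  have : S.pot M x = l := h1.limUnder_eq
  rw [this]; exact ⟨h1, h2⟩

lemma pot_tendsto (hc : S.Cst M B C) {x : ℤ → ℂ} {N : ℤ} (h : S.Tame M x N) :
    Tendsto (fun j : ℤ => LL M x j / S.D j) atTop (𝓝 (S.pot M x)) := (pot_aux hc h le_rfl).1

lemma pot_bound (hc : S.Cst M B C) {x : ℤ → ℂ} {N : ℤ} (h : S.Tame M x N) {j : ℤ} (hj : N ≤ j) :
    |S.D j * S.pot M x - LL M x j| ≤ C := (pot_aux hc h hj).2

lemma LL_pos (hc : S.Cst M B C) (x : ℤ → ℂ) (j : ℤ) : 0 < LL M x j :=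
  Real.log_pos (lt_max_of_lt_left (by linarith [hc.M2]))

lemma norm_le_exp_LL (hc : S.Cst M B C) (x : ℤ → ℂ) (j : ℤ) : ‖x j‖ ≤ Real.exp (LL M x j) := by
  rw [LL, Real.exp_log (lt_max_of_lt_left (by linarith [hc.M2]))]; exact le_max_right _ _

lemma norm_le_exp (hc : S.Cst M B C) {x : ℤ → ℂ} {N : ℤ} (h : S.Tame M x N) {j : ℤ} (hj : N ≤ j) :
    ‖x j‖ ≤ Real.exp (S.D j * S.pot M x + C) := by
  refine (norm_le_exp_LL hc x j).trans (Real.exp_le_exp.2 ?_)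
  have := (abs_le.1 (pot_bound hc h hj)).1; linarith

lemma pot_nonneg (hc : S.Cst M B C) {x : ℤ → ℂ} {N : ℤ} (h : S.Tame M x N) : 0 ≤ S.pot M x :=
  ge_of_tendsto' (pot_tendsto hc h) fun j => (div_pos (LL_pos hc x j) (S.Dpos j)).le

lemma pot_eq_zero_of_bdd (hc : S.Cst M B C) {x : ℤ → ℂ} {N : ℤ} (h : S.Tame M x N) (R : ℝ)
    (hb : ∃ᶠ j in atTop, ‖x j‖ ≤ R) : S.pot M x = 0 := by
  refine le_antisymm ?_ (pot_nonneg hc h)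
  by_contra hcon
  push Not at hcon
  have h1 : Tendsto (fun j => S.D j * S.pot M x - C) atTop atTop :=
    tendsto_atTop_add_const_right _ _ (S.tendsto_D.atTop_mul_const hcon)
  have h2 := (h1.eventually_gt_atTop (Real.log (max M R))).and (eventually_ge_atTop N)
  obtain ⟨j, hj, hj2, hj3⟩ := (hb.and_eventually h2).exists
  have := (abs_le.1 (pot_bound hc h hj3)).2
  have h4 : LL M x j ≤ Real.log (max M R) :=
    Real.log_le_log (lt_max_of_lt_left (by linarith [hc.M2])) (max_le_max le_rfl hj)
  linarith

lemma D_per (j : ℤ) : S.D (j + S.k) = S.D S.k * S.D j := by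
  induction j using Int.induction_on with
  | zero => simp [S.D0]
  | succ i ih =>
    rw [add_right_comm, S.Dsucc, S.Dsucc, S.hp, ih]; ring
  | pred i ih =>
    have e1 := S.Dsucc (-(i:ℤ) - 1)
    have e2 := S.Dsucc (-(i:ℤ) - 1 + S.k)
    rw [S.hp] at e2
    rw [show -(i:ℤ) - 1 + 1 = -i by ring] at e1
    rw [show -(i:ℤ) - 1 + S.k + 1 = -i + S.k by ring, ih, e1] at e2
    have : ((S.p (-(i:ℤ) - 1)).natDegree : ℝ) ≠ 0 := by
      have := S.deg (-(i:ℤ) - 1); positivity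
    have h3 : (S.p (-(i:ℤ) - 1)).natDegree * (S.D S.k * S.D (-(i:ℤ) - 1)) =
      (S.p (-(i:ℤ) - 1)).natDegree * S.D (-(i:ℤ) - 1 + S.k) := by rw [← e2]; ring
    exact (mul_left_cancel₀ this h3).symm

lemma D_per_n (n : ℕ) (j : ℤ) : S.D (j + S.k * n) = S.D S.k ^ n * S.D j := by
  induction n with
  | zero => simp
  | succ n ih =>
    have : j + S.k * ((n + 1 : ℕ) : ℤ) = (j + S.k * n) + S.k := by push_cast; ring
    rw [this, D_per, ih]; ring

lemma IsOrb.shift {x : ℤ → ℂ} (h : S.IsOrb x) (n : ℕ) : S.IsOrb (fun j => x (j + S.k * n)) := by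
  intro j
  have h1 : Function.Periodic S.p (S.k : ℤ) := S.hp
  have h2 : Function.Periodic S.a (S.k : ℤ) := S.ha
  have := h (j + S.k * n)
  have e1 : S.p (j + S.k * n) = S.p j := by
    have := h1.nat_mul n j; rwa [mul_comm] at this
  have e2 : S.a (j + S.k * n) = S.a j := by
    have := h2.nat_mul n j; rwa [mul_comm] at this
  simp only [stp, e1, e2] at this ⊢
  rw [add_right_comm, this]; congr 3; ring

end Sys


/-- Holomorphic logarithm on a ball. -/
lemma exists_log_ball {w : ℂ} {ρ : ℝ} {g : ℂ → ℂ} (hg : DifferentiableOn ℂ g (Metric.ball w ρ))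
    (h0 : ∀ z ∈ Metric.ball w ρ, g z ≠ 0) :
    ∃ F : ℂ → ℂ, (∀ z ∈ Metric.ball w ρ, HasDerivAt F (deriv g z / g z) z) ∧
      ∀ z ∈ Metric.ball w ρ, (F z).re = Real.log ‖g z‖ := by
  rcases le_or_gt ρ 0 with hρ | hρ
  · refine ⟨0, by simp [Metric.ball_eq_empty.2 hρ], by simp [Metric.ball_eq_empty.2 hρ]⟩
  have hw : w ∈ Metric.ball w ρ := Metric.mem_ball_self hρ
  have hd : DifferentiableOn ℂ (fun z => deriv g z / g z) (Metric.ball w ρ) :=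
    (hg.deriv Metric.isOpen_ball).div hg h0
  obtain ⟨P, hP⟩ := hd.isExactOn_ball
  set F := fun z => P z - P w + Complex.log (g w) with hF
  have hF' : ∀ z ∈ Metric.ball w ρ, HasDerivAt F (deriv g z / g z) z := fun z hz =>
    ((hP z hz).sub_const _).add_const _
  have hq : ∀ z ∈ Metric.ball w ρ, HasDerivAt (fun z => g z * Complex.exp (-F z)) 0 z := by
    intro z hz
    have hgz := (hg.differentiableAt (Metric.isOpen_ball.mem_nhds hz)).hasDerivAt
    have h := h0 z hz
    refine (hgz.mul ((hF' z hz).neg.cexp)).congr_deriv ?_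
    field_simp
    ring
  have hconst : ∀ z ∈ Metric.ball w ρ, g z * Complex.exp (-F z) = 1 := by
    intro z hz
    have := (convex_ball w ρ).is_const_of_fderivWithin_eq_zero (𝕜 := ℂ)
      (f := fun z => g z * Complex.exp (-F z))
      (fun z hz => (hq z hz).differentiableAt.differentiableWithinAt)
      (fun z hz => by
        rw [fderivWithin_of_isOpen Metric.isOpen_ball hz]
        ext; simp [(hq z hz).deriv]) hz hw
    rw [this]
    simp only [hF]
    rw [sub_self, zero_add, Complex.exp_neg, Complex.exp_log (h0 w hw), mul_inv_cancel₀ (h0 w hw)]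
  refine ⟨F, hF', fun z hz => ?_⟩
  have h1 : g z = Complex.exp (F z) := by
    have := hconst z hz
    rw [Complex.exp_neg, mul_inv_eq_one₀ (Complex.exp_ne_zero _)] at this
    exact this
  rw [h1, Complex.norm_exp, Real.log_exp]

lemma harnack_holo {w : ℂ} {ρ : ℝ} {F : ℂ → ℂ} (hF : DifferentiableOn ℂ F (Metric.ball w ρ))
    (h0 : ∀ z ∈ Metric.ball w ρ, 0 < (F z).re) {z : ℂ} (hz : z ∈ Metric.ball w ρ) :
    (F w).re * (ρ - dist z w) ≤ (F z).re * (ρ + dist z w) ∧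
    (F z).re * (ρ - dist z w) ≤ (F w).re * (ρ + dist z w) := by
  have hρ : 0 < ρ := lt_of_le_of_lt dist_nonneg hz
  have hw : w ∈ Metric.ball w ρ := Metric.mem_ball_self hρ
  have hden : ∀ z ∈ Metric.ball w ρ, F z + (starRingEnd ℂ) (F w) ≠ 0 := by
    intro z hz h
    have := congrArg Complex.re h
    simp at this
    linarith [h0 z hz, h0 w hw]
  set φ := fun z => (F z - F w) / (F z + (starRingEnd ℂ) (F w)) with hφ
  have hφd : DifferentiableOn ℂ φ (Metric.ball w ρ) :=
    (hF.sub_const _).div (hF.add_const _) hden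
  have nsq : ∀ z, ‖F z - F w‖ ^ 2 = ((F z).re - (F w).re) ^ 2 + ((F z).im - (F w).im) ^ 2 := by
    intro z
    rw [Complex.sq_norm, Complex.normSq_apply]; simp; ring
  have nsq2 : ∀ z, ‖F z + (starRingEnd ℂ) (F w)‖ ^ 2 =
      ((F z).re + (F w).re) ^ 2 + ((F z).im - (F w).im) ^ 2 := by
    intro z
    rw [Complex.sq_norm, Complex.normSq_apply]; simp; ring
  have hφw : φ w = 0 := by simp [hφ]
  have hmaps : MapsTo φ (Metric.ball w ρ) (Metric.ball (φ w) 1) := by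
    intro z hz
    rw [hφw, mem_ball_zero_iff]
    simp only [hφ]
    rw [norm_div, div_lt_one (norm_pos_iff.2 (hden z hz))]
    refine lt_of_pow_lt_pow_left₀ 2 (norm_nonneg _) ?_
    rw [nsq, nsq2]
    nlinarith [mul_pos (h0 z hz) (h0 w hw)]
  have hS := Complex.dist_le_div_mul_dist_of_mapsTo_ball hφd (hmaps.mono_right Metric.ball_subset_closedBall) hz
  rw [hφw, dist_zero_right] at hS
  simp only [hφ] at hS
  rw [norm_div, div_le_iff₀ (norm_pos_iff.2 (hden z hz))] at hS
  set s := dist z w with hs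
  have hs0 : 0 ≤ s := dist_nonneg
  have hsρ : s < ρ := hz
  have h1 : ρ * ‖F z - F w‖ ≤ s * ‖F z + (starRingEnd ℂ) (F w)‖ := by
    calc _ ≤ ρ * (1 / ρ * s * ‖F z + (starRingEnd ℂ) (F w)‖) := by gcongr
      _ = _ := by field_simp
  have h2 : (ρ * ‖F z - F w‖) ^ 2 ≤ (s * ‖F z + (starRingEnd ℂ) (F w)‖) ^ 2 := by gcongr
  rw [mul_pow, mul_pow, nsq, nsq2] at h2
  have h3 : (ρ * ((F z).re - (F w).re)) ^ 2 ≤ (s * ((F z).re + (F w).re)) ^ 2 := by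
    have : s ^ 2 ≤ ρ ^ 2 := by gcongr
    nlinarith [sq_nonneg ((F z).im - (F w).im)]
  have h4 := abs_le_of_sq_le_sq' h3 (mul_nonneg hs0 (by linarith [h0 z hz, h0 w hw]))
  constructor <;> nlinarith [h4.1, h4.2]

namespace Sys
variable {S : Sys} {M B C : ℝ}

lemma pot_tendstoUniformlyOn (hc : S.Cst M B C) {x : ℤ → ℂ → ℂ} {N : ℤ} {U : Set ℂ}
    (ht : ∀ z ∈ U, S.Tame M (fun j => x j z) N) :
    TendstoUniformlyOn (fun (j : ℤ) z => LL M (fun j => x j z) j / S.D j)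
      (fun z => S.pot M (fun j => x j z)) atTop U := by
  rw [Metric.tendstoUniformlyOn_iff]
  intro ε hε
  have h1 : Tendsto (fun j => C / S.D j) atTop (𝓝 0) := S.tendsto_D.const_div_atTop C
  filter_upwards [h1.eventually_lt_const hε, eventually_ge_atTop N] with j hj hjN z hz
  refine lt_of_le_of_lt ?_ hj
  have := pot_bound hc (ht z hz) hjN
  have hD := S.Dpos j
  rw [Real.dist_eq, le_div_iff₀ hD, ← abs_of_pos hD, ← abs_mul, abs_of_pos hD, sub_mul,
    div_mul_cancel₀ _ hD.ne', mul_comm]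
  exact this

lemma pot_continuousOn (hc : S.Cst M B C) {x : ℤ → ℂ → ℂ} {N : ℤ} {U : Set ℂ}
    (hx : ∀ j, ContinuousOn (x j) U) (ht : ∀ z ∈ U, S.Tame M (fun j => x j z) N) :
    ContinuousOn (fun z => S.pot M (fun j => x j z)) U := by
  refine (pot_tendstoUniformlyOn hc ht).continuousOn (Eventually.frequently (Eventually.of_forall fun j => ?_))
  refine ContinuousOn.div_const (ContinuousOn.log ?_ ?_) _
  · exact ContinuousOn.sup continuousOn_const (hx j).norm
  · intro z _
    have : 0 < max M ‖x j z‖ := lt_max_of_lt_left (by linarith [hc.M2])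
    exact ne_of_gt this

/-- positive lower bound of pot forces large coordinates -/
lemma large_of_pot (hc : S.Cst M B C) {x : ℤ → ℂ} {N : ℤ} (ht : S.Tame M x N) {j : ℤ} (hj : N ≤ j)
    (h : Real.log M < S.D j * S.pot M x - C) : M < ‖x j‖ ∧ LL M x j = Real.log ‖x j‖ := by
  have h1 := (abs_le.1 (pot_bound hc ht hj)).2
  have hM := hc.M2
  have : M < ‖x j‖ := by
    by_contra hcon
    push Not at hcon
    have : LL M x j = Real.log M := by rw [LL, max_eq_left hcon]
    linarith
  exact ⟨this, by rw [LL, max_eq_right this.le]⟩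

lemma eventually_large (_hc : S.Cst M B C) {m : ℝ} (hm : 0 < m) :
    ∀ᶠ j in atTop, Real.log M < S.D j * m - C :=
  (tendsto_atTop_add_const_right _ _ (S.tendsto_D.atTop_mul_const hm)).eventually_gt_atTop _

lemma harnack_pot (hc : S.Cst M B C) {x : ℤ → ℂ → ℂ} {N : ℤ} {w : ℂ} {ρ : ℝ}
    (hx : ∀ j, DifferentiableOn ℂ (x j) (Metric.ball w ρ))
    (ht : ∀ z ∈ Metric.ball w ρ, S.Tame M (fun j => x j z) N)
    (hp : ∀ z ∈ Metric.ball w ρ, 0 < S.pot M (fun j => x j z)) {z : ℂ} (hz : z ∈ Metric.ball w ρ) :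
    S.pot M (fun j => x j w) * (ρ - dist z w) ≤ S.pot M (fun j => x j z) * (ρ + dist z w) ∧
    S.pot M (fun j => x j z) * (ρ - dist z w) ≤ S.pot M (fun j => x j w) * (ρ + dist z w) := by
  have hρ : 0 < ρ := lt_of_le_of_lt dist_nonneg hz
  have hw : w ∈ Metric.ball w ρ := Metric.mem_ball_self hρ
  have hcont := pot_continuousOn hc (fun j => (hx j).continuousOn) ht
  have key : ∀ ρ', dist z w < ρ' → ρ' < ρ →
    S.pot M (fun j => x j w) * (ρ' - dist z w) ≤ S.pot M (fun j => x j z) * (ρ' + dist z w) ∧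
    S.pot M (fun j => x j z) * (ρ' - dist z w) ≤ S.pot M (fun j => x j w) * (ρ' + dist z w) := by
    intro ρ' h1 h2
    have hsub : Metric.closedBall w ρ' ⊆ Metric.ball w ρ := Metric.closedBall_subset_ball h2
    have hρ' : 0 < ρ' := lt_of_le_of_lt dist_nonneg h1
    obtain ⟨z1, hz1, hmin⟩ := (isCompact_closedBall w ρ').exists_isMinOn
      ⟨w, Metric.mem_closedBall_self hρ'.le⟩ (hcont.mono hsub)
    have hm := hp z1 (hsub hz1)
    set m := S.pot M (fun j => x j z1) with hmdef
    have ev : ∀ᶠ n : ℤ in atTop,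
      (LL M (fun j => x j w) n / S.D n) * (ρ' - dist z w) ≤
        (LL M (fun j => x j z) n / S.D n) * (ρ' + dist z w) ∧
      (LL M (fun j => x j z) n / S.D n) * (ρ' - dist z w) ≤
        (LL M (fun j => x j w) n / S.D n) * (ρ' + dist z w) := by
      filter_upwards [eventually_large hc hm, eventually_ge_atTop N] with n hn hnN
      have hl : ∀ y ∈ Metric.ball w ρ', M < ‖x n y‖ ∧ LL M (fun j => x j y) n = Real.log ‖x n y‖ := by
        intro y hy
        have hy' := Metric.ball_subset_closedBall hy
        refine large_of_pot hc (ht y (hsub hy')) hnN (hn.trans_le ?_)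
        have : m ≤ S.pot M (fun j => x j y) := hmin hy'
        have := mul_le_mul_of_nonneg_left this (S.Dpos n).le
        linarith
      have hball : Metric.ball w ρ' ⊆ Metric.ball w ρ := Metric.ball_subset_closedBall.trans hsub
      obtain ⟨F, hF1, hF2⟩ := exists_log_ball ((hx n).mono hball) (fun y hy => by
        have := (hl y hy).1
        exact norm_pos_iff.1 (by linarith [hc.M2]))
      have hz' : z ∈ Metric.ball w ρ' := h1
      have hw' : w ∈ Metric.ball w ρ' := Metric.mem_ball_self hρ'
      have := harnack_holo (fun y hy => (hF1 y hy).differentiableAt.differentiableWithinAt) (fun y hy => by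
        rw [hF2 y hy]; exact Real.log_pos (by linarith [hc.M2, (hl y hy).1])) hz'
      rw [hF2 z hz', hF2 w hw', ← (hl z hz').2, ← (hl w hw').2] at this
      have hD := (S.Dpos n).le
      constructor
      · rw [div_mul_eq_mul_div, div_mul_eq_mul_div]; exact div_le_div_of_nonneg_right this.1 hD
      · rw [div_mul_eq_mul_div, div_mul_eq_mul_div]; exact div_le_div_of_nonneg_right this.2 hD
    have tw := pot_tendsto hc (ht w hw)
    have tz := pot_tendsto hc (ht z hz)
    exact ⟨le_of_tendsto_of_tendsto (tw.mul_const _) (tz.mul_const _) (ev.mono fun _ h => h.1),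
      le_of_tendsto_of_tendsto (tz.mul_const _) (tw.mul_const _) (ev.mono fun _ h => h.2)⟩
  have hz' : dist z w < ρ := hz
  have ev : ∀ᶠ ρ' in 𝓝[<] ρ, dist z w < ρ' ∧ ρ' < ρ := by
    have h1 : ∀ᶠ ρ' in 𝓝[<] ρ, ρ' ∈ Ioo (dist z w) ρ := Ioo_mem_nhdsLT hz'
    exact h1
  have tid : Tendsto (fun ρ' : ℝ => ρ') (𝓝[<] ρ) (𝓝 ρ) := tendsto_id.mono_left nhdsWithin_le_nhds
  exact ⟨le_of_tendsto_of_tendsto ((tid.sub_const _).const_mul _) ((tid.add_const _).const_mul _)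
      (ev.mono fun r h => (key r h.1 h.2).1),
    le_of_tendsto_of_tendsto ((tid.sub_const _).const_mul _) ((tid.add_const _).const_mul _)
      (ev.mono fun r h => (key r h.1 h.2).2)⟩

end Sys


lemma PL_upper {f : ℂ → ℂ} (hd : ∀ z : ℂ, 0 ≤ z.im → DifferentiableAt ℂ f z) {A K K2 : ℝ}
    (hexp : ∀ z : ℂ, 0 ≤ z.im → ‖f z‖ ≤ Real.exp (A * (1 + ‖z‖)))
    (hre : ∀ t : ℝ, ‖f t‖ ≤ K) (him : ∀ y : ℝ, 0 ≤ y → ‖f (y * Complex.I)‖ ≤ K2)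
    {z : ℂ} (hz : 0 ≤ z.im) : ‖f z‖ ≤ K := by
  have hI : ∀ w : ℂ, (Complex.I * w).im = w.re := by intro w; simp
  have hcl : closure {w : ℂ | 0 < w.re} ⊆ {w : ℂ | 0 ≤ w.re} :=
    closure_minimal (fun w (hw : 0 < w.re) => hw.le) (isClosed_le continuous_const Complex.continuous_re)
  have hdi : DifferentiableOn ℂ (fun w => f (Complex.I * w)) (closure {w : ℂ | 0 < w.re}) := by
    intro w hw
    have h0 : 0 ≤ (Complex.I * w).im := by rw [hI]; exact hcl hw
    exact ((hd _ h0).comp w (differentiableAt_id.const_mul _)).differentiableWithinAt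
  have := PhragmenLindelof.right_half_plane_of_bounded_on_real (f := fun w => f (Complex.I * w))
    (C := K) (z := -Complex.I * z) hdi.diffContOnCl ⟨1, by norm_num, |A|, ?_⟩ ?_ ?_ ?_
  · have e : Complex.I * (-Complex.I * z) = z := by
      rw [← mul_assoc, mul_neg, Complex.I_mul_I]; simp
    simpa only [e] using this
  · refine Asymptotics.IsBigO.of_bound (Real.exp |A|) ?_
    rw [eventually_inf_principal]
    refine Eventually.of_forall fun w hw => ?_
    have h0 : 0 ≤ (Complex.I * w).im := by rw [hI]; exact le_of_lt hw
    refine (hexp _ h0).trans ?_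
    rw [Real.norm_eq_abs, Real.abs_exp, ← Real.exp_add, Real.exp_le_exp]
    simp only [norm_mul, Complex.norm_I, one_mul, Real.rpow_one]
    have := mul_le_mul_of_nonneg_right (le_abs_self A) (show 0 ≤ 1 + ‖w‖ by positivity)
    linarith
  · refine ⟨K2, ?_⟩
    rw [eventually_map]
    filter_upwards [eventually_ge_atTop 0] with y hy
    rw [mul_comm]; exact him y hy
  · intro y
    have : Complex.I * (y * Complex.I) = ((-y : ℝ) : ℂ) := by
      push_cast; linear_combination (y : ℂ) * Complex.I_mul_I
    rw [this]; exact hre _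
  · simpa using hz

namespace Sys
variable {S : Sys} {M B C : ℝ}

/-- The limit families. -/
structure Lim (S : Sys) (M A : ℝ) (x : ℤ → ℂ → ℂ) : Prop where
  A0 : 0 ≤ A
  ent : ∀ j, Differentiable ℂ (x j)
  tame : ∀ z N, S.Tame M (fun j => x j z) N
  real : ∀ t : ℝ, S.pot M (fun j => x j t) = 0
  growth : ∀ z, S.pot M (fun j => x j z) ≤ A * (1 + ‖z‖)
  up : (∀ z : ℂ, 0 < z.im → S.pot M (fun j => x j z) = 0) ∨
    (∀ z : ℂ, 0 < z.im → 0 < S.pot M (fun j => x j z))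
  down : (∀ z : ℂ, z.im < 0 → S.pot M (fun j => x j z) = 0) ∨
    (∀ z : ℂ, z.im < 0 → 0 < S.pot M (fun j => x j z))

variable {A : ℝ} {x : ℤ → ℂ → ℂ}

lemma Lim.flip (h : S.Lim M A x) : S.Lim M A (fun j z => x j (-z)) where
  A0 := h.A0
  ent j := (h.ent j).comp differentiable_neg
  tame z N := h.tame (-z) N
  real t := by have := h.real (-t); push_cast at this; exact this
  growth z := by have := h.growth (-z); rwa [norm_neg] at this
  up := by
    rcases h.down with h | h
    · exact Or.inl fun z hz => h (-z) (by simpa using hz)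
    · exact Or.inr fun z hz => h (-z) (by simpa using hz)
  down := by
    rcases h.up with h | h
    · exact Or.inl fun z hz => h (-z) (by simpa using hz)
    · exact Or.inr fun z hz => h (-z) (by simpa using hz)

lemma Lim.D1 (hc : S.Cst M B C) (h : S.Lim M A x) {z : ℂ} (hz : 0 ≤ z.im) :
    S.pot M (fun j => x j z) ≤ A * z.im := by
  have hA := h.A0
  have key : ∀ j, ‖x j z‖ ≤ Real.exp (C + S.D j * A * z.im) := by
    intro j
    have hD := S.Dpos j
    set κ := S.D j * A with hκ
    have hκ0 : 0 ≤ κ := by positivity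
    have hn : ∀ w : ℂ, ‖Complex.exp (Complex.I * κ * w)‖ = Real.exp (-(κ * w.im)) := by
      intro w; rw [Complex.norm_exp]; congr 1; simp
    have hb : ∀ w, ‖x j w‖ ≤ Real.exp (κ * (1 + ‖w‖) + C) := by
      intro w
      refine (norm_le_exp hc (h.tame w j) le_rfl).trans (Real.exp_le_exp.2 ?_)
      have := mul_le_mul_of_nonneg_left (h.growth w) hD.le
      rw [hκ]; linarith
    have := PL_upper (f := fun w => x j w * Complex.exp (Complex.I * κ * w)) (A := κ + C)
      (K := Real.exp C) (K2 := Real.exp (κ + C)) ?_ ?_ ?_ ?_ hz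
    · rw [norm_mul, hn] at this
      rw [Real.exp_add]
      have h2 := mul_le_mul_of_nonneg_right this (Real.exp_pos (κ * z.im)).le
      rwa [mul_assoc, ← Real.exp_add, neg_add_cancel, Real.exp_zero, mul_one] at h2
    · intro w _
      exact ((h.ent j) w).mul (by fun_prop)
    · intro w hw
      rw [norm_mul, hn]
      calc _ ≤ Real.exp (κ * (1 + ‖w‖) + C) * 1 := by
            gcongr
            · exact hb w
            · rw [Real.exp_le_one_iff]; nlinarith
        _ ≤ _ := by
            rw [mul_one, Real.exp_le_exp]; nlinarith [norm_nonneg w, hc.C0]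
    · intro t
      rw [norm_mul, hn]
      have := norm_le_exp hc (h.tame t j) le_rfl
      rw [h.real] at this
      simpa using this
    · intro y hy
      rw [norm_mul, hn]
      have := hb (y * Complex.I)
      rw [norm_mul, Complex.norm_I, Complex.norm_real, Real.norm_of_nonneg hy] at this
      calc _ ≤ Real.exp (κ * (1 + y * 1) + C) * Real.exp (-(κ * (y * Complex.I).im)) := by gcongr
        _ = _ := by rw [← Real.exp_add]; congr 1; simp; ring
  have h1 : ∀ j, LL M (fun j => x j z) j / S.D j ≤ (Real.log M + C) / S.D j + A * z.im := by
    intro j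
    have hD := S.Dpos j
    have hM := hc.M2
    have hlM : 0 ≤ Real.log M := Real.log_nonneg (by linarith)
    have hk0 : 0 ≤ C + S.D j * A * z.im := by have := hc.C0; positivity
    have : LL M (fun j => x j z) j ≤ Real.log M + (C + S.D j * A * z.im) := by
      rw [LL, ← Real.log_exp (C + S.D j * A * z.im), ← Real.log_mul (by linarith) (Real.exp_ne_zero _)]
      refine Real.log_le_log (lt_max_of_lt_left (by linarith)) (max_le ?_ ?_)
      · have := Real.one_le_exp hk0; nlinarith
      · have := key j
        nlinarith [Real.exp_pos (C + S.D j * A * z.im)]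
    rw [div_add' _ _ _ hD.ne']
    gcongr
    linarith
  refine le_of_tendsto_of_tendsto' (pot_tendsto hc (h.tame z 0)) ?_ h1
  have := (S.tendsto_D.const_div_atTop (Real.log M + C)).add_const (A * z.im)
  simpa using this

lemma Lim.D1' (hc : S.Cst M B C) (h : S.Lim M A x) (z : ℂ) :
    S.pot M (fun j => x j z) ≤ A * |z.im| := by
  rcases le_total 0 z.im with hz | hz
  · rw [abs_of_nonneg hz]; exact h.D1 hc hz
  · rw [abs_of_nonpos hz]
    have := h.flip.D1 hc (z := -z) (by simpa using hz)
    simpa using this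

/-- normalized logarithmic derivative -/
def ell (S : Sys) (x : ℤ → ℂ → ℂ) (m : ℤ) (z : ℂ) : ℂ := deriv (x m) z / (S.D m * x m z)

def ellLim (S : Sys) (x : ℤ → ℂ → ℂ) (z : ℂ) : ℂ := limUnder atTop (fun m : ℤ => ell S x m z)

lemma Lim.D2step (hc : S.Cst M B C) (h : S.Lim M A x) {z : ℂ} {δ R : ℝ} (hδ : 0 < δ) (hR : M ≤ R)
    {m : ℤ} (hb : ∀ w ∈ Metric.closedBall z δ, R ≤ ‖x m w‖) :
    ‖ell S x (m+1) z - ell S x m z‖ ≤ 2 * B / (R * δ * S.D (m+1)) := by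
  have hM := hc.M2
  have hR0 : 0 < R := by linarith
  have hne : ∀ w ∈ Metric.closedBall z δ, x m w ≠ 0 := fun w hw =>
    norm_pos_iff.1 (hR0.trans_le (hb w hw))
  set l := (S.p m).leadingCoeff with hl
  have hl0 : l ≠ 0 := S.lc_ne m
  set q := fun w => x (m+1) w / (l * x m w ^ (S.d m)) with hq
  have hq1 : ∀ w ∈ Metric.closedBall z δ, ‖q w - 1‖ ≤ B / R := by
    intro w hw
    have ht := h.tame w m
    have hMx : M ≤ ‖x m w‖ := hR.trans (hb w hw)
    have h1 := ht.ini
    rw [max_eq_right hMx] at h1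
    have := hc.step2 m _ _ hMx h1
    have e : x (m+1) w = _ := ht.orb m
    rw [← e] at this
    refine this.trans ?_
    exact div_le_div_of_nonneg_left hc.B0 hR0 (hb w hw)
  have hzb : z ∈ Metric.closedBall z δ := Metric.mem_closedBall_self hδ.le
  have hqd : DifferentiableOn ℂ q (Metric.closedBall z δ) := by
    refine DifferentiableOn.div (h.ent _).differentiableOn ?_ ?_
    · exact (((h.ent m).pow _).const_mul _).differentiableOn
    · intro w hw; exact mul_ne_zero hl0 (pow_ne_zero _ (hne w hw))
  have hC : ‖deriv (fun w => q w - 1) z‖ ≤ (B / R) / δ := by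
    refine Complex.norm_deriv_le_of_forall_mem_sphere_norm_le hδ ?_ ?_
    · exact (hqd.sub_const 1).diffContOnCl_ball subset_rfl
    · intro w hw; exact hq1 w (Metric.sphere_subset_closedBall hw)
  rw [deriv_sub_const] at hC
  have hqz : 1 / 2 ≤ ‖q z‖ := by
    have h1 := (hq1 z hzb).trans ((div_le_div_of_nonneg_left hc.B0 (by linarith) hR).trans hc.BM)
    have : ‖(1:ℂ)‖ ≤ ‖q z‖ + ‖q z - 1‖ := by
      have := norm_sub_le (q z) (q z - 1); simpa using this
    simp at this; linarith
  have hx0 := hne z hzb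
  have hx1 : x (m+1) z ≠ 0 := by
    intro h0
    simp [hq, h0] at hqz
    norm_num at hqz
  have hD0 : (S.D m : ℂ) ≠ 0 := by exact_mod_cast (S.Dpos m).ne'
  have hd0 : (S.d m : ℂ) ≠ 0 := by
    have := S.deg m; simp only [d]; norm_cast; omega
  have hqderiv : deriv q z = q z * (S.D (m+1) * (ell S x (m+1) z - ell S x m z)) := by
    have h1 := ((h.ent (m+1)) z).hasDerivAt
    have h2 := ((h.ent m) z).hasDerivAt
    have h3 := h1.div ((h2.pow (S.d m)).const_mul l) (mul_ne_zero hl0 (pow_ne_zero _ hx0))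
    have h4 : deriv q z = _ := h3.deriv
    rw [h4]
    simp only [hq, ell]
    have e : (S.D (m+1) : ℂ) = S.d m * S.D m := by
      have := S.Dsucc m; rw [this]; push_cast; rfl
    rw [e]
    obtain ⟨k, hk⟩ : ∃ k, S.d m = k + 1 := ⟨S.d m - 1, by have := S.deg m; simp only [d]; omega⟩
    rw [hk] at hd0 ⊢
    simp only [Pi.pow_apply, add_tsub_cancel_right]
    field_simp
    ring
  have hDp := S.Dpos (m+1)
  rw [hqderiv, norm_mul, norm_mul, Complex.norm_real, Real.norm_of_nonneg hDp.le] at hC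
  set N := ‖ell S x (m+1) z - ell S x m z‖ with hN
  have : 1 / 2 * (S.D (m+1) * N) ≤ B / R / δ := le_trans (by gcongr) hC
  rw [le_div_iff₀ (by positivity)]
  rw [div_div, le_div_iff₀ (by positivity)] at this
  linarith

lemma Lim.D2 (hc : S.Cst M B C) (h : S.Lim M A x) {z : ℂ} {δ R : ℝ} (hδ : 0 < δ) (hR : M ≤ R)
    {n : ℤ} (hb : ∀ w ∈ Metric.closedBall z δ, R ≤ ‖x n w‖) :
    Tendsto (fun m : ℤ => ell S x m z) atTop (𝓝 (ellLim S x z)) ∧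
    ‖ellLim S x z - ell S x n z‖ ≤ 2 * B / (R * δ * S.D n) := by
  have hM := hc.M2
  have hR0 : 0 < R := by linarith
  have hDn := S.Dpos n
  have hB := hc.B0
  have st : ∀ i : ℕ, dist (ell S x (n + i) z) (ell S x (n + (i+1:ℕ)) z) ≤
      (2 * B / (R * δ * S.D n)) / 2 / 2 ^ i := by
    intro i
    have h1 := h.D2step hc (z := z) (m := n + i) hδ hR (fun w hw => (hb w hw).trans
      ((h.tame w n).grow' hc le_rfl (hR.trans (hb w hw)) (by omega)))
    rw [dist_comm, dist_eq_norm]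
    push_cast
    rw [← add_assoc]
    refine h1.trans ?_
    have := S.D_two_pow n (i+1)
    push_cast at this; rw [← add_assoc] at this
    rw [div_div, div_div]
    refine div_le_div_of_nonneg_left (by positivity) (by positivity) ?_
    calc R * δ * S.D n * (2 * 2 ^ i) = R * δ * (2 ^ (i+1) * S.D n) := by ring
      _ ≤ _ := by gcongr
  obtain ⟨l, hl⟩ := cauchySeq_tendsto_of_complete (cauchySeq_of_le_geometric_two st)
  have hd := dist_le_of_le_geometric_two_of_tendsto₀ st hl
  have h2 : Tendsto (fun i : ℤ => (i - n).toNat) atTop atTop := by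
    refine tendsto_atTop.2 fun b => ?_
    filter_upwards [eventually_ge_atTop (n + b)] with i hi
    omega
  have h3 : Tendsto (fun m : ℤ => ell S x m z) atTop (𝓝 l) := by
    refine (hl.comp h2).congr' ?_
    filter_upwards [eventually_ge_atTop n] with i hi
    have : n + ((i - n).toNat : ℤ) = i := by omega
    simp only [Function.comp, this]
  have e : ellLim S x z = l := h3.limUnder_eq
  rw [e]
  refine ⟨h3, ?_⟩
  simpa [dist_comm, dist_eq_norm] using hd

end Sys


def upperH : Set ℂ := {z : ℂ | 0 < z.im}

lemma isOpen_upper : IsOpen upperH := isOpen_lt continuous_const Complex.continuous_im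

lemma convex_upper : Convex ℝ upperH := convex_halfSpace_im_gt 0

lemma mem_upper_of_ball {z0 w : ℂ} {r : ℝ} (h : w ∈ Metric.closedBall z0 r) (hr : r < z0.im) :
    0 < w.im := by
  have h1 : |(w - z0).im| ≤ ‖w - z0‖ := Complex.abs_im_le_norm _
  rw [Metric.mem_closedBall, dist_eq_norm] at h
  have := (abs_le.1 (h1.trans h)).1
  simp at this
  linarith

/-- primitive on the upperH half plane through the Cayley transform -/
lemma exists_primitive_upper {f : ℂ → ℂ} (hf : DifferentiableOn ℂ f upperH) :
    ∃ h : ℂ → ℂ, ∀ z ∈ upperH, HasDerivAt h (f z) z := by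
  have hphi : ∀ w ∈ Metric.ball (0:ℂ) 1, Complex.I * (1 + w) / (1 - w) ∈ upperH ∧ 1 - w ≠ 0 := by
    intro w hw
    rw [mem_ball_zero_iff] at hw
    have h1 : Complex.normSq w < 1 := by
      rw [← Complex.sq_norm]; nlinarith [norm_nonneg w]
    have h0 : 1 - w ≠ 0 := by
      intro h
      have : w = 1 := by linear_combination -h
      simp [this] at hw
    refine ⟨?_, h0⟩
    have hns := Complex.normSq_pos.2 h0
    show 0 < (Complex.I * (1 + w) / (1 - w)).im
    rw [Complex.div_im]
    simp only [Complex.normSq_apply] at h1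
    have : (Complex.I * (1 + w)).im * (1 - w).re / Complex.normSq (1 - w) -
      (Complex.I * (1 + w)).re * (1 - w).im / Complex.normSq (1 - w) =
      (1 - (w.re * w.re + w.im * w.im)) / Complex.normSq (1 - w) := by
      rw [← sub_div]; congr 1; simp; ring
    rw [this]
    exact div_pos (by linarith) hns
  set g := fun w : ℂ => f (Complex.I * (1 + w) / (1 - w)) * (2 * Complex.I / (1 - w) ^ 2) with hg
  have hgd : DifferentiableOn ℂ g (Metric.ball 0 1) := by
    intro w hw
    obtain ⟨h1, h2⟩ := hphi w hw
    have e1 : DifferentiableAt ℂ (fun w : ℂ => Complex.I * (1 + w) / (1 - w)) w := by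
      fun_prop (disch := exact h2)
    have e2 : DifferentiableAt ℂ f (Complex.I * (1 + w) / (1 - w)) :=
      hf.differentiableAt (isOpen_upper.mem_nhds h1)
    have e3 : DifferentiableAt ℂ (fun w : ℂ => 2 * Complex.I / (1 - w) ^ 2) w := by
      fun_prop (disch := exact pow_ne_zero _ h2)
    exact ((e2.comp w e1).mul e3).differentiableWithinAt
  obtain ⟨G, hG⟩ := hgd.isExactOn_ball
  refine ⟨fun z => G ((z - Complex.I) / (z + Complex.I)), fun z hz => ?_⟩
  have hz' : 0 < z.im := hz
  have hzI : z + Complex.I ≠ 0 := by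
    intro h
    have := congrArg Complex.im h
    simp at this; linarith
  have hmem : (z - Complex.I) / (z + Complex.I) ∈ Metric.ball (0:ℂ) 1 := by
    rw [mem_ball_zero_iff, norm_div, div_lt_one (norm_pos_iff.2 hzI)]
    refine lt_of_pow_lt_pow_left₀ 2 (norm_nonneg _) ?_
    rw [Complex.sq_norm, Complex.sq_norm, Complex.normSq_apply, Complex.normSq_apply]
    simp; nlinarith
  have hd := hG _ hmem
  have hpsi : HasDerivAt (fun z : ℂ => (z - Complex.I) / (z + Complex.I))
      ((1 * (z + Complex.I) - (z - Complex.I) * 1) / (z + Complex.I) ^ 2) z :=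
    ((hasDerivAt_id z).sub_const _).div ((hasDerivAt_id z).add_const _) hzI
  refine (hd.comp z hpsi).congr_deriv ?_
  have h2I : (2 * Complex.I) ≠ 0 := by simp
  have e1 : 1 - (z - Complex.I) / (z + Complex.I) = 2 * Complex.I / (z + Complex.I) := by
    field_simp; ring
  have e2 : Complex.I * (1 + (z - Complex.I) / (z + Complex.I)) / (1 - (z - Complex.I) / (z + Complex.I)) = z := by
    rw [e1]
    field_simp; ring
  simp only [hg]
  rw [e2, e1]
  field_simp
  ring

namespace Sys
variable {S : Sys} {M B C : ℝ}
variable {A : ℝ} {x : ℤ → ℂ → ℂ}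

lemma Lim.cont (hc : S.Cst M B C) (h : S.Lim M A x) :
    Continuous (fun z => S.pot M (fun j => x j z)) := by
  rw [← continuousOn_univ]
  exact pot_continuousOn hc (N := 0) (fun j => (h.ent j).continuous.continuousOn) (fun z _ => h.tame z 0)

lemma Lim.D3a (hc : S.Cst M B C) (h : S.Lim M A x)
    (hu : ∀ z : ℂ, 0 < z.im → 0 < S.pot M (fun j => x j z)) {z0 : ℂ} (hz0 : z0 ∈ upperH) :
    ∃ δ > 0, Metric.ball z0 δ ⊆ upperH ∧
      TendstoUniformlyOn (ell S x) (ellLim S x) atTop (Metric.ball z0 δ) ∧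
      ∀ᶠ m in atTop, ∀ w ∈ Metric.ball z0 δ, x m w ≠ 0 ∧
        LL M (fun j => x j w) m = Real.log ‖x m w‖ := by
  have hz : 0 < z0.im := hz0
  set δ := z0.im / 3 with hδ
  have hδ0 : 0 < δ := by positivity
  have hsub : ∀ w ∈ Metric.closedBall z0 (2 * δ), 0 < w.im := fun w hw =>
    mem_upper_of_ball hw (by linarith)
  obtain ⟨z1, hz1, hmin⟩ := (isCompact_closedBall z0 (2 * δ)).exists_isMinOn
      ⟨z0, Metric.mem_closedBall_self (by positivity)⟩ (h.cont hc).continuousOn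
  have hm := hu z1 (hsub z1 hz1)
  have hlarge : ∀ᶠ m in atTop, ∀ w ∈ Metric.closedBall z0 (2 * δ), M < ‖x m w‖ ∧
        LL M (fun j => x j w) m = Real.log ‖x m w‖ := by
    filter_upwards [eventually_large hc hm] with m hm1 w hw
    refine large_of_pot hc (h.tame w m) le_rfl (hm1.trans_le ?_)
    have : S.pot M (fun j => x j z1) ≤ S.pot M (fun j => x j w) := hmin hw
    have := mul_le_mul_of_nonneg_left this (S.Dpos m).le
    linarith
  have hM := hc.M2
  refine ⟨δ, hδ0, fun w hw => hsub w ?_, ?_, ?_⟩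
  · exact Metric.closedBall_subset_closedBall (by linarith) (Metric.ball_subset_closedBall hw)
  · rw [Metric.tendstoUniformlyOn_iff]
    intro ε hε
    have ht : Tendsto (fun m => (2 * B / (M * δ)) / S.D m) atTop (𝓝 0) := S.tendsto_D.const_div_atTop _
    filter_upwards [hlarge, ht.eventually_lt_const hε] with m hm1 hm2 w hw
    have := (h.D2 hc (z := w) (δ := δ) (R := M) (n := m) hδ0 le_rfl (fun y hy => (hm1 y ?_).1.le)).2
    · rw [dist_eq_norm]
      refine this.trans_lt ?_
      rwa [div_div] at hm2
    · rw [Metric.mem_closedBall] at hy ⊢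
      have := Metric.mem_ball.1 hw
      linarith [dist_triangle y w z0]
  · filter_upwards [hlarge] with m hm1 w hw
    have := hm1 w (Metric.closedBall_subset_closedBall (by linarith) (Metric.ball_subset_closedBall hw))
    exact ⟨norm_pos_iff.1 (by linarith [this.1]), this.2⟩

lemma Lim.ell_diff (hc : S.Cst M B C) (h : S.Lim M A x)
    (hu : ∀ z : ℂ, 0 < z.im → 0 < S.pot M (fun j => x j z)) :
    DifferentiableOn ℂ (ellLim S x) upperH := by
  intro z0 hz0
  obtain ⟨δ, hδ, hsub, htu, hev⟩ := h.D3a hc hu hz0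
  have : DifferentiableOn ℂ (ellLim S x) (Metric.ball z0 δ) := by
    refine htu.tendstoLocallyUniformlyOn.differentiableOn ?_ Metric.isOpen_ball
    filter_upwards [hev] with m hm
    refine DifferentiableOn.div ?_ ?_ ?_
    · exact (((h.ent m).differentiableOn (s := Set.univ)).deriv isOpen_univ).mono (subset_univ _)
    · exact ((h.ent m).const_mul _).differentiableOn
    · intro w hw
      have hD0 : (S.D m : ℂ) ≠ 0 := by exact_mod_cast (S.Dpos m).ne'
      exact mul_ne_zero hD0 (hm w hw).1
  exact (this.differentiableAt (Metric.ball_mem_nhds _ hδ)).differentiableWithinAt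

lemma Lim.D3 (hc : S.Cst M B C) (h : S.Lim M A x)
    (hu : ∀ z : ℂ, 0 < z.im → 0 < S.pot M (fun j => x j z)) :
    ∃ g : ℂ → ℂ, (∀ z ∈ upperH, HasDerivAt g (ellLim S x z) z) ∧
      ∀ z ∈ upperH, (g z).re = S.pot M (fun j => x j z) := by
  obtain ⟨g, hg⟩ := exists_primitive_upper (h.ell_diff hc hu)
  set v := fun z => S.pot M (fun j => x j z) with hv
  have hloc : ∀ z0 ∈ upperH, ∃ δ > 0, ∀ w ∈ Metric.ball z0 δ, v w - (g w).re = v z0 - (g z0).re := by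
    intro z0 hz0
    obtain ⟨δ, hδ, hsub, htu, hev⟩ := h.D3a hc hu hz0
    refine ⟨δ, hδ, fun w hw => ?_⟩
    have hz0b : z0 ∈ Metric.ball z0 δ := Metric.mem_ball_self hδ
    have key : ∀ ε > 0, |(v w - (g w).re) - (v z0 - (g z0).re)| ≤ ε * ‖w - z0‖ := by
      intro ε hε
      have hev2 : ∀ᶠ m in atTop, |(LL M (fun j => x j w) m / S.D m - (g w).re) -
          (LL M (fun j => x j z0) m / S.D m - (g z0).re)| ≤ ε * ‖w - z0‖ := by
        filter_upwards [hev, (Metric.tendstoUniformlyOn_iff.1 htu) ε hε] with m hm1 hm2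
        obtain ⟨F, hF1, hF2⟩ := exists_log_ball ((h.ent m).differentiableOn (s := Metric.ball z0 δ))
          (fun y hy => (hm1 y hy).1)
        have hD := S.Dpos m
        have hD0 : (S.D m : ℂ) ≠ 0 := by exact_mod_cast hD.ne'
        have hk : ∀ y ∈ Metric.ball z0 δ, HasDerivWithinAt (fun y => F y / S.D m - g y)
            (ell S x m y - ellLim S x y) (Metric.ball z0 δ) y := by
          intro y hy
          refine (((hF1 y hy).div_const _).sub (hg y (hsub hy))).hasDerivWithinAt.congr_deriv ?_
          rw [ell, div_div, mul_comm (x m y)]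
        have := (convex_ball z0 δ).norm_image_sub_le_of_norm_hasDerivWithin_le (C := ε) hk
          (fun y hy => by
            have := hm2 y hy
            rw [dist_comm, dist_eq_norm] at this
            exact this.le) hz0b hw
        refine le_trans ?_ this
        refine le_trans (le_of_eq ?_) (Complex.abs_re_le_norm _)
        congr 1
        have e : ∀ y ∈ Metric.ball z0 δ, (F y / S.D m - g y).re = LL M (fun j => x j y) m / S.D m - (g y).re := by
          intro y hy
          rw [Complex.sub_re, Complex.div_ofReal_re, hF2 y hy, (hm1 y hy).2]
        rw [Complex.sub_re, e w hw, e z0 hz0b]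
      refine le_of_tendsto ?_ hev2
      exact (((pot_tendsto hc (h.tame w 0)).sub_const _).sub
        ((pot_tendsto hc (h.tame z0 0)).sub_const _)).abs
    have h0 : |(v w - (g w).re) - (v z0 - (g z0).re)| ≤ 0 := by
      have ht : Tendsto (fun ε : ℝ => ε * ‖w - z0‖) (𝓝[>] 0) (𝓝 (0 * ‖w - z0‖)) :=
        (tendsto_id.mono_left nhdsWithin_le_nhds).mul_const _
      rw [zero_mul] at ht
      exact ge_of_tendsto ht (eventually_nhdsWithin_of_forall fun ε hε => key ε hε)
    have := abs_nonpos_iff.1 h0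
    linarith
  have hI : Complex.I ∈ upperH := by simp [upperH]
  have hconst : ∀ z ∈ upperH, v z - (g z).re = v Complex.I - (g Complex.I).re := by
    intro z hz
    have hfd : ∀ y ∈ upperH, HasFDerivAt (𝕜 := ℝ) (fun z => v z - (g z).re) 0 y := by
      intro y hy
      obtain ⟨δ, hδ, hd⟩ := hloc y hy
      refine (hasFDerivAt_const (v y - (g y).re) y).congr_of_eventuallyEq ?_
      filter_upwards [Metric.ball_mem_nhds y hδ] with w hw
      exact hd w hw
    exact convex_upper.is_const_of_fderivWithin_eq_zero (𝕜 := ℝ)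
      (fun y hy => (hfd y hy).differentiableAt.differentiableWithinAt)
      (fun y hy => by rw [fderivWithin_of_isOpen isOpen_upper hy, (hfd y hy).fderiv]) hz hI
  refine ⟨fun z => g z + ((v Complex.I - (g Complex.I).re : ℝ) : ℂ), fun z hz => (hg z hz).add_const _,
    fun z hz => ?_⟩
  rw [Complex.add_re, Complex.ofReal_re]
  have := hconst z hz
  show _ = v z
  linarith

end Sys

namespace Sys
variable {S : Sys} {M B C : ℝ}
variable {A : ℝ} {x : ℤ → ℂ → ℂ}

lemma Lim.D4a (hc : S.Cst M B C) (h : S.Lim M A x)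
    (hu : ∀ z : ℂ, 0 < z.im → 0 < S.pot M (fun j => x j z)) (t : ℝ) {z : ℂ} (hz : z ∈ upperH) :
    S.pot M (fun j => x j (z + t)) ≤ S.pot M (fun j => x j z) := by
  obtain ⟨g, hg1, hg2⟩ := h.D3 hc hu
  set v := fun z => S.pot M (fun j => x j z) with hv
  have hA := h.A0
  have hv0 : ∀ z, 0 ≤ v z := fun z => pot_nonneg hc (h.tame z 0)
  have hvA : ∀ z : ℂ, 0 ≤ z.im → v z ≤ A * z.im := fun z hz => h.D1 hc hz
  have hz' : 0 < z.im := hz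
  have key : ∀ ε, 0 < ε → ε < z.im → v (z + t) - v z ≤ A * ε := by
    intro ε hε hεz
    have hmem : ∀ w : ℂ, 0 ≤ w.im → w + ε * Complex.I ∈ upperH ∧ w + ε * Complex.I + t ∈ upperH := by
      intro w hw
      constructor <;> (show 0 < Complex.im _; simp; linarith)
    set k := fun w : ℂ => Complex.exp (g (w + ε * Complex.I + t) - g (w + ε * Complex.I)) with hk
    have hkn : ∀ w : ℂ, 0 ≤ w.im → ‖k w‖ = Real.exp (v (w + ε * Complex.I + t) - v (w + ε * Complex.I)) := by
      intro w hw
      obtain ⟨h1, h2⟩ := hmem w hw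
      simp only [hk]
      rw [Complex.norm_exp, Complex.sub_re, hg2 _ h1, hg2 _ h2]
    have him : ∀ w : ℂ, (w + ε * Complex.I + t).im = w.im + ε := by intro w; simp
    have him2 : ∀ w : ℂ, (w + ε * Complex.I).im = w.im + ε := by intro w; simp
    have := PL_upper (f := k) (A := A * (1 + ε)) (K := Real.exp (A * ε)) (K2 := Real.exp (2 * A * |t|))
      (z := z - ε * Complex.I) ?_ ?_ ?_ ?_ ?_
    · rw [hkn _ (by simp; linarith), Real.exp_le_exp] at this
      simpa using this
    · intro w hw
      obtain ⟨h1, h2⟩ := hmem w hw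
      have d1 : DifferentiableAt ℂ (fun w : ℂ => g (w + ε * Complex.I + t)) w :=
        (hg1 _ h2).differentiableAt.comp w (by fun_prop)
      have d2 : DifferentiableAt ℂ (fun w : ℂ => g (w + ε * Complex.I)) w :=
        (hg1 _ h1).differentiableAt.comp w (by fun_prop)
      exact (d1.sub d2).cexp
    · intro w hw
      rw [hkn w hw, Real.exp_le_exp]
      have h1 := hvA (w + ε * Complex.I + t) (by rw [him]; linarith)
      rw [him] at h1
      have h2 := hv0 (w + ε * Complex.I)
      have h3 : w.im ≤ ‖w‖ := (le_abs_self _).trans (Complex.abs_im_le_norm w)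
      have h4 : w.im + ε ≤ (1 + ε) * (1 + ‖w‖) := by nlinarith [norm_nonneg w]
      have h5 := mul_le_mul_of_nonneg_left h4 hA
      linarith
    · intro s
      rw [hkn _ (by simp), Real.exp_le_exp]
      have h1 := hvA ((s:ℂ) + ε * Complex.I + t) (by rw [him]; simp; linarith)
      rw [him] at h1
      have h2 := hv0 ((s:ℂ) + ε * Complex.I)
      simp at h1
      linarith
    · intro y hy
      rw [hkn _ (by simpa using hy), Real.exp_le_exp]
      set w := (y:ℂ) * Complex.I + ε * Complex.I with hw
      have hwim : w.im = y + ε := by simp [hw]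
      have hwpos : 0 < w.im := by rw [hwim]; linarith
      have hwt : (w + t).im = w.im := by simp
      have e1 := hvA (w + t) (by rw [hwt]; exact hwpos.le)
      have e2 := hvA w hwpos.le
      rw [hwt] at e1
      have e0 := hv0 w
      have ht0 := abs_nonneg t
      rcases le_or_gt w.im |t| with hcase | hcase
      · have := mul_le_mul_of_nonneg_left hcase hA
        nlinarith
      · have hd : dist (w + t) w = |t| := by simp [dist_eq_norm]
        have hH := (harnack_pot hc (x := x) (N := 0) (w := w) (ρ := w.im) (z := w + t)
          (fun j => (h.ent j).differentiableOn) (fun z _ => h.tame z 0) (fun z hz => hu z ?_) ?_).2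
        · rw [hd] at hH
          change v (w + t) * (w.im - |t|) ≤ v w * (w.im + |t|) at hH
          have : (v (w + t) - v w) * w.im ≤ (2 * A * |t|) * w.im := by nlinarith
          exact le_of_mul_le_mul_right this hwpos
        · rw [Metric.mem_ball, dist_eq_norm] at hz
          have h1 := (Complex.abs_im_le_norm (z - w)).trans_lt hz
          have := (abs_lt.1 h1).1
          simp at this; linarith
        · rw [Metric.mem_ball, hd]; exact hcase
    · simp; linarith
  have ht : Tendsto (fun ε : ℝ => A * ε) (𝓝[>] 0) (𝓝 (A * 0)) :=
    (tendsto_id.mono_left nhdsWithin_le_nhds).const_mul _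
  rw [mul_zero] at ht
  have : v (z + t) - v z ≤ 0 := by
    refine ge_of_tendsto ht ?_
    filter_upwards [Ioo_mem_nhdsGT hz'] with ε hε
    exact key ε hε.1 hε.2
  have h3 : v (z + t) ≤ v z := by linarith
  exact h3

lemma Lim.D4 (hc : S.Cst M B C) (h : S.Lim M A x)
    (hu : ∀ z : ℂ, 0 < z.im → 0 < S.pot M (fun j => x j z)) :
    ∃ c : ℝ, 0 < c ∧ (∀ z ∈ upperH, S.pot M (fun j => x j z) = c * z.im) ∧
      ∀ z ∈ upperH, ellLim S x z = -(Complex.I * c) := by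
  obtain ⟨g, hg1, hg2⟩ := h.D3 hc hu
  set v := fun z => S.pot M (fun j => x j z) with hv
  have hA := h.A0
  have hinv : ∀ (t : ℝ) (z : ℂ), z ∈ upperH → v (z + t) = v z := by
    intro t z hz
    refine le_antisymm (h.D4a hc hu t hz) ?_
    have hz2 : z + t ∈ upperH := by
      have : 0 < z.im := hz
      show 0 < (z + t).im; simpa using this
    have := h.D4a hc hu (-t) hz2
    simpa using this
  have hre : ∀ z ∈ upperH, (ellLim S x z).re = 0 := by
    intro z hz
    have hd : HasDerivAt (fun t : ℝ => (g (z + t)).re) (ellLim S x z).re 0 := by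
      have h1 : HasDerivAt g (ellLim S x z) (z + ((0:ℝ):ℂ)) := by simpa using hg1 z hz
      have h2 : HasDerivAt (fun w : ℂ => g (z + w)) (ellLim S x z) ((0:ℝ):ℂ) :=
        HasDerivAt.comp_const_add z _ h1
      exact h2.real_of_complex
    have hconst : (fun t : ℝ => (g (z + t)).re) = fun _ => (g z).re := by
      funext t
      have hz2 : z + t ∈ upperH := by
        have : 0 < z.im := hz
        show 0 < (z + t).im; simpa using this
      rw [hg2 _ hz2, hg2 _ hz]
      exact hinv t z hz
    rw [hconst] at hd
    exact hd.unique (hasDerivAt_const _ _)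
  have hI : Complex.I ∈ upperH := by simp [upperH]
  have han : AnalyticOnNhd ℂ (ellLim S x) upperH := (h.ell_diff hc hu).analyticOnNhd isOpen_upper
  obtain ⟨κ, hκ⟩ := han.eq_const_of_re_eq_const hre isOpen_upper
    ⟨⟨Complex.I, hI⟩, convex_upper.isPreconnected⟩
  have hκre : κ.re = 0 := by rw [← hκ _ hI]; exact hre _ hI
  have hκe : κ = -(Complex.I * ((-κ.im : ℝ) : ℂ)) := by
    apply Complex.ext <;> simp [hκre]
  obtain ⟨b, hb⟩ : ∃ b : ℂ, ∀ z ∈ upperH, g z = κ * z + b := by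
    refine ⟨g Complex.I - κ * Complex.I, fun z hz => ?_⟩
    have hd : ∀ y ∈ upperH, HasDerivAt (fun z => g z - κ * z) 0 y := by
      intro y hy
      refine ((hg1 y hy).sub ((hasDerivAt_id y).const_mul κ)).congr_deriv ?_
      rw [hκ y hy]; ring
    have := convex_upper.is_const_of_fderivWithin_eq_zero (𝕜 := ℂ)
      (fun y hy => (hd y hy).differentiableAt.differentiableWithinAt)
      (fun y hy => by
        rw [fderivWithin_of_isOpen isOpen_upper hy]
        ext; simp [(hd y hy).deriv]) hz hI
    linear_combination this
  have hvf : ∀ z ∈ upperH, v z = -κ.im * z.im + b.re := by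
    intro z hz
    have := hg2 z hz
    rw [hb z hz] at this
    change _ = v z at this
    rw [← this]; simp [hκre]
  have hyI : ∀ y : ℝ, 0 < y → (y * Complex.I : ℂ) ∈ upperH := by
    intro y hy; show 0 < Complex.im _; simpa using hy
  have hb0 : b.re = 0 := by
    have t1 : Tendsto (fun y : ℝ => -κ.im * y + b.re) (𝓝[>] 0) (𝓝 (-κ.im * 0 + b.re)) :=
      ((tendsto_id.mono_left nhdsWithin_le_nhds).const_mul _).add_const _
    have t2 : Tendsto (fun y : ℝ => A * y) (𝓝[>] 0) (𝓝 (A * 0)) :=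
      ((tendsto_id.mono_left nhdsWithin_le_nhds).const_mul _)
    rw [mul_zero, zero_add] at t1
    rw [mul_zero] at t2
    refine le_antisymm (le_of_tendsto_of_tendsto t1 t2 ?_) (ge_of_tendsto t1 ?_)
    · filter_upwards [self_mem_nhdsWithin] with y hy
      have h1 := hvf _ (hyI y hy)
      have h2 : v (y * Complex.I) ≤ _ := h.D1 hc (le_of_lt (hyI y hy))
      simp at h1 h2
      linarith
    · filter_upwards [self_mem_nhdsWithin] with y hy
      have h1 := hvf _ (hyI y hy)
      have h2 : 0 ≤ v (y * Complex.I) := pot_nonneg hc (h.tame _ 0)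
      simp at h1
      linarith
  refine ⟨-κ.im, ?_, ?_, ?_⟩
  · have h1 := hvf _ hI
    have h2 : 0 < v Complex.I := hu _ hI
    rw [hb0] at h1
    simp at h1
    linarith
  · intro z hz
    have := hvf z hz
    rw [hb0, add_zero] at this
    exact this
  · intro z hz
    rw [hκ z hz]; exact hκe

lemma Lim.strip (hc : S.Cst M B C) (h : S.Lim M A x) (n : ℤ) (Y : ℝ) :
    ∃ K, ∀ z : ℂ, |z.im| ≤ Y → ‖x n z‖ ≤ K ∧ ‖deriv (x n) z‖ ≤ K := by
  have hA := h.A0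
  have hD := S.Dpos n
  have hb : ∀ z : ℂ, |z.im| ≤ Y + 1 → ‖x n z‖ ≤ Real.exp (S.D n * (A * (Y + 1)) + C) := by
    intro z hz
    refine (norm_le_exp hc (h.tame z n) le_rfl).trans (Real.exp_le_exp.2 ?_)
    have h1 := h.D1' hc z
    have h2 : A * |z.im| ≤ A * (Y + 1) := by gcongr
    have := mul_le_mul_of_nonneg_left (h1.trans h2) hD.le
    linarith
  refine ⟨Real.exp (S.D n * (A * (Y + 1)) + C), fun z hz => ⟨hb z (by linarith), ?_⟩⟩
  have := Complex.norm_deriv_le_of_forall_mem_sphere_norm_le (c := z) (R := 1) one_pos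
    (h.ent n).diffContOnCl (fun w hw => hb w ?_)
  · simpa using this
  · have h1 := Complex.abs_im_le_norm (w - z)
    rw [mem_sphere_iff_norm] at hw
    rw [hw, Complex.sub_im] at h1
    have := abs_sub_abs_le_abs_sub w.im z.im
    linarith

lemma Lim.D5 (hc : S.Cst M B C) (h : S.Lim M A x) :
    ∃ c : ℝ, 0 ≤ c ∧ (∀ z : ℂ, 0 < z.im → S.pot M (fun j => x j z) = c * z.im) ∧
      ∀ n, ∃ K, ∀ z : ℂ, -1 ≤ z.im → ‖deriv (x n) z + Complex.I * (c * S.D n : ℝ) * x n z‖ ≤ K := by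
  have hA := h.A0
  rcases h.up with h0 | hu
  · refine ⟨0, le_rfl, by simpa using h0, fun n => ?_⟩
    obtain ⟨K, hK⟩ := h.strip hc n 1
    refine ⟨max K (Real.exp C), fun z hz => ?_⟩
    simp only [zero_mul, Complex.ofReal_zero, mul_zero, add_zero]
    rcases le_or_gt z.im 1 with h1 | h1
    · exact le_max_of_le_left (hK z (abs_le.2 ⟨hz, h1⟩)).2
    · refine le_max_of_le_right ?_
      have := Complex.norm_deriv_le_of_forall_mem_sphere_norm_le (c := z) (R := 1) (C := Real.exp C) one_pos
        (h.ent n).diffContOnCl (fun w hw => ?_)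
      · simpa using this
      · have := norm_le_exp hc (h.tame w n) le_rfl
        rw [h0 w (mem_upper_of_ball (Metric.sphere_subset_closedBall hw) h1)] at this
        simpa using this
  · obtain ⟨c, hc0, hv, hl⟩ := h.D4 hc hu
    refine ⟨c, hc0.le, hv, fun n => ?_⟩
    have hD := S.Dpos n
    have hcD : 0 < c * S.D n := by positivity
    have hM := hc.M2
    have hB := hc.B0
    set Y := max 1 ((Real.log M + C) / (c * S.D n) + 1) with hY
    obtain ⟨K, hK⟩ := h.strip hc n Y
    refine ⟨max (K + c * S.D n * K) (2 * B * Real.exp (c * S.D n + 2 * C)), fun z hz => ?_⟩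
    rcases le_or_gt z.im Y with h1 | h1
    · refine le_max_of_le_left ?_
      have hz' : |z.im| ≤ Y := abs_le.2 ⟨by linarith [le_max_left 1 ((Real.log M + C) / (c * S.D n) + 1)], h1⟩
      obtain ⟨k1, k2⟩ := hK z hz'
      refine (norm_add_le _ _).trans (add_le_add k2 ?_)
      rw [norm_mul, norm_mul, Complex.norm_I, one_mul, Complex.norm_real, Real.norm_of_nonneg hcD.le]
      gcongr
    · refine le_max_of_le_right ?_
      have hz1 : 1 < z.im := lt_of_le_of_lt (le_max_left _ _) h1
      have hz2 : Real.log M + C < c * S.D n * (z.im - 1) := by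
        have : (Real.log M + C) / (c * S.D n) + 1 < z.im := lt_of_le_of_lt (le_max_right _ _) h1
        have : (Real.log M + C) / (c * S.D n) < z.im - 1 := by linarith
        rwa [div_lt_iff₀' hcD] at this
      set R := Real.exp (c * S.D n * (z.im - 1) - C) with hR
      have hMR : M ≤ R := by
        rw [hR, ← Real.exp_log (show 0 < M by linarith), Real.exp_le_exp]; linarith
      have hb : ∀ w ∈ Metric.closedBall z 1, R ≤ ‖x n w‖ := by
        intro w hw
        have hwp : 0 < w.im := mem_upper_of_ball hw hz1
        have hwi : z.im - 1 ≤ w.im := by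
          have h1 := Complex.abs_im_le_norm (w - z)
          rw [Metric.mem_closedBall, dist_eq_norm] at hw
          have := (abs_le.1 (h1.trans hw)).1
          simp at this; linarith
        have hw2 : c * S.D n * (z.im - 1) ≤ S.D n * S.pot M (fun j => x j w) := by
          rw [hv w hwp]
          have := mul_le_mul_of_nonneg_left hwi hcD.le
          linarith
        obtain ⟨g1, g2⟩ := large_of_pot hc (h.tame w n) (j := n) le_rfl (by linarith)
        have g3 := (abs_le.1 (pot_bound hc (h.tame w n) (j := n) le_rfl)).2
        rw [g2] at g3
        rw [hR, ← Real.exp_log (show 0 < ‖x n w‖ by linarith), Real.exp_le_exp]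
        linarith
      have hD2 := (h.D2 hc (z := z) one_pos hMR hb).2
      have hzU : z ∈ upperH := by show 0 < z.im; linarith
      rw [hl z hzU] at hD2
      have hx0 : x n z ≠ 0 := norm_pos_iff.1
        (lt_of_lt_of_le (Real.exp_pos _) (hb z (Metric.mem_closedBall_self zero_le_one)))
      have hD0 : (S.D n : ℂ) ≠ 0 := by exact_mod_cast hD.ne'
      have e : deriv (x n) z + Complex.I * (c * S.D n : ℝ) * x n z =
        -((S.D n * x n z) * (-(Complex.I * c) - ell S x n z)) := by
        rw [ell]; push_cast; field_simp; ring
      rw [e, norm_neg, norm_mul, norm_mul, Complex.norm_real, Real.norm_of_nonneg hD.le]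
      have hxb : ‖x n z‖ ≤ Real.exp (c * S.D n * z.im + C) := by
        have := norm_le_exp hc (h.tame z n) le_rfl
        rw [hv z hzU] at this
        rwa [show c * S.D n * z.im + C = S.D n * (c * z.im) + C by ring]
      have hRp : 0 < R := Real.exp_pos _
      calc _ ≤ S.D n * Real.exp (c * S.D n * z.im + C) * (2 * B / (R * 1 * S.D n)) := by gcongr
        _ = 2 * B * (Real.exp (c * S.D n * z.im + C) / R) := by field_simp
        _ = _ := by
          rw [hR, ← Real.exp_sub]; congr 2; ring

lemma Lim.D5low (hc : S.Cst M B C) (h : S.Lim M A x) :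
    ∃ c : ℝ, 0 ≤ c ∧ (∀ z : ℂ, z.im < 0 → S.pot M (fun j => x j z) = c * (-z.im)) ∧
      ∀ n, ∃ K, ∀ z : ℂ, z.im ≤ 1 → ‖deriv (x n) z - Complex.I * (c * S.D n : ℝ) * x n z‖ ≤ K := by
  obtain ⟨c, h1, h2, h3⟩ := h.flip.D5 hc
  refine ⟨c, h1, fun z hz => ?_, fun n => ?_⟩
  · have := h2 (-z) (by simpa using hz)
    simpa using this
  · obtain ⟨K, hK⟩ := h3 n
    refine ⟨K, fun z hz => ?_⟩
    have := hK (-z) (by simpa using hz)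
    rw [deriv_comp_neg] at this
    rw [← norm_neg]
    simp only [neg_neg] at this
    refine le_trans (le_of_eq (congrArg _ ?_)) this
    ring
end Sys


lemma const_of_deriv_zero {q : ℂ → ℂ} (hq : ∀ z, HasDerivAt q 0 z) (z : ℂ) : q z = q 0 :=
  is_const_of_deriv_eq_zero (fun z => (hq z).differentiableAt) (fun z => (hq z).deriv) z 0

lemma ode_solve {Y : ℂ → ℂ} (hY : Differentiable ℂ Y) (a : ℝ) (k : ℂ)
    (he : ∀ z, deriv Y z + Complex.I * a * Y z = k) (K : ℝ) (hb : ∀ t : ℝ, ‖Y t‖ ≤ K) :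
    ∃ α β : ℂ, ∀ z, Y z = β + α * Complex.exp (-(Complex.I * a * z)) := by
  rcases eq_or_ne a 0 with rfl | ha
  · have h1 : ∀ z, deriv Y z = k := fun z => by simpa using he z
    have h2 : ∀ z, Y z = k * z + Y 0 := by
      intro z
      have := const_of_deriv_zero (q := fun z => Y z - k * z) (fun z => by
        refine ((hY z).hasDerivAt.sub ((hasDerivAt_id z).const_mul k)).congr_deriv ?_
        rw [h1]; ring) z
      simp at this
      linear_combination this
    have hk : k = 0 := by
      by_contra hk
      have hk' : 0 < ‖k‖ := norm_pos_iff.2 hk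
      have hK : 0 ≤ K := (norm_nonneg _).trans (hb 0)
      have h3 := hb ((2 * K + 1) / ‖k‖)
      have h4 := hb 0
      have h5 := h2 (((2 * K + 1) / ‖k‖ : ℝ) : ℂ)
      have h6 : k * (((2 * K + 1) / ‖k‖ : ℝ) : ℂ) = Y (((2 * K + 1) / ‖k‖ : ℝ) : ℂ) - Y ((0:ℝ):ℂ) := by
        rw [h5]; simp
      have h7 := congrArg norm h6
      rw [norm_mul, Complex.norm_real, Real.norm_of_nonneg (by positivity), mul_div_cancel₀ _ hk'.ne'] at h7
      have := norm_sub_le (Y (((2 * K + 1) / ‖k‖ : ℝ) : ℂ)) (Y ((0:ℝ):ℂ))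
      linarith
    refine ⟨0, Y 0, fun z => ?_⟩
    rw [h2 z, hk]; ring
  · have haI : Complex.I * (a:ℂ) ≠ 0 := mul_ne_zero Complex.I_ne_zero (by exact_mod_cast ha)
    set q := fun z => (Y z - k / (Complex.I * a)) * Complex.exp (Complex.I * a * z) with hq
    have hq0 : ∀ z, HasDerivAt q 0 z := by
      intro z
      have h1 := ((hY z).hasDerivAt.sub_const (k / (Complex.I * a)))
      have h2 := ((hasDerivAt_id z).const_mul (Complex.I * (a:ℂ))).cexp
      refine (h1.mul h2).congr_deriv ?_
      have := he z
      have h3 : deriv Y z = k - Complex.I * a * Y z := by linear_combination this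
      rw [h3]
      simp only [id]
      have haC : (a:ℂ) ≠ 0 := by exact_mod_cast ha
      have := Complex.I_ne_zero
      field_simp
      ring
    refine ⟨q 0, k / (Complex.I * a), fun z => ?_⟩
    have := const_of_deriv_zero hq0 z
    rw [← this]
    simp only [hq]
    rw [mul_assoc, ← Complex.exp_add, add_neg_cancel, Complex.exp_zero]
    ring

lemma rep_form {f : ℂ → ℂ} (hf : Differentiable ℂ f) {a b : ℝ} (hab : 0 < a + b) {K1 K2 : ℝ}
    (h2 : ∀ z : ℂ, -1 ≤ z.im → ‖deriv f z + Complex.I * a * f z‖ ≤ K2)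
    (h1 : ∀ z : ℂ, z.im ≤ 1 → ‖deriv f z - Complex.I * b * f z‖ ≤ K1) :
    ∃ α β α' : ℂ, ∀ z, f z = α * Complex.exp (-(Complex.I * a * z)) + β +
      α' * Complex.exp (Complex.I * b * z) := by
  set Y2 := fun z => deriv f z + Complex.I * a * f z with hY2
  set Y1 := fun z => deriv f z - Complex.I * b * f z with hY1
  have hf' : Differentiable ℂ (deriv f) := by
    have := (hf.differentiableOn (s := Set.univ)).deriv isOpen_univ
    rwa [differentiableOn_univ] at this
  have hf'd : ∀ z, HasDerivAt (deriv f) (deriv (deriv f) z) z := fun z => (hf' z).hasDerivAt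
  have hd2 : ∀ z, HasDerivAt Y2 (deriv (deriv f) z + Complex.I * a * deriv f z) z := fun z =>
    (hf'd z).add ((hf z).hasDerivAt.const_mul _)
  have hd1 : ∀ z, HasDerivAt Y1 (deriv (deriv f) z - Complex.I * b * deriv f z) z := fun z =>
    (hf'd z).sub ((hf z).hasDerivAt.const_mul _)
  have hD2 : Differentiable ℂ Y2 := fun z => (hd2 z).differentiableAt
  have hD1 : Differentiable ℂ Y1 := fun z => (hd1 z).differentiableAt
  have hY1' : Differentiable ℂ (deriv Y1) := by
    have := (hD1.differentiableOn (s := Set.univ)).deriv isOpen_univ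
    rwa [differentiableOn_univ] at this
  set W := fun z => deriv Y1 z + Complex.I * a * Y1 z with hW
  have hW2 : ∀ z, W z = deriv Y2 z - Complex.I * b * Y2 z := by
    intro z
    simp only [hW]
    rw [(hd1 z).deriv, (hd2 z).deriv]
    simp only [hY1, hY2]
    ring
  have hWd : Differentiable ℂ W := hY1'.add (hD1.const_mul _)
  have cauchy : ∀ (Y : ℂ → ℂ) (z : ℂ) (K : ℝ), Differentiable ℂ Y → (∀ w ∈ Metric.sphere z 1, ‖Y w‖ ≤ K) →
      ‖deriv Y z‖ ≤ K := by
    intro Y z K hY hK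
    have := Complex.norm_deriv_le_of_forall_mem_sphere_norm_le one_pos hY.diffContOnCl hK
    simpa using this
  have hsph : ∀ (z w : ℂ), w ∈ Metric.sphere z 1 → |w.im - z.im| ≤ 1 := by
    intro z w hw
    have h1 := Complex.abs_im_le_norm (w - z)
    rw [mem_sphere_iff_norm] at hw
    rwa [hw, Complex.sub_im] at h1
  have hWb : ∀ z, ‖W z‖ ≤ max (K1 + |a| * K1) (K2 + |b| * K2) := by
    intro z
    rcases le_total 0 z.im with hz | hz
    · refine le_max_of_le_right ?_
      rw [hW2]
      refine (norm_sub_le _ _).trans (add_le_add (cauchy _ _ _ hD2 fun w hw => h2 w ?_) ?_)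
      · have := (abs_le.1 (hsph z w hw)).1; linarith
      · rw [norm_mul, norm_mul, Complex.norm_I, one_mul, Complex.norm_real, Real.norm_eq_abs]
        exact mul_le_mul_of_nonneg_left (h2 z (by linarith)) (abs_nonneg _)
    · refine le_max_of_le_left ?_
      refine (norm_add_le _ _).trans (add_le_add (cauchy _ _ _ hD1 fun w hw => h1 w ?_) ?_)
      · have := (abs_le.1 (hsph z w hw)).2; linarith
      · rw [norm_mul, norm_mul, Complex.norm_I, one_mul, Complex.norm_real, Real.norm_eq_abs]
        exact mul_le_mul_of_nonneg_left (h1 z (by linarith)) (abs_nonneg _)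
  have hWc : ∀ z, W z = W 0 := by
    intro z
    refine hWd.apply_eq_apply_of_bounded ?_ z 0
    rw [isBounded_iff_forall_norm_le]
    exact ⟨_, by rintro _ ⟨z, rfl⟩; exact hWb z⟩
  obtain ⟨α1, β1, e1⟩ := ode_solve hD1 a (W 0) hWc K1 (fun t => h1 t (by simp))
  obtain ⟨α2, β2, e2⟩ := ode_solve hD2 (-b) (W 0) (fun z => by
    rw [← hWc z, hW2]; push_cast; ring) K2 (fun t => h2 t (by simp))
  have habC : Complex.I * ((a:ℂ) + b) ≠ 0 :=
    mul_ne_zero Complex.I_ne_zero (by exact_mod_cast hab.ne')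
  refine ⟨-α1 / (Complex.I * (a + b)), (β2 - β1) / (Complex.I * (a + b)), α2 / (Complex.I * (a + b)), fun z => ?_⟩
  have : f z = (Y2 z - Y1 z) / (Complex.I * (a + b)) := by
    rw [eq_div_iff habC]; simp only [hY1, hY2]; ring
  rw [this, e1, e2]
  have e : -(Complex.I * ((-b : ℝ):ℂ) * z) = Complex.I * b * z := by push_cast; ring
  rw [e]
  field_simp
  ring

/-- difference quotient of a polynomial -/
lemma poly_quot (p : Polynomial ℂ) (X Y W : ℝ → ℂ) (Al : ℂ) (hW0 : ∀ y, W y ≠ 0)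
    (hX : Tendsto (fun y => X y / W y) atTop (𝓝 Al)) (hY : Tendsto (fun y => Y y / W y) atTop (𝓝 Al))
    (hW : Tendsto (fun y => (W y)⁻¹) atTop (𝓝 0)) (hd : 2 ≤ p.natDegree) :
    ∃ R : ℝ → ℂ, (∀ y, p.eval (X y) - p.eval (Y y) = R y * W y ^ (p.natDegree - 1) * (X y - Y y)) ∧
      Tendsto R atTop (𝓝 (p.leadingCoeff * (p.natDegree * Al ^ (p.natDegree - 1)))) := by
  set n := p.natDegree with hn
  refine ⟨fun y => ∑ i ∈ Finset.range (n + 1), p.coeff i *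
    ((∑ k ∈ Finset.range i, (X y / W y) ^ k * (Y y / W y) ^ (i - 1 - k)) * ((W y)⁻¹) ^ (n - i)),
    fun y => ?_, ?_⟩
  · rw [Polynomial.eval_eq_sum_range, Polynomial.eval_eq_sum_range, ← Finset.sum_sub_distrib,
      Finset.sum_mul, Finset.sum_mul]
    refine Finset.sum_congr rfl fun i hi => ?_
    rw [← mul_sub, mul_assoc, mul_assoc]
    congr 1
    rw [← geom_sum₂_mul (X y) (Y y) i, ← mul_assoc]
    congr 1
    rcases Nat.eq_zero_or_pos i with rfl | hi0
    · simp
    have hin : i ≤ n := by simp at hi; omega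
    rw [mul_assoc, Finset.sum_mul]
    refine Finset.sum_congr rfl fun k hk => ?_
    have hk' : k < i := by simpa using hk
    have hw := hW0 y
    obtain ⟨l, rfl⟩ : ∃ l, i = k + 1 + l := ⟨i - k - 1, by omega⟩
    obtain ⟨m, hm⟩ : ∃ m, n = k + 1 + l + m := ⟨n - (k + 1 + l), by omega⟩
    rw [hm]
    have a1 : k + 1 + l - 1 - k = l := by omega
    have a2 : k + 1 + l + m - (k + 1 + l) = m := by omega
    have a3 : k + 1 + l + m - 1 = k + l + m := by omega
    rw [a1, a2, a3, div_pow, div_pow, inv_pow, pow_add, pow_add]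
    field_simp
  · have ht : Tendsto (fun y => ∑ i ∈ Finset.range (n + 1), p.coeff i *
      ((∑ k ∈ Finset.range i, (X y / W y) ^ k * (Y y / W y) ^ (i - 1 - k)) * ((W y)⁻¹) ^ (n - i))) atTop
      (𝓝 (∑ i ∈ Finset.range (n + 1), p.coeff i *
      ((∑ k ∈ Finset.range i, Al ^ k * Al ^ (i - 1 - k)) * 0 ^ (n - i)))) := by
      refine tendsto_finsetSum _ fun i _ => (Tendsto.mul ?_ (hW.pow _)).const_mul _
      exact tendsto_finsetSum _ fun k _ => (hX.pow _).mul (hY.pow _)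
    convert ht using 2
    rw [Finset.sum_range_succ, Finset.sum_eq_zero]
    · rw [zero_add, Nat.sub_self, pow_zero, mul_one]
      congr 1
      rw [Finset.sum_congr rfl (g := fun _ => Al ^ (n - 1))]
      · simp
      · intro k hk
        have : k < n := by simpa using hk
        rw [← pow_add]; congr 1; omega
    · intro i hi
      have : i < n := by simpa using hi
      rw [zero_pow (by omega)]; simp

/-- an exponential cannot be balanced by a nonzero limit unless the exponent vanishes -/
lemma exp_balance {s : ℝ} {κ q L : ℂ} {Q : ℝ → ℂ} (hQ : Tendsto Q atTop (𝓝 q)) (hq : q ≠ 0) (hL : L ≠ 0)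
    (h : Tendsto (fun y : ℝ => κ * Q y * (Real.exp (s * y) : ℂ)) atTop (𝓝 L)) : s = 0 := by
  have h1 : Tendsto (fun y : ℝ => κ * (Real.exp (s * y) : ℂ)) atTop (𝓝 (L / q)) := by
    refine (h.div hQ hq).congr' ?_
    filter_upwards [hQ.eventually_ne hq] with y hy
    simp only [Pi.div_apply]
    field_simp
  have h2 : Tendsto (fun y : ℝ => ‖κ‖ * Real.exp (s * y)) atTop (𝓝 ‖L / q‖) := by
    refine h1.norm.congr fun y => ?_
    rw [norm_mul, Complex.norm_real, Real.norm_of_nonneg (Real.exp_pos _).le]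
  have hLq : 0 < ‖L / q‖ := norm_pos_iff.2 (div_ne_zero hL hq)
  by_contra hs
  rcases lt_or_gt_of_ne hs with hs | hs
  · have h3 : Tendsto (fun y : ℝ => s * y) atTop atBot := tendsto_id.const_mul_atTop_of_neg hs
    have h4 := (Real.tendsto_exp_atBot.comp h3).const_mul ‖κ‖
    rw [mul_zero] at h4
    exact hLq.ne' (tendsto_nhds_unique h2 h4)
  · rcases eq_or_ne κ 0 with rfl | hκ
    · simp only [norm_zero, zero_mul] at h2
      exact hLq.ne (tendsto_nhds_unique tendsto_const_nhds h2)
    · have h3 : Tendsto (fun y : ℝ => s * y) atTop atTop := tendsto_id.const_mul_atTop hs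
      have h4 := (Real.tendsto_exp_atTop.comp h3).const_mul_atTop (norm_pos_iff.2 hκ)
      exact not_tendsto_nhds_of_tendsto_atTop h4 _ h2


namespace Sys
variable {S : Sys} {M B C A : ℝ} {x : ℤ → ℂ → ℂ}

lemma D_one : S.D 1 = S.d 0 := by
  have := S.Dsucc 0
  rw [S.D0] at this
  simpa [d] using this

lemma D_neg_one : S.D (-1) = 1 / S.d (-1) := by
  have h := S.Dsucc (-1)
  have hd := S.deg (-1)
  have : (0:ℝ) < S.d (-1) := by
    have : 0 < S.d (-1) := by unfold d; omega
    exact_mod_cast this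
  rw [neg_add_cancel, S.D0] at h
  rw [eq_div_iff this.ne', mul_comm]
  exact h.symm

lemma exp_neg_tendsto {s : ℝ} (hs : 0 < s) :
    Tendsto (fun y : ℝ => (Real.exp (-(s * y)) : ℂ)) atTop (𝓝 0) := by
  have h1 : Tendsto (fun y : ℝ => -(s * y)) atTop atBot :=
    tendsto_neg_atTop_atBot.comp (tendsto_id.const_mul_atTop hs)
  have := (Complex.continuous_ofReal.tendsto 0).comp (Real.tendsto_exp_atBot.comp h1)
  rw [Complex.ofReal_zero] at this
  exact this

lemma Lim.key (hc : S.Cst M B C) (h : S.Lim M A x) {c c2 : ℝ} (hc0 : 0 < c) (hc2 : 0 ≤ c2)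
    (hup : ∀ z : ℂ, 0 < z.im → S.pot M (fun j => x j z) = c * z.im)
    (e1 : ∀ n, ∃ K, ∀ z : ℂ, -1 ≤ z.im →
      ‖deriv (x n) z + Complex.I * (c * S.D n : ℝ) * x n z‖ ≤ K)
    (e2 : ∀ n, ∃ K, ∀ z : ℂ, z.im ≤ 1 →
      ‖deriv (x n) z - Complex.I * (c2 * S.D n : ℝ) * x n z‖ ≤ K) :
    c2 = c * (S.d 0 - 1 - 1 / S.d (-1)) := by
  have rep : ∀ n, ∃ α β α' : ℂ, ∀ z, x n z = α * Complex.exp (-(Complex.I * (c * S.D n : ℝ) * z)) + β +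
      α' * Complex.exp (Complex.I * (c2 * S.D n : ℝ) * z) := by
    intro n
    obtain ⟨K1, h1⟩ := e1 n
    obtain ⟨K2, h2⟩ := e2 n
    have hD := S.Dpos n
    exact rep_form (h.ent n) (by positivity) h1 h2
  choose α β α' rep using rep
  set T : ℝ := 2 * Real.pi / c with hT
  set ω : ℤ → ℂ := fun n => Complex.exp (-(Complex.I * (c * S.D n : ℝ) * T)) with hω
  set μ : ℤ → ℂ := fun n => Complex.exp (Complex.I * (c2 * S.D n : ℝ) * T) with hμ
  have v1 : ∀ n (y : ℝ), x n (Complex.I * y) = α n * (Real.exp (c * S.D n * y) : ℂ) + β n +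
      α' n * (Real.exp (-(c2 * S.D n * y)) : ℂ) := by
    intro n y
    rw [rep n]
    have a1 : -(Complex.I * (c * S.D n : ℝ) * (Complex.I * y)) = ((c * S.D n * y : ℝ) : ℂ) := by
      push_cast; linear_combination -(c * S.D n * y : ℂ) * Complex.I_mul_I
    have a2 : (Complex.I * (c2 * S.D n : ℝ) * (Complex.I * y)) = ((-(c2 * S.D n * y) : ℝ) : ℂ) := by
      push_cast; linear_combination (c2 * S.D n * y : ℂ) * Complex.I_mul_I
    rw [a1, a2, Complex.ofReal_exp, Complex.ofReal_exp]
  have v2 : ∀ n (y : ℝ), x n (Complex.I * y + T) = α n * ω n * (Real.exp (c * S.D n * y) : ℂ) + β n +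
      α' n * μ n * (Real.exp (-(c2 * S.D n * y)) : ℂ) := by
    intro n y
    rw [rep n]
    have a1 : -(Complex.I * (c * S.D n : ℝ) * (Complex.I * y + T)) =
        -(Complex.I * (c * S.D n : ℝ) * T) + ((c * S.D n * y : ℝ) : ℂ) := by
      push_cast; linear_combination -(c * S.D n * y : ℂ) * Complex.I_mul_I
    have a2 : (Complex.I * (c2 * S.D n : ℝ) * (Complex.I * y + T)) =
        (Complex.I * (c2 * S.D n : ℝ) * T) + ((-(c2 * S.D n * y) : ℝ) : ℂ) := by
      push_cast; linear_combination (c2 * S.D n * y : ℂ) * Complex.I_mul_I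
    rw [a1, a2, Complex.exp_add, Complex.exp_add, Complex.ofReal_exp, Complex.ofReal_exp]
    simp only [hω, hμ]
    ring
  have hcT : (c:ℂ) * T = 2 * Real.pi := by
    have : c * T = 2 * Real.pi := by rw [hT]; field_simp
    exact_mod_cast this
  have hα : ∀ n, α n ≠ 0 := by
    intro n hn
    set K := ‖β n‖ + ‖α' n‖ with hK
    have hb : ∀ y : ℝ, 0 ≤ y → ‖x n (Complex.I * y)‖ ≤ K := by
      intro y hy
      rw [v1, hn, zero_mul, zero_add]
      refine (norm_add_le _ _).trans (add_le_add le_rfl ?_)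
      rw [norm_mul, Complex.norm_real, Real.norm_of_nonneg (Real.exp_pos _).le]
      refine mul_le_of_le_one_right (norm_nonneg _) (Real.exp_le_one_iff.2 ?_)
      have := S.Dpos n
      have : 0 ≤ c2 * S.D n * y := by positivity
      linarith
    have hD := S.Dpos n
    have hM := hc.M2
    set y := (|Real.log (max M K)| + C + 1) / (c * S.D n) with hy
    have hy0 : 0 < y := by have := hc.C0; positivity
    have h1 := pot_bound hc (h.tame (Complex.I * y) n) le_rfl
    rw [hup _ (by simpa using hy0)] at h1
    have h2 : LL M (fun j => x j (Complex.I * y)) n ≤ Real.log (max M K) := by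
      unfold LL
      exact Real.log_le_log (by positivity) (max_le_max le_rfl (hb y hy0.le))
    have h3 : S.D n * (c * (Complex.I * (y:ℂ)).im) = |Real.log (max M K)| + C + 1 := by
      simp only [Complex.mul_im, Complex.I_re, Complex.I_im, Complex.ofReal_re, Complex.ofReal_im]
      rw [hy]; field_simp; ring
    have := (abs_le.1 h1).2
    have := le_abs_self (Real.log (max M K))
    linarith
  have hω0 : ω 0 = 1 := by
    simp only [hω, S.D0, mul_one]
    rw [show -(Complex.I * (c:ℂ) * T) = -(2 * Real.pi * Complex.I) by linear_combination -Complex.I * hcT]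
    rw [Complex.exp_neg, Complex.exp_two_pi_mul_I, inv_one]
  have hω1 : ω 1 = 1 := by
    simp only [hω, D_one]
    rw [show -(Complex.I * ((c * S.d 0 : ℝ):ℂ) * T) = -(S.d 0 * (2 * Real.pi * Complex.I)) by
      push_cast; linear_combination -Complex.I * S.d 0 * hcT]
    rw [Complex.exp_neg, Complex.exp_nat_mul, Complex.exp_two_pi_mul_I, one_pow, inv_one]
  have hd' : (2:ℝ) ≤ S.d (-1) := by exact_mod_cast S.deg (-1)
  have hωm : ω (-1) ≠ 1 := by
    simp only [hω, D_neg_one]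
    intro h1
    rw [Complex.exp_eq_one_iff] at h1
    obtain ⟨n, hn⟩ := h1
    have hdc : (S.d (-1) : ℂ) ≠ 0 := by
      have : (S.d (-1) : ℝ) ≠ 0 := by linarith
      exact_mod_cast this
    have e3 : -(2 * Real.pi * Complex.I) = n * S.d (-1) * (2 * Real.pi * Complex.I) := by
      push_cast at hn
      have := congrArg (· * (S.d (-1) : ℂ)) hn
      field_simp at this
      linear_combination Complex.I * this + Complex.I * hcT
    have e4 : ((n * S.d (-1) : ℤ) : ℂ) = ((-1 : ℤ) : ℂ) := by
      have hne := Complex.two_pi_I_ne_zero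
      have : (n * S.d (-1) : ℂ) = -1 := by
        refine mul_right_cancel₀ hne ?_
        linear_combination -e3
      push_cast; exact this
    have e5 : n * (S.d (-1) : ℤ) = -1 := by exact_mod_cast e4
    have e6 : (2:ℤ) ≤ S.d (-1) := by exact_mod_cast S.deg (-1)
    have : (S.d (-1) : ℤ) ∣ 1 := ⟨-n, by linarith [mul_comm n (S.d (-1) : ℤ)]⟩
    have := Int.le_of_dvd one_pos this
    omega
  -- polynomial comparison
  set W : ℝ → ℂ := fun y => (Real.exp (c * y) : ℂ) with hW
  have hWX : ∀ q r : ℂ, Tendsto (fun y : ℝ => (α 0 * W y + q + r * (Real.exp (-(c2 * y)) : ℂ)) / W y) atTop (𝓝 (α 0)) := by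
    intro q r
    have h1 := ((exp_neg_tendsto hc0).const_mul q).add
      ((exp_neg_tendsto (s := c2 + c) (by positivity)).const_mul r)
    have h2 := h1.const_add (α 0)
    simp only [mul_zero, add_zero] at h2
    refine h2.congr fun y => ?_
    have hWy : W y ≠ 0 := by simp only [hW]; exact_mod_cast (Real.exp_pos _).ne'
    rw [eq_div_iff hWy, show -((c2 + c) * y) = -(c2 * y) + -(c * y) by ring, Real.exp_add, Real.exp_neg (c * y)]
    rw [Complex.ofReal_mul, Complex.ofReal_inv]
    change _ = α 0 * W y + q + r * _
    change (α 0 + (q * (W y)⁻¹ + r * (_ * (W y)⁻¹))) * W y = _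
    field_simp
    ring
  obtain ⟨R, hR1, hR2⟩ := poly_quot (S.p 0) (fun y => x 0 (Complex.I * y)) (fun y => x 0 (Complex.I * y + T)) W (α 0)
    (fun y => by simp only [hW]; exact_mod_cast (Real.exp_pos _).ne')
    (by
      refine (hWX (β 0) (α' 0)).congr fun y => ?_
      simp only [v1, S.D0, mul_one, hW])
    (by
      refine (hWX (β 0) (α' 0 * μ 0)).congr fun y => ?_
      simp only [v2, S.D0, mul_one, hW, hω0])
    (by
      refine (exp_neg_tendsto hc0).congr fun y => ?_
      simp only [hW]
      rw [Real.exp_neg]; push_cast; rfl)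
    (S.deg 0)
  have horb : ∀ z, (S.p 0).eval (x 0 z) = x 1 z + S.a 0 * x (-1) z := by
    intro z
    have := (h.tame z 0).orb 0
    simp only [stp, zero_add, zero_sub] at this
    rw [this]; ring
  set s := -c2 + c * (S.d 0 - 1) - c / S.d (-1) with hs
  set L := S.a 0 * α (-1) * (1 - ω (-1)) with hL
  have hd0 : 2 ≤ S.d 0 := S.deg 0
  have main : ∀ y : ℝ, α' 0 * (1 - μ 0) * R y * (Real.exp (s * y) : ℂ) =
      α' 1 * (1 - μ 1) * (Real.exp (-((c2 * S.d 0 + c / S.d (-1)) * y)) : ℂ) +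
      S.a 0 * α' (-1) * (1 - μ (-1)) * (Real.exp (-((c2 / S.d (-1) + c / S.d (-1)) * y)) : ℂ) + L := by
    intro y
    have h1 := hR1 y
    simp only [horb] at h1
    rw [v1, v2, v1, v2, v1, v2, hω0, hω1, D_one, D_neg_one, S.D0] at h1
    have f1 : (Real.exp (s * y) : ℂ) = W y ^ ((S.p 0).natDegree - 1) * (Real.exp (-(c2 * y)) : ℂ) * (Real.exp (-(c / S.d (-1) * y)) : ℂ) := by
      simp only [hW]
      norm_cast
      rw [← Real.exp_nat_mul, ← Real.exp_add, ← Real.exp_add]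
      congr 1
      rw [Nat.cast_sub (by have := S.deg 0; omega), hs]
      simp only [d]
      push_cast
      ring
    have f2 : (Real.exp (-((c2 * S.d 0 + c / S.d (-1)) * y)) : ℂ) =
        (Real.exp (-(c2 * S.d 0 * y)) : ℂ) * (Real.exp (-(c / S.d (-1) * y)) : ℂ) := by
      norm_cast
      rw [← Real.exp_add]; congr 1; ring
    have f3 : (Real.exp (-((c2 / S.d (-1) + c / S.d (-1)) * y)) : ℂ) =
        (Real.exp (-(c2 * (1 / S.d (-1)) * y)) : ℂ) * (Real.exp (-(c / S.d (-1) * y)) : ℂ) := by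
      norm_cast
      rw [← Real.exp_add]; congr 1; ring
    have f4 : (Real.exp (c * (1 / S.d (-1)) * y) : ℂ) * (Real.exp (-(c / S.d (-1) * y)) : ℂ) = 1 := by
      norm_cast
      rw [← Real.exp_add, Real.exp_eq_one_iff]; ring
    rw [f1, f2, f3, hL]
    simp only [mul_one] at h1
    linear_combination -(Real.exp (-(c / S.d (-1) * y)) : ℂ) * h1 + S.a 0 * α (-1) * (1 - ω (-1)) * f4
  have hlim : Tendsto (fun y : ℝ => α' 0 * (1 - μ 0) * R y * (Real.exp (s * y) : ℂ)) atTop (𝓝 L) := by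
    simp only [main]
    have h1 := ((exp_neg_tendsto (s := c2 * S.d 0 + c / S.d (-1)) (by positivity)).const_mul (α' 1 * (1 - μ 1))).add
      ((exp_neg_tendsto (s := c2 / S.d (-1) + c / S.d (-1)) (by positivity)).const_mul (S.a 0 * α' (-1) * (1 - μ (-1))))
    simpa using h1.add_const L
  have hL0 : L ≠ 0 := mul_ne_zero (mul_ne_zero (S.ane 0) (hα _)) (sub_ne_zero.2 hωm.symm)
  have hq : (S.p 0).leadingCoeff * ((S.p 0).natDegree * α 0 ^ ((S.p 0).natDegree - 1)) ≠ 0 := by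
    refine mul_ne_zero (S.lc_ne 0) (mul_ne_zero ?_ (pow_ne_zero _ (hα 0)))
    have := S.deg 0
    exact_mod_cast (by omega : (S.p 0).natDegree ≠ 0)
  have := exp_balance hR2 hq hL0 hlim
  rw [hs] at this
  linarith [show c * (S.d 0 - 1 - 1 / S.d (-1)) = c * (S.d 0 - 1) - c / S.d (-1) by ring]

lemma Lim.absurd_pos (hc : S.Cst M B C) (h : S.Lim M A x) {z : ℂ} (hz : 0 < z.im)
    (hp : 0 < S.pot M (fun j => x j z)) : False := by
  obtain ⟨c, hc0, hup, e1⟩ := h.D5 hc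
  obtain ⟨c2, hc20, hlo, e2⟩ := h.D5low hc
  have hcp : 0 < c := by
    rw [hup z hz] at hp
    exact pos_of_mul_pos_left hp hz.le
  have k1 := h.key hc hcp hc20 hup e1 e2
  have hd' : (2:ℝ) ≤ S.d (-1) := by exact_mod_cast S.deg (-1)
  have hd : (2:ℝ) ≤ S.d 0 := by exact_mod_cast S.deg 0
  have hi : (1:ℝ) / S.d (-1) ≤ 1 / 2 := one_div_le_one_div_of_le two_pos hd'
  set θ : ℝ := S.d 0 - 1 - 1 / S.d (-1) with hθ
  have hθ0 : 0 < θ := by rw [hθ]; linarith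
  have hc2p : 0 < c2 := by rw [k1]; positivity
  have hder : ∀ n z, deriv (fun z => x n (-z)) z = - deriv (x n) (-z) := by
    intro n z; exact deriv_comp_neg (x n) z
  have k2 := h.flip.key hc hc2p hc0 (fun z hz => by
      have := hlo (-z) (by simpa using hz)
      simpa using this)
    (fun n => by
      obtain ⟨K, hK⟩ := e2 n
      refine ⟨K, fun z hz => ?_⟩
      have := hK (-z) (by simp; linarith)
      rw [hder, ← norm_neg]
      refine le_of_eq_of_le (congrArg norm ?_) this
      ring)
    (fun n => by
      obtain ⟨K, hK⟩ := e1 n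
      refine ⟨K, fun z hz => ?_⟩
      have := hK (-z) (by simp; linarith)
      rw [hder, ← norm_neg]
      refine le_of_eq_of_le (congrArg norm ?_) this
      ring)
  have k3 : c * (θ * θ - 1) = 0 := by
    rw [← hθ] at k2
    rw [k1] at k2
    linear_combination -k2
  have k4 : θ * θ - 1 = 0 := (mul_eq_zero.1 k3).resolve_left hcp.ne'
  have k5 : θ = 1 := by nlinarith
  have k6 : ((S.d 0 : ℝ) - 2) * S.d (-1) = 1 := by
    rw [hθ] at k5
    have : (S.d 0 : ℝ) - 2 = 1 / S.d (-1) := by linarith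
    rw [this]; field_simp
  have k7 : ((S.d 0 : ℤ) - 2) * S.d (-1) = 1 := by exact_mod_cast k6
  have k8 : (S.d (-1) : ℤ) ∣ 1 := ⟨(S.d 0 : ℤ) - 2, by linarith [mul_comm ((S.d 0 : ℤ) - 2) (S.d (-1) : ℤ)]⟩
  have k9 := Int.le_of_dvd one_pos k8
  have e6 : (2:ℤ) ≤ S.d (-1) := by exact_mod_cast S.deg (-1)
  omega

lemma Lim.absurd (hc : S.Cst M B C) (h : S.Lim M A x) {z : ℂ}
    (hp : 0 < S.pot M (fun j => x j z)) : False := by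
  rcases lt_trichotomy z.im 0 with hz | hz | hz
  · exact h.flip.absurd_pos hc (z := -z) (by simpa using hz) (by simpa using hp)
  · have h1 := h.real z.re
    have : ((z.re : ℝ) : ℂ) = z := by apply Complex.ext <;> simp [hz]
    rw [this] at h1
    exact hp.ne' h1
  · exact h.absurd_pos hc hz hp

end Sys


lemma ultra_lip (U : Filter ℕ) (F : ℕ → ℂ → ℂ)
    (hF : ∀ R : ℝ, ∃ K, ∀ᶠ m in U, DifferentiableOn ℂ (F m) (Metric.ball 0 R) ∧
      ∀ z ∈ Metric.ball (0:ℂ) R, ‖F m z‖ ≤ K) (R : ℝ) :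
    ∃ L, 0 < L ∧ ∀ᶠ m in U, ∀ z ∈ Metric.ball (0:ℂ) R, ∀ z' ∈ Metric.ball (0:ℂ) R,
      ‖F m z - F m z'‖ ≤ L * ‖z - z'‖ := by
  obtain ⟨K, hK⟩ := hF (R + 1)
  refine ⟨2 * |K| + 1, by positivity, ?_⟩
  filter_upwards [hK] with m hm z hz z' hz'
  have hb : ∀ w ∈ Metric.ball (0:ℂ) R, ‖deriv (F m) w‖ ≤ 2 * |K| + 1 := by
    intro w hw
    have hsub : Metric.closedBall w (1/2) ⊆ Metric.ball (0:ℂ) (R + 1) := by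
      intro v hv
      rw [Metric.mem_ball] at hw ⊢
      rw [Metric.mem_closedBall] at hv
      have := dist_triangle v w 0
      linarith
    have hd : DiffContOnCl ℂ (F m) (Metric.ball w (1/2)) := by
      refine DifferentiableOn.diffContOnCl ?_
      rw [closure_ball _ (by norm_num)]
      exact hm.1.mono hsub
    have := Complex.norm_deriv_le_of_forall_mem_sphere_norm_le (by norm_num) hd
      (fun v hv => hm.2 v (hsub (Metric.sphere_subset_closedBall hv)))
    have h2 := le_abs_self K
    linarith
  refine (convex_ball (0:ℂ) R).norm_image_sub_le_of_norm_deriv_le (𝕜 := ℂ) (fun w hw => ?_) hb hz' hz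
  refine hm.1.differentiableAt (Metric.isOpen_ball.mem_nhds ?_)
  exact Metric.ball_subset_ball (by linarith) hw

lemma ultra_limit (U : Ultrafilter ℕ) (F : ℕ → ℂ → ℂ)
    (hF : ∀ R : ℝ, ∃ K, ∀ᶠ m in (U : Filter ℕ), DifferentiableOn ℂ (F m) (Metric.ball 0 R) ∧
      ∀ z ∈ Metric.ball (0:ℂ) R, ‖F m z‖ ≤ K) :
    ∃ G : ℂ → ℂ, Differentiable ℂ G ∧ ∀ (q : ℕ → ℂ) (z : ℂ), Tendsto q U (𝓝 z) →
      Tendsto (fun m => F m (q m)) U (𝓝 (G z)) := by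
  have hpt : ∀ z, ∃ g, Tendsto (fun m => F m z) U (𝓝 g) := by
    intro z
    obtain ⟨K, hK⟩ := hF (‖z‖ + 1)
    have hcomp : IsCompact (Metric.closedBall (0:ℂ) K) := isCompact_closedBall _ _
    have := hcomp.ultrafilter_le_nhds (U.map (fun m => F m z)) (by
      rw [le_principal_iff]
      change ∀ᶠ m in (U : Filter ℕ), F m z ∈ Metric.closedBall (0:ℂ) K
      filter_upwards [hK] with m hm
      simpa using hm.2 z (by simp))
    obtain ⟨g, -, hg⟩ := this
    exact ⟨g, hg⟩
  choose G hG using hpt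
  have hGL : ∀ R, ∃ L, 0 < L ∧ (∀ᶠ m in (U : Filter ℕ), ∀ z ∈ Metric.ball (0:ℂ) R, ∀ z' ∈ Metric.ball (0:ℂ) R,
      ‖F m z - F m z'‖ ≤ L * ‖z - z'‖) ∧ ∀ z ∈ Metric.ball (0:ℂ) R, ∀ z' ∈ Metric.ball (0:ℂ) R,
      ‖G z - G z'‖ ≤ L * ‖z - z'‖ := by
    intro R
    obtain ⟨L, hL, h⟩ := ultra_lip U F hF R
    refine ⟨L, hL, h, fun z hz z' hz' => ?_⟩
    refine le_of_tendsto ((hG z).sub (hG z')).norm ?_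
    filter_upwards [h] with m hm using hm z hz z' hz'
  have hunif : ∀ R, TendstoUniformlyOn F G U (Metric.ball 0 R) := by
    intro R
    obtain ⟨L, hL, h1, h2⟩ := hGL R
    rw [Metric.tendstoUniformlyOn_iff]
    intro ε hε
    have htb : TotallyBounded (Metric.ball (0:ℂ) R) :=
      (isCompact_closedBall (0:ℂ) R).totallyBounded.subset Metric.ball_subset_closedBall
    obtain ⟨t, hts, htf, ht⟩ := Metric.finite_approx_of_totallyBounded htb (ε / (3 * L)) (by positivity)
    have h3 : ∀ᶠ m in (U : Filter ℕ), ∀ y ∈ t, dist (F m y) (G y) < ε / 3 := by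
      rw [htf.eventually_all]
      intro y _
      exact (Metric.tendsto_nhds.1 (hG y)) _ (by positivity)
    filter_upwards [h1, h3] with m hm1 hm3 z hz
    obtain ⟨y, hy, hzy⟩ := Set.mem_iUnion₂.1 (ht hz)
    rw [Metric.mem_ball, dist_eq_norm] at hzy
    have k1 := hm1 z hz y (hts hy)
    have k2 := h2 z hz y (hts hy)
    have k3 := hm3 y hy
    rw [lt_div_iff₀ (by positivity)] at hzy
    rw [dist_eq_norm] at k3 ⊢
    have e : G z - F m z = (G z - G y) - (F m y - G y) - (F m z - F m y) := by ring
    have n1 := norm_sub_le ((G z - G y) - (F m y - G y)) (F m z - F m y)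
    have n2 := norm_sub_le (G z - G y) (F m y - G y)
    rw [e]
    nlinarith
  refine ⟨G, ?_, ?_⟩
  · intro z
    have hd : DifferentiableOn ℂ G (Metric.ball 0 (‖z‖ + 1)) := by
      obtain ⟨K, hK⟩ := hF (‖z‖ + 1)
      exact (hunif _).tendstoLocallyUniformlyOn.differentiableOn (hK.mono fun m hm => hm.1) Metric.isOpen_ball
    exact hd.differentiableAt (Metric.isOpen_ball.mem_nhds (by simp))
  · intro q z hq
    obtain ⟨L, hL, h1, h2⟩ := hGL (‖z‖ + 1)
    have hq2 : ∀ᶠ m in (U : Filter ℕ), q m ∈ Metric.ball (0:ℂ) (‖z‖ + 1) :=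
      hq (Metric.isOpen_ball.mem_nhds (by simp))
    have h3 : Tendsto (fun m => F m (q m) - F m z) U (𝓝 0) := by
      refine squeeze_zero_norm' (a := fun m => L * ‖q m - z‖) ?_ ?_
      · filter_upwards [h1, hq2] with m hm hqm using hm _ hqm _ (by simp)
      · have := (hq.sub_const z).norm.const_mul L
        simpa using this
    have := h3.add (hG z)
    simpa using this

namespace Sys
variable {S : Sys} {M B C A b : ℝ}

lemma pot_eq_of_bound (hc : S.Cst M B C) {x : ℤ → ℂ} {N : ℤ} (h : S.Tame M x N) {P : ℝ}
    (hb : ∀ j, |S.D j * P - LL M x j| ≤ C) : S.pot M x = P := by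
  have h1 : Tendsto (fun j => C / S.D j) atTop (𝓝 0) := S.tendsto_D.const_div_atTop C
  have h2 : Tendsto (fun j : ℤ => LL M x j / S.D j) atTop (𝓝 P) := by
    rw [tendsto_iff_dist_tendsto_zero]
    refine squeeze_zero (fun _ => dist_nonneg) (fun j => ?_) h1
    have hD := S.Dpos j
    rw [dist_comm, Real.dist_eq, le_div_iff₀ hD, ← abs_of_pos hD, ← abs_mul, abs_of_pos hD, sub_mul,
      div_mul_cancel₀ _ hD.ne', mul_comm]
    exact hb j
  exact tendsto_nhds_unique (pot_tendsto hc h) h2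

lemma tendsto_LL (hc : S.Cst M B C) {U : Filter ℕ} {Y : ℕ → ℤ → ℂ} {x : ℤ → ℂ} {j : ℤ}
    (h : Tendsto (fun m => Y m j) U (𝓝 (x j))) :
    Tendsto (fun m => LL M (Y m) j) U (𝓝 (LL M x j)) := by
  unfold LL
  have hM := hc.M2
  refine Tendsto.log ?_ (lt_max_of_lt_left (by linarith)).ne'
  exact tendsto_const_nhds.max h.norm

/-- one half plane of the dichotomy in the limit -/
lemma limit_half (hc : S.Cst M B C) (U : Filter ℕ) [U.NeBot] {Y : ℕ → ℤ → ℂ → ℂ} {P : ℂ → ℝ} {σ : ℝ}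
    (hσ : σ = 1 ∨ σ = -1)
    (l1 : ∀ R : ℝ, ∀ N : ℤ, ∀ᶠ m in U, (∀ j, DifferentiableOn ℂ (Y m j) (Metric.ball 0 R)) ∧
      ∀ z ∈ Metric.ball (0:ℂ) R, S.Tame M (fun j => Y m j z) N)
    (hP : ∀ z, Tendsto (fun m => S.pot M (fun j => Y m j z)) U (𝓝 (P z)))
    (l5 : (∀ z : ℂ, 0 < σ * z.im → ∀ᶠ m in U, S.pot M (fun j => Y m j z) = 0) ∨
      (∀ T ρ : ℝ, 0 < ρ → ρ < T → ∀ᶠ m in U, ∀ z ∈ Metric.ball (Complex.I * (σ * T)) ρ,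
        0 < S.pot M (fun j => Y m j z))) :
    (∀ z : ℂ, 0 < σ * z.im → P z = 0) ∨ (∀ z : ℂ, 0 < σ * z.im → 0 < P z) := by
  have hP0 : ∀ z, 0 ≤ P z := by
    intro z
    refine ge_of_tendsto (hP z) ?_
    filter_upwards [l1 (‖z‖ + 1) 0] with m hm
    exact pot_nonneg hc (hm.2 z (by simp))
  rcases l5 with l5 | l5
  · left
    intro z hz
    exact tendsto_nhds_unique (hP z) (tendsto_const_nhds.congr' ((l5 z hz).mono fun m hm => hm.symm))
  · by_contra hcon
    push Not at hcon
    obtain ⟨⟨w, hw, hPw⟩, ⟨z, hz, hPz⟩⟩ := hcon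
    have hPz0 : P z = 0 := le_antisymm hPz (hP0 z)
    have hPw0 : 0 < P w := lt_of_le_of_ne (hP0 w) (Ne.symm hPw)
    have hσ2 : σ * σ = 1 := by rcases hσ with rfl | rfl <;> norm_num
    -- a ball containing a given point
    have hball : ∀ v : ℂ, 0 < σ * v.im → ∃ T0 : ℝ, 0 < T0 ∧ ∀ T : ℝ, T0 ≤ T →
        dist v (Complex.I * (σ * T)) ^ 2 ≤ T ^ 2 - σ * v.im * T := by
      intro v hv
      refine ⟨(‖v‖ ^ 2 + 1) / (σ * v.im), by positivity, fun T hT => ?_⟩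
      rw [div_le_iff₀ hv] at hT
      have e : dist v (Complex.I * (σ * T)) ^ 2 = ‖v‖ ^ 2 - 2 * (σ * v.im) * T + T ^ 2 := by
        rw [dist_eq_norm, ← Complex.normSq_eq_norm_sq, ← Complex.normSq_eq_norm_sq, Complex.normSq_apply,
          Complex.normSq_apply]
        simp
        linear_combination T ^ 2 * hσ2
      rw [e]; nlinarith
    obtain ⟨T1, hT1, h1⟩ := hball w hw
    obtain ⟨T2, hT2, h2⟩ := hball z hz
    set T := max T1 T2 with hT
    have hT0 : 0 < T := lt_max_of_lt_left hT1
    have d1 := h1 T (le_max_left _ _)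
    have d2 := h2 T (le_max_right _ _)
    set c := Complex.I * (σ * T) with hcdef
    have d1' : dist w c < T := by
      refine lt_of_pow_lt_pow_left₀ 2 hT0.le ?_
      have : 0 < σ * w.im * T := by positivity
      linarith
    have d2' : dist z c < T := by
      refine lt_of_pow_lt_pow_left₀ 2 hT0.le ?_
      have : 0 < σ * z.im * T := by positivity
      linarith
    obtain ⟨ρ, hρ1, hρ2⟩ := exists_between (max_lt d1' d2')
    have hρw : dist w c < ρ := lt_of_le_of_lt (le_max_left _ _) hρ1
    have hρz : dist z c < ρ := lt_of_le_of_lt (le_max_right _ _) hρ1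
    have hρ0 : 0 < ρ := lt_of_le_of_lt dist_nonneg hρw
    have hsub : Metric.ball c ρ ⊆ Metric.ball 0 (‖c‖ + ρ) := by
      intro v hv
      rw [Metric.mem_ball] at hv ⊢
      have := dist_triangle v c 0
      rw [dist_zero_right c] at this
      linarith
    have hev := (l5 T ρ hρ0 hρ2).and (l1 (‖c‖ + ρ) 0)
    have k1 : P w * (ρ - dist w c) ≤ P c * (ρ + dist w c) := by
      refine le_of_tendsto_of_tendsto ((hP w).mul_const _) ((hP c).mul_const _) ?_
      filter_upwards [hev] with m hm
      exact (harnack_pot hc (fun j => (hm.2.1 j).mono hsub) (fun v hv => hm.2.2 v (hsub hv)) hm.1 hρw).2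
    have k2 : P c * (ρ - dist z c) ≤ P z * (ρ + dist z c) := by
      refine le_of_tendsto_of_tendsto ((hP c).mul_const _) ((hP z).mul_const _) ?_
      filter_upwards [hev] with m hm
      exact (harnack_pot hc (fun j => (hm.2.1 j).mono hsub) (fun v hv => hm.2.2 v (hsub hv)) hm.1 hρz).1
    rw [hPz0, zero_mul] at k2
    have k3 : P c ≤ 0 := by
      by_contra h; push Not at h
      have := mul_pos h (sub_pos.2 hρz); linarith
    have k4 : 0 < P w * (ρ - dist w c) := mul_pos hPw0 (sub_pos.2 hρw)
    have k5 : P c * (ρ + dist w c) ≤ 0 := mul_nonpos_of_nonpos_of_nonneg k3 (by positivity)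
    linarith

lemma limit_absurd (hc : S.Cst M B C) (hA : 0 ≤ A) (hb : 0 < b) {Y : ℕ → ℤ → ℂ → ℂ}
    (l1 : ∀ R : ℝ, ∀ N : ℤ, ∀ᶠ m in atTop, (∀ j, DifferentiableOn ℂ (Y m j) (Metric.ball 0 R)) ∧
      ∀ z ∈ Metric.ball (0:ℂ) R, S.Tame M (fun j => Y m j z) N)
    (l2 : ∀ R : ℝ, ∀ᶠ m in atTop, ∀ z ∈ Metric.ball (0:ℂ) R, S.pot M (fun j => Y m j z) ≤ A * (1 + ‖z‖))
    (l3 : ∀ m, ∃ z : ℂ, ‖z‖ ≤ 1 ∧ b ≤ S.pot M (fun j => Y m j z))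
    (l4 : ∀ t : ℝ, ∃ q : ℕ → ℂ, Tendsto q atTop (𝓝 (t:ℂ)) ∧ ∀ᶠ m in atTop, S.pot M (fun j => Y m j (q m)) = 0)
    (l5 : ∀ σ : ℝ, σ = 1 ∨ σ = -1 →
      (∀ z : ℂ, 0 < σ * z.im → ∀ᶠ m in atTop, S.pot M (fun j => Y m j z) = 0) ∨
      (∀ T ρ : ℝ, 0 < ρ → ρ < T → ∀ᶠ m in atTop, ∀ z ∈ Metric.ball (Complex.I * (σ * T)) ρ,
        0 < S.pot M (fun j => Y m j z))) : False := by
  obtain ⟨U, hU⟩ : ∃ U : Ultrafilter ℕ, (U : Filter ℕ) ≤ atTop := ⟨Ultrafilter.of atTop, Ultrafilter.of_le _⟩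
  have l1' := fun R N => (l1 R N).filter_mono hU
  have l2' := fun R => (l2 R).filter_mono hU
  have hlim : ∀ j, ∃ G : ℂ → ℂ, Differentiable ℂ G ∧ ∀ (q : ℕ → ℂ) (z : ℂ), Tendsto q U (𝓝 z) →
      Tendsto (fun m => Y m j (q m)) U (𝓝 (G z)) := by
    intro j
    refine ultra_limit U (fun m => Y m j) fun R => ⟨Real.exp (S.D j * (A * (1 + R)) + C), ?_⟩
    filter_upwards [l1' R j, l2' R] with m h1 h2
    refine ⟨h1.1 j, fun z hz => ?_⟩
    have hD := S.Dpos j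
    refine (norm_le_exp hc (h1.2 z hz) le_rfl).trans (Real.exp_le_exp.2 ?_)
    have h3 : S.pot M (fun j => Y m j z) ≤ A * (1 + R) := by
      refine (h2 z hz).trans ?_
      rw [mem_ball_zero_iff] at hz
      gcongr
    gcongr
  choose x hx1 hx2 using hlim
  have hxz : ∀ j z, Tendsto (fun m => Y m j z) U (𝓝 (x j z)) := fun j z => hx2 j _ z tendsto_const_nhds
  have htame : ∀ z N, S.Tame M (fun j => x j z) N := by
    intro z N
    constructor
    · intro j
      have h1 : Tendsto (fun m => S.stp j (Y m j z) (Y m (j-1) z)) U (𝓝 (S.stp j (x j z) (x (j-1) z))) := by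
        unfold stp
        exact (((S.p j).continuous.tendsto _).comp (hxz j z)).sub ((hxz (j-1) z).const_mul _)
      refine tendsto_nhds_unique (hxz (j+1) z) (h1.congr' ?_)
      filter_upwards [l1' (‖z‖ + 1) 0] with m hm
      exact ((hm.2 z (by simp)).orb j).symm
    · refine le_of_tendsto_of_tendsto (hxz (N-1) z).norm (tendsto_const_nhds.max (hxz N z).norm) ?_
      filter_upwards [l1' (‖z‖ + 1) N] with m hm
      exact (hm.2 z (by simp)).ini
  -- limits of potentials along moving points
  have hpq : ∀ (q : ℕ → ℂ) (z : ℂ) (P : ℝ), Tendsto q U (𝓝 z) →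
      Tendsto (fun m => S.pot M (fun j => Y m j (q m))) U (𝓝 P) → S.pot M (fun j => x j z) = P := by
    intro q z P hq hP
    refine pot_eq_of_bound hc (htame z 0) fun j => ?_
    have h1 : Tendsto (fun m => LL M (fun j => Y m j (q m)) j) U (𝓝 (LL M (fun j => x j z) j)) :=
      tendsto_LL hc (hx2 j q z hq)
    refine le_of_tendsto ((hP.const_mul (S.D j)).sub h1).abs ?_
    have hqb : ∀ᶠ m in (U : Filter ℕ), q m ∈ Metric.ball (0:ℂ) (‖z‖ + 1) :=
      hq (Metric.isOpen_ball.mem_nhds (by simp))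
    filter_upwards [hqb, l1' (‖z‖ + 1) j] with m hm1 hm2
    exact pot_bound hc (hm2.2 _ hm1) le_rfl
  have hpc : ∀ (q : ℕ → ℂ) (z : ℂ), Tendsto q U (𝓝 z) →
      Tendsto (fun m => S.pot M (fun j => Y m j (q m))) U (𝓝 (S.pot M (fun j => x j z))) := by
    intro q z hq
    have hcomp : IsCompact (Set.Icc (0:ℝ) (A * (1 + (‖z‖ + 1)))) := isCompact_Icc
    have hqb : ∀ᶠ m in (U : Filter ℕ), q m ∈ Metric.ball (0:ℂ) (‖z‖ + 1) :=
      hq (Metric.isOpen_ball.mem_nhds (by simp))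
    obtain ⟨P, -, hP⟩ := hcomp.ultrafilter_le_nhds (U.map (fun m => S.pot M (fun j => Y m j (q m)))) (by
      rw [le_principal_iff]
      change ∀ᶠ m in (U : Filter ℕ), S.pot M (fun j => Y m j (q m)) ∈ Set.Icc (0:ℝ) (A * (1 + (‖z‖ + 1)))
      filter_upwards [hqb, l1' (‖z‖ + 1) 0, l2' (‖z‖ + 1)] with m h1 h2 h3
      refine ⟨pot_nonneg hc (h2.2 _ h1), (h3 _ h1).trans ?_⟩
      rw [mem_ball_zero_iff] at h1
      gcongr)
    have hP' : Tendsto (fun m => S.pot M (fun j => Y m j (q m))) U (𝓝 P) := hP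
    rwa [hpq q z P hq hP']
  have hpz : ∀ z, Tendsto (fun m => S.pot M (fun j => Y m j z)) U (𝓝 (S.pot M (fun j => x j z))) :=
    fun z => hpc _ z tendsto_const_nhds
  have hLim : S.Lim M A x := by
    refine ⟨hA, hx1, htame, ?_, ?_, ?_, ?_⟩
    · intro t
      obtain ⟨q, hq1, hq2⟩ := l4 t
      refine hpq q t 0 (hq1.mono_left hU) ?_
      exact tendsto_const_nhds.congr' ((hq2.filter_mono hU).mono fun m hm => hm.symm)
    · intro z
      refine le_of_tendsto (hpz z) ?_
      filter_upwards [l2' (‖z‖ + 1)] with m hm using hm z (by simp)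
    · have := limit_half hc (U : Filter ℕ) (σ := 1) (Or.inl rfl) l1' hpz (by
        rcases l5 1 (Or.inl rfl) with h | h
        · exact Or.inl fun z hz => (h z hz).filter_mono hU
        · exact Or.inr fun T ρ h1 h2 => (h T ρ h1 h2).filter_mono hU)
      simpa using this
    · have := limit_half hc (U : Filter ℕ) (σ := -1) (Or.inr rfl) l1' hpz (by
        rcases l5 (-1) (Or.inr rfl) with h | h
        · exact Or.inl fun z hz => (h z hz).filter_mono hU
        · exact Or.inr fun T ρ h1 h2 => (h T ρ h1 h2).filter_mono hU)
      simpa using this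
  choose q hq1 hq2 using l3
  obtain ⟨z, -, hz⟩ := (isCompact_closedBall (0:ℂ) 1).ultrafilter_le_nhds (U.map q) (by
    rw [le_principal_iff]
    change ∀ᶠ m in (U : Filter ℕ), q m ∈ Metric.closedBall (0:ℂ) 1
    exact Eventually.of_forall fun m => by simpa using hq1 m)
  have hz' : Tendsto q U (𝓝 z) := hz
  have : b ≤ S.pot M (fun j => x j z) := ge_of_tendsto (hpc q z hz') (Eventually.of_forall hq2)
  exact hLim.absurd hc (lt_of_lt_of_le hb this)

end Sys


lemma scales {Mf : ℝ → ℝ} {r1 c : ℝ} (hr1 : 0 < r1) (hc : 0 < c)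
    (mono : ∀ r s, 0 < r → r ≤ s → s ≤ r1 → Mf r ≤ Mf s)
    (low : ∀ r, 0 < r → r ≤ r1 → c * r ≤ Mf r) :
    ∃ C', 1 ≤ C' ∧ ∀ δ : ℝ, 0 < δ → ∃ r, 0 < r ∧ r < δ ∧ r ≤ r1 ∧
      ∀ s, r ≤ s → s ≤ r1 → Mf s * r ≤ C' * Mf r * s := by
  by_cases hK : ∃ K, ∀ r, 0 < r → r ≤ r1 → Mf r ≤ K * r
  · obtain ⟨K, hK⟩ := hK
    refine ⟨max 1 (K / c), le_max_left _ _, fun δ hδ => ⟨min (δ / 2) r1, by positivity,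
      lt_of_le_of_lt (min_le_left _ _) (by linarith), min_le_right _ _, fun s hs hs1 => ?_⟩⟩
    set r := min (δ / 2) r1 with hr
    have hr0 : 0 < r := by positivity
    have h1 := hK s (by linarith) hs1
    have h2 := low r hr0 (by linarith)
    have h3 : K / c ≤ max 1 (K / c) := le_max_right _ _
    rw [div_le_iff₀ hc] at h3
    set C' := max 1 (K / c)
    have hC' : 1 ≤ C' := le_max_left _ _
    calc Mf s * r ≤ K * s * r := by gcongr
      _ ≤ C' * c * s * r := by
        have : 0 < s * r := mul_pos (by linarith) hr0
        nlinarith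
      _ = C' * (c * r) * s := by ring
      _ ≤ C' * Mf r * s := by
        have : 0 ≤ s := by linarith
        gcongr
  · push Not at hK
    refine ⟨2, by norm_num, fun δ hδ => ?_⟩
    set φ : ℝ → ℝ := fun r => Mf r / r with hφ
    have hφ0 : ∀ r, 0 < r → r ≤ r1 → 0 < φ r := fun r h0 h1 => by
      have := low r h0 h1
      exact div_pos (lt_of_lt_of_le (by positivity) this) h0
    have hMr1 : 0 < Mf r1 := lt_of_lt_of_le (by positivity) (low r1 hr1 le_rfl)
    have hub : ∀ d, 0 < d → ∀ s, d ≤ s → s ≤ r1 → φ s ≤ Mf r1 / d := by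
      intro d hd s h1 h2
      simp only [hφ]
      have := mono s r1 (by linarith) h2 le_rfl
      gcongr
    obtain ⟨s, hs0, hs1, hs⟩ := hK (Mf r1 / δ)
    have hs' : Mf r1 / δ < φ s := by
      simp only [hφ]; rwa [lt_div_iff₀ hs0]
    set T := φ '' Set.Icc s r1 with hT
    have hTb : BddAbove T := ⟨Mf r1 / s, by rintro _ ⟨v, hv, rfl⟩; exact hub s hs0 v hv.1 hv.2⟩
    have hTn : T.Nonempty := ⟨φ s, s, ⟨le_rfl, hs1⟩, rfl⟩
    have hle : ∀ v, s ≤ v → v ≤ r1 → φ v ≤ sSup T := fun v h1 h2 => le_csSup hTb ⟨v, ⟨h1, h2⟩, rfl⟩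
    obtain ⟨r, hr, hr2, hr3⟩ : ∃ r ∈ Set.Icc s r1, sSup T ≤ 2 * φ r ∧ φ s ≤ φ r := by
      by_cases h : sSup T ≤ 2 * φ s
      · exact ⟨s, ⟨le_rfl, hs1⟩, h, le_rfl⟩
      · push Not at h
        have : sSup T / 2 < sSup T := by
          have := hφ0 s hs0 hs1
          linarith
        obtain ⟨_, ⟨r, hr, rfl⟩, hr2⟩ := exists_lt_of_lt_csSup hTn this
        exact ⟨r, hr, by linarith, by linarith⟩
    have hr0 : 0 < r := by linarith [hr.1]
    refine ⟨r, hr0, ?_, hr.2, fun v h1 h2 => ?_⟩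
    · by_contra hcon
      push Not at hcon
      have := hub δ hδ r hcon hr.2
      linarith
    · have h3 := (hle v (by linarith [hr.1]) h2).trans hr2
      simp only [hφ] at h3
      rw [div_le_iff₀ (by linarith)] at h3
      calc Mf v * r ≤ (2 * (Mf r / r) * v) * r := by gcongr
        _ = 2 * Mf r * v := by field_simp

namespace Sys
variable {S : Sys} {M B C A b : ℝ}

lemma Tame.shift {x : ℤ → ℂ} {N : ℤ} (h : S.Tame M x N) (n : ℕ) :
    S.Tame M (fun j => x (j + S.k * n)) (N - S.k * n) where
  orb := h.orb.shift n
  ini := by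
    have := h.ini
    rw [show N - S.k * n - 1 + S.k * n = N - 1 by ring, show N - S.k * n + S.k * n = N by ring]
    exact this

lemma pot_shift (hc : S.Cst M B C) {x : ℤ → ℂ} {N : ℤ} (h : S.Tame M x N) (n : ℕ) :
    S.pot M (fun j => x (j + S.k * n)) = S.D S.k ^ n * S.pot M x := by
  have h1 := pot_tendsto hc (h.shift n)
  have h2 : Tendsto (fun j : ℤ => j + (S.k * n : ℤ)) atTop atTop := tendsto_atTop_add_const_right _ _ tendsto_id
  have h3 := ((pot_tendsto hc h).comp h2).const_mul (S.D S.k ^ n)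
  refine tendsto_nhds_unique h1 (h3.congr fun j => ?_)
  simp only [Function.comp, D_per_n, LL]
  have := S.Dpos S.k
  have := S.Dpos j
  field_simp

structure Loc (S : Sys) (M : ℝ) (y : ℤ → ℂ → ℂ) (r0 : ℝ) : Prop where
  r0pos : 0 < r0
  diff : ∀ j, DifferentiableOn ℂ (y j) (Metric.ball 0 r0)
  tame : ∀ z ∈ Metric.ball (0:ℂ) r0, S.Tame M (fun j => y j z) 0
  zero : S.pot M (fun j => y j 0) = 0
  low : ∃ c r1, 0 < c ∧ 0 < r1 ∧ ∀ r : ℝ, 0 < r → r ≤ r1 → ∃ z : ℂ, ‖z‖ ≤ r ∧ c * r ≤ S.pot M (fun j => y j z)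
  real : ∃ q : ℝ → ℂ, (∀ᶠ t in 𝓝 0, S.pot M (fun j => y j (q t)) = 0) ∧
    Asymptotics.IsLittleO (𝓝 0) (fun t : ℝ => q t - t) (fun t : ℝ => t)
  half : ∀ σ : ℝ, σ = 1 ∨ σ = -1 →
    (∀ ε : ℝ, 0 < ε → ∃ r, 0 < r ∧ ∀ z : ℂ, ‖z‖ < r → ε * ‖z‖ < σ * z.im → S.pot M (fun j => y j z) = 0) ∨
    (∀ ε : ℝ, 0 < ε → ∃ r, 0 < r ∧ ∀ z : ℂ, ‖z‖ < r → ε * ‖z‖ < σ * z.im → 0 < S.pot M (fun j => y j z))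

lemma one_lt_Dk : 1 < S.D S.k := by
  have := S.D_two_pow 0 S.k
  rw [S.D0, zero_add, mul_one] at this
  exact lt_of_lt_of_le (one_lt_pow₀ one_lt_two S.kpos.ne') this

lemma Loc.false (hc : S.Cst M B C) {y : ℤ → ℂ → ℂ} {r0 : ℝ} (h : S.Loc M y r0) : False := by
  set g : ℂ → ℝ := fun z => S.pot M (fun j => y j z) with hg
  have hgc : ContinuousOn g (Metric.ball 0 r0) :=
    pot_continuousOn hc (fun j => (h.diff j).continuousOn) h.tame
  obtain ⟨c, r1', hc0, hr1', hlow⟩ := h.low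
  have h0 : (0:ℂ) ∈ Metric.ball (0:ℂ) r0 := Metric.mem_ball_self h.r0pos
  have hg0 : g 0 = 0 := h.zero
  have hgc0 : ContinuousAt g 0 := hgc.continuousAt (Metric.isOpen_ball.mem_nhds h0)
  have hsm : ∀ ε : ℝ, 0 < ε → ∃ δ : ℝ, 0 < δ ∧ ∀ z : ℂ, ‖z‖ < δ → g z < ε := by
    intro ε hε
    have : ∀ᶠ z in 𝓝 (0:ℂ), g z < ε := hgc0.eventually_lt_const (by rw [hg0]; exact hε)
    obtain ⟨δ, hδ, hh⟩ := Metric.eventually_nhds_iff.1 this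
    exact ⟨δ, hδ, fun z hz => hh (by simpa using hz)⟩
  obtain ⟨δ1, hδ1, hδ1'⟩ := hsm 1 one_pos
  set r1 := min r1' (min (δ1 / 2) (r0 / 2)) with hr1
  have hr0 := h.r0pos
  have hr1p : 0 < r1 := by positivity
  have hr1a : r1 ≤ r1' := min_le_left _ _
  have hr1b : r1 ≤ δ1 / 2 := (min_le_right _ _).trans (min_le_left _ _)
  have hr1c : r1 ≤ r0 / 2 := (min_le_right _ _).trans (min_le_right _ _)
  have hmax : ∀ r : ℝ, ∃ z : ℂ, 0 ≤ r → r ≤ r1 → ‖z‖ ≤ r ∧ ∀ w : ℂ, ‖w‖ ≤ r → g w ≤ g z := by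
    intro r
    by_cases hr : 0 ≤ r ∧ r ≤ r1
    · obtain ⟨z, hz, hz2⟩ := (isCompact_closedBall (0:ℂ) r).exists_isMaxOn
        ⟨0, Metric.mem_closedBall_self hr.1⟩ (hgc.mono (Metric.closedBall_subset_ball (by linarith [hr.2])))
      refine ⟨z, fun _ _ => ⟨by simpa using hz, fun w hw => hz2 (by simpa using hw)⟩⟩
    · exact ⟨0, fun a b => absurd ⟨a, b⟩ hr⟩
  choose ζ hζ using hmax
  set Mf : ℝ → ℝ := fun r => g (ζ r) with hMf
  have hMle : ∀ r w, 0 ≤ r → r ≤ r1 → ‖w‖ ≤ r → g w ≤ Mf r := fun r w a b e => (hζ r a b).2 w e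
  have hlow' : ∀ r, 0 < r → r ≤ r1 → c * r ≤ Mf r := by
    intro r a b
    obtain ⟨z, hz1, hz2⟩ := hlow r a (b.trans hr1a)
    exact hz2.trans (hMle r z a.le b hz1)
  obtain ⟨C', hC', hsc⟩ := scales (Mf := Mf) hr1p hc0
    (fun r s a b e => hMle s _ (by linarith) e ((hζ r a.le (b.trans e)).1.trans b)) hlow'
  choose r hrp hrlt hrle hrs using fun m : ℕ => hsc (1 / ((m:ℝ) + 1)) (by positivity)
  have hrt : Tendsto r atTop (𝓝 0) :=
    squeeze_zero (fun m => (hrp m).le) (fun m => (hrlt m).le) tendsto_one_div_add_atTop_nhds_zero_nat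
  set Δ := S.D S.k with hΔ
  have hΔ1 : 1 < Δ := one_lt_Dk
  have hMp : ∀ m, 0 < Mf (r m) := fun m => lt_of_lt_of_le (mul_pos hc0 (hrp m)) (hlow' _ (hrp m) (hrle m))
  have hM1 : ∀ m, Mf (r m) ≤ 1 := fun m => (hδ1' _ (by
    have := (hζ (r m) (hrp m).le (hrle m)).1
    have := hrle m
    linarith)).le
  have hn : ∀ m, ∃ n : ℕ, Δ ^ n ≤ 1 / Mf (r m) ∧ 1 / Mf (r m) < Δ ^ (n + 1) := fun m =>
    exists_nat_pow_near (by rw [le_div_iff₀ (hMp m)]; linarith [hM1 m]) hΔ1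
  choose n hn1 hn2 using hn
  have hn1' : ∀ m, Δ ^ n m * Mf (r m) ≤ 1 := fun m => by
    have := hn1 m; rwa [le_div_iff₀ (hMp m)] at this
  have hn2' : ∀ m, 1 / Δ ≤ Δ ^ n m * Mf (r m) := fun m => by
    have := hn2 m
    rw [div_lt_iff₀ (hMp m)] at this
    rw [div_le_iff₀ (by linarith)]
    have e : Δ ^ n m * Mf (r m) * Δ = Δ ^ (n m + 1) * Mf (r m) := by ring
    rw [e]; exact this.le
  have hnt : Tendsto n atTop atTop := by
    rw [tendsto_atTop]
    intro N
    obtain ⟨δ, hδ, hδ'⟩ := hsm (1 / Δ ^ N) (by positivity)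
    filter_upwards [hrt.eventually_lt_const hδ] with m hm
    have h1 : Mf (r m) < 1 / Δ ^ N := hδ' _ (lt_of_le_of_lt (hζ _ (hrp m).le (hrle m)).1 hm)
    have h2 : Δ ^ N < Δ ^ (n m + 1) := by
      refine lt_trans ?_ (hn2 m)
      rw [lt_div_iff₀ (hMp m)]
      rw [lt_div_iff₀ (by positivity)] at h1
      linarith [mul_comm (Δ ^ N) (Mf (r m))]
    have := (pow_lt_pow_iff_right₀ hΔ1).1 h2
    omega
  have hsmall : ∀ R δ : ℝ, 0 < δ → ∀ᶠ m in atTop, r m * R < δ := by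
    intro R δ hδ
    have := hrt.mul_const R
    rw [zero_mul] at this
    exact this.eventually_lt_const hδ
  have hnr : ∀ m (z : ℂ), ‖(r m : ℂ) * z‖ = r m * ‖z‖ := fun m z => by
    rw [norm_mul, Complex.norm_real, Real.norm_of_nonneg (hrp m).le]
  set Y : ℕ → ℤ → ℂ → ℂ := fun m j z => y (j + S.k * n m) (r m * z) with hY
  have hYpot : ∀ m (z : ℂ), r m * ‖z‖ < r0 → S.pot M (fun j => Y m j z) = Δ ^ n m * g (r m * z) := by
    intro m z hz
    exact pot_shift hc (h.tame (r m * z) (by rw [mem_ball_zero_iff, hnr]; exact hz)) (n m)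
  have hΔp : ∀ m, 0 < Δ ^ n m := fun m => by positivity
  refine limit_absurd hc (A := C') (b := 1 / Δ) (Y := Y) (by linarith) (by positivity) ?_ ?_ ?_ ?_ ?_
  · intro R N
    filter_upwards [hsmall |R| r0 hr0, hnt.eventually_ge_atTop N.natAbs] with m hm hnm
    have hb : ∀ z ∈ Metric.ball (0:ℂ) R, (r m : ℂ) * z ∈ Metric.ball (0:ℂ) r0 := by
      intro z hz
      rw [mem_ball_zero_iff] at hz ⊢
      rw [hnr]
      have h1 : ‖z‖ ≤ |R| := hz.le.trans (le_abs_self R)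
      have := mul_le_mul_of_nonneg_left h1 (hrp m).le
      linarith
    refine ⟨fun j => ?_, fun z hz => ?_⟩
    · exact (h.diff (j + S.k * n m)).comp (differentiable_id.const_mul (r m : ℂ)).differentiableOn hb
    · have h1 := (h.tame _ (hb z hz)).shift (n m)
      refine h1.mono hc ?_
      have : (n m : ℤ) ≤ S.k * n m := by
        have := S.kpos
        exact_mod_cast Nat.le_mul_of_pos_left (n m) this
      omega
  · intro R
    filter_upwards [hsmall |R| r1 hr1p] with m hm z hz
    have hz1 : ‖z‖ ≤ |R| := by
      rw [mem_ball_zero_iff] at hz; exact hz.le.trans (le_abs_self R)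
    have hz2 : r m * ‖z‖ < r1 := lt_of_le_of_lt (mul_le_mul_of_nonneg_left hz1 (hrp m).le) hm
    rw [hYpot m z (by linarith)]
    have key : g (r m * z) ≤ C' * Mf (r m) * (1 + ‖z‖) := by
      have hMm := hMp m
      rcases le_total ‖z‖ 1 with h1 | h1
      · have k1 : g (r m * z) ≤ Mf (r m) := hMle _ _ (hrp m).le (hrle m) (by
          rw [hnr]; exact mul_le_of_le_one_right (hrp m).le h1)
        have k2 : 1 * Mf (r m) * 1 ≤ C' * Mf (r m) * (1 + ‖z‖) := by
          gcongr; linarith [norm_nonneg z]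
        linarith
      · have k1 : g (r m * z) ≤ Mf (r m * ‖z‖) := hMle _ _ (mul_nonneg (hrp m).le (norm_nonneg z)) hz2.le (by rw [hnr])
        have k2 := hrs m (r m * ‖z‖) (le_mul_of_one_le_right (hrp m).le h1) hz2.le
        have k3 : Mf (r m * ‖z‖) ≤ C' * Mf (r m) * ‖z‖ := by
          refine le_of_mul_le_mul_right ?_ (hrp m)
          linarith [mul_comm (r m) ‖z‖, show C' * Mf (r m) * (r m * ‖z‖) = C' * Mf (r m) * ‖z‖ * r m by ring]
        have k4 : 0 ≤ C' * Mf (r m) := by positivity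
        linarith
    calc Δ ^ n m * g (r m * z) ≤ Δ ^ n m * (C' * Mf (r m) * (1 + ‖z‖)) := by gcongr
      _ = (Δ ^ n m * Mf (r m)) * (C' * (1 + ‖z‖)) := by ring
      _ ≤ 1 * (C' * (1 + ‖z‖)) := by
        have := hn1' m
        gcongr
      _ = _ := one_mul _
  · intro m
    have hr' : (r m : ℂ) ≠ 0 := by exact_mod_cast (hrp m).ne'
    have h1 := (hζ (r m) (hrp m).le (hrle m)).1
    have h2 : ‖ζ (r m) / r m‖ ≤ 1 := by
      rw [norm_div, Complex.norm_real, Real.norm_of_nonneg (hrp m).le, div_le_one (hrp m)]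
      exact h1
    refine ⟨ζ (r m) / r m, h2, ?_⟩
    rw [hYpot m _ (by
      have := mul_le_mul_of_nonneg_left h2 (hrp m).le
      have := hrle m
      linarith), mul_div_cancel₀ _ hr']
    exact hn2' m
  · intro t
    obtain ⟨q, hq1, hq2⟩ := h.real
    have hrt' : Tendsto (fun m => r m * t) atTop (𝓝 0) := by
      have := hrt.mul_const t; rwa [zero_mul] at this
    have hqt : Tendsto (fun m => q (r m * t) / r m) atTop (𝓝 (t:ℂ)) := by
      have h1 := hq2.comp_tendsto hrt'
      have h2 : Asymptotics.IsLittleO atTop (fun m => q (r m * t) - (r m * t : ℝ)) (fun m => r m) :=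
        h1.trans_isBigO (Asymptotics.isBigO_of_le' (c := |t|) _ fun m => by
          simp only [Function.comp, norm_mul, Real.norm_eq_abs]; rw [mul_comm])
      have h3 : Asymptotics.IsLittleO atTop (fun m => q (r m * t) - (r m * t : ℝ)) (fun m => (r m : ℂ)) := by
        refine h2.trans_isBigO (Asymptotics.isBigO_of_le _ fun m => ?_)
        rw [Complex.norm_real]
      have h4 := h3.tendsto_div_nhds_zero.add_const (t:ℂ)
      rw [zero_add] at h4
      refine h4.congr fun m => ?_
      have hr' : (r m : ℂ) ≠ 0 := by exact_mod_cast (hrp m).ne'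
      push_cast
      field_simp
      ring
    refine ⟨fun m => q (r m * t) / r m, hqt, ?_⟩
    have hb : ∀ᶠ m in atTop, ‖q (r m * t) / r m‖ < |t| + 1 :=
      hqt.norm.eventually_lt_const (by rw [Complex.norm_real, Real.norm_eq_abs]; linarith)
    filter_upwards [hrt'.eventually hq1, hb, hsmall (|t| + 1) r0 hr0] with m h1 h2 h3
    have hr' : (r m : ℂ) ≠ 0 := by exact_mod_cast (hrp m).ne'
    have := mul_le_mul_of_nonneg_left h2.le (hrp m).le
    rw [hYpot m _ (by linarith), mul_div_cancel₀ _ hr']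
    exact mul_eq_zero_of_right _ h1
  · intro σ hσ
    have hcone : ∀ m (ε : ℝ) (z : ℂ), ε * ‖z‖ < σ * z.im → ε * ‖(r m : ℂ) * z‖ < σ * ((r m : ℂ) * z).im := by
      intro m ε z hz
      rw [hnr, Complex.im_ofReal_mul]
      have := mul_lt_mul_of_pos_left hz (hrp m)
      linarith [show r m * (ε * ‖z‖) = ε * (r m * ‖z‖) by ring, show r m * (σ * z.im) = σ * (r m * z.im) by ring]
    rcases h.half σ hσ with hh | hh
    · left
      intro z hz
      have hz0 : 0 < ‖z‖ := by
        rw [norm_pos_iff]; rintro rfl; simp at hz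
      obtain ⟨ρ, hρ, hh⟩ := hh (σ * z.im / (2 * ‖z‖)) (by positivity)
      filter_upwards [hsmall ‖z‖ ρ hρ, hsmall ‖z‖ r0 hr0] with m h1 h2
      rw [hYpot m z h2]
      refine mul_eq_zero_of_right _ (hh _ (by rw [hnr]; exact h1) (hcone m _ z ?_))
      have : σ * z.im / (2 * ‖z‖) * ‖z‖ = σ * z.im / 2 := by field_simp
      rw [this]; linarith
    · right
      intro T ρ hρ hρT
      obtain ⟨ρ', hρ', hh⟩ := hh ((T - ρ) / (2 * (T + ρ))) (div_pos (by linarith) (by linarith))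
      have hσ2 : σ * σ = 1 := by rcases hσ with rfl | rfl <;> norm_num
      have hσa : |σ| = 1 := by rcases hσ with rfl | rfl <;> norm_num
      filter_upwards [hsmall (T + ρ) ρ' hρ', hsmall (T + ρ) r0 hr0] with m h1 h2 z hz
      have hz1 : ‖z - Complex.I * (σ * T)‖ < ρ := by rwa [Metric.mem_ball, dist_eq_norm] at hz
      have hcn : ‖Complex.I * (σ * T)‖ = T := by
        rw [norm_mul, norm_mul, Complex.norm_I, Complex.norm_real, Complex.norm_real, Real.norm_eq_abs,
          Real.norm_eq_abs, hσa, abs_of_pos (by linarith)]; ring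
      have hz2 : ‖z‖ < T + ρ := by
        have := norm_add_le (z - Complex.I * (σ * T)) (Complex.I * (σ * T))
        rw [sub_add_cancel, hcn] at this
        linarith
      have hz3 : T - ρ < σ * z.im := by
        have h3 := Complex.abs_im_le_norm (z - Complex.I * (σ * T))
        have h4 : (z - Complex.I * (σ * T)).im = z.im - σ * T := by simp
        rw [h4] at h3
        have h5 : |σ * (z.im - σ * T)| < ρ := by
          rw [abs_mul, hσa, one_mul]; linarith
        have h6 := (abs_lt.1 h5).1
        have h7 : σ * (z.im - σ * T) = σ * z.im - T := by linear_combination -T * hσ2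
        linarith
      have hz4 : r m * ‖z‖ ≤ r m * (T + ρ) := mul_le_mul_of_nonneg_left hz2.le (hrp m).le
      rw [hYpot m z (by linarith)]
      refine mul_pos (hΔp m) (hh _ (by rw [hnr]; linarith) (hcone m _ z ?_))
      have h8 : (T - ρ) / (2 * (T + ρ)) * ‖z‖ ≤ (T - ρ) / (2 * (T + ρ)) * (T + ρ) :=
        mul_le_mul_of_nonneg_left hz2.le (div_pos (by linarith) (by linarith)).le
      have h9 : (T - ρ) / (2 * (T + ρ)) * (T + ρ) = (T - ρ) / 2 := by
        have : T + ρ ≠ 0 := by linarith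
        field_simp
      linarith

end Sys


lemma preconn_dich {V K : Set ℂ} (hV : IsPreconnected V) (h : ∀ z ∈ V, z ∉ frontier K) :
    V ⊆ K ∨ ∀ z ∈ V, z ∉ K := by
  have hdis : Disjoint (interior K) (closure K)ᶜ := by
    rw [Set.disjoint_compl_right_iff_subset]
    exact interior_subset.trans subset_closure
  have hcov : V ⊆ interior K ∪ (closure K)ᶜ := by
    intro z hz
    by_contra hcon
    simp only [Set.mem_union, Set.mem_compl_iff, not_or, not_not] at hcon
    exact h z hz ⟨hcon.2, hcon.1⟩
  rcases hV.subset_or_subset isOpen_interior isClosed_closure.isOpen_compl hdis hcov with h1 | h1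
  · exact Or.inl (h1.trans interior_subset)
  · exact Or.inr fun z hz hK => h1 hz (subset_closure hK)

/-- Baire step: some relatively open nonempty piece of the curve lies in a compact arc. -/
lemma baire_arc {E : Set ℂ} (hE : IsLocallyClosed E) (hne : E.Nonempty) {I : Set ℝ} {η : ℝ → ℂ}
    (hI : IsOpen I) (hη : ContinuousOn η I) (him : η '' I = E) :
    ∃ α β : ℝ, Set.Icc α β ⊆ I ∧ ∃ O : Set ℂ, IsOpen O ∧ (O ∩ E).Nonempty ∧ O ∩ E ⊆ η '' Set.Icc α β := by
  haveI : LocallyCompactSpace E := hE.locallyCompactSpace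
  haveI : Nonempty E := hne.to_subtype
  let Q := {ab : ℚ × ℚ // Set.Icc (ab.1 : ℝ) (ab.2 : ℝ) ⊆ I}
  let F : Q → Set E := fun ab => Subtype.val ⁻¹' (η '' Set.Icc (ab.1.1 : ℝ) (ab.1.2 : ℝ))
  have hF : ∀ ab, IsClosed (F ab) := by
    intro ab
    refine IsClosed.preimage continuous_subtype_val ?_
    exact (isCompact_Icc.image_of_continuousOn (hη.mono ab.2)).isClosed
  have hU : ⋃ ab, F ab = Set.univ := by
    refine Set.eq_univ_of_forall fun z => ?_
    have : (z : ℂ) ∈ η '' I := by rw [him]; exact z.2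
    obtain ⟨t, ht, hz⟩ := this
    obtain ⟨δ, hδ, hb⟩ := Metric.isOpen_iff.1 hI t ht
    obtain ⟨a, ha1, ha2⟩ := exists_rat_btwn (show t - δ < t by linarith)
    obtain ⟨b, hb1, hb2⟩ := exists_rat_btwn (show t < t + δ by linarith)
    refine Set.mem_iUnion.2 ⟨⟨(a, b), ?_⟩, t, ⟨ha2.le, hb1.le⟩, hz⟩
    intro s hs
    refine hb ?_
    rw [Metric.mem_ball, Real.dist_eq, abs_lt]
    constructor <;> linarith [hs.1, hs.2]
  obtain ⟨ab, hab⟩ := nonempty_interior_of_iUnion_of_closed hF hU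
  obtain ⟨O, hO, hO2⟩ := isOpen_induced_iff.1 (isOpen_interior (s := F ab))
  refine ⟨ab.1.1, ab.1.2, ab.2, O, hO, ?_, ?_⟩
  · obtain ⟨z, hz⟩ := hab
    rw [← hO2] at hz
    exact ⟨z, hz, z.2⟩
  · rintro z ⟨hz1, hz2⟩
    have : (⟨z, hz2⟩ : E) ∈ interior (F ab) := by rw [← hO2]; exact hz1
    have h2 : (⟨z, hz2⟩ : E) ∈ F ab := interior_subset this
    exact h2

/-- points of the arc near `η t0` have parameter near `t0` -/
lemma arc_near {η : ℝ → ℂ} {α β t0 : ℝ} (hη : ContinuousOn η (Set.Icc α β)) (hinj : Set.InjOn η (Set.Icc α β))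
    (ht0 : t0 ∈ Set.Icc α β) {τ : ℝ} (hτ : 0 < τ) :
    ∃ r : ℝ, 0 < r ∧ ∀ t ∈ Set.Icc α β, dist (η t) (η t0) < r → |t - t0| < τ := by
  have hcomp : IsCompact (Set.Icc α β \ Metric.ball t0 τ) := isCompact_Icc.diff Metric.isOpen_ball
  have hcl : IsClosed (η '' (Set.Icc α β \ Metric.ball t0 τ)) :=
    (hcomp.image_of_continuousOn (hη.mono Set.diff_subset)).isClosed
  have hnot : η t0 ∈ (η '' (Set.Icc α β \ Metric.ball t0 τ))ᶜ := by
    rintro ⟨t, ht, h⟩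
    have := hinj ht.1 ht0 h
    subst this
    exact ht.2 (Metric.mem_ball_self hτ)
  obtain ⟨r, hr, hb⟩ := Metric.isOpen_iff.1 hcl.isOpen_compl _ hnot
  refine ⟨r, hr, fun t ht hd => ?_⟩
  by_contra hcon
  exact hb hd ⟨t, ⟨ht, fun h => hcon (by rwa [Metric.mem_ball, Real.dist_eq] at h)⟩, rfl⟩

lemma convex_cone (ε σ r : ℝ) (hε : 0 < ε) : Convex ℝ {z : ℂ | ‖z‖ < r ∧ ε * ‖z‖ < σ * z.im} := by
  intro u hu v hv a b ha hb hab
  have hn : ‖a • u + b • v‖ ≤ a * ‖u‖ + b * ‖v‖ := by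
    refine (norm_add_le _ _).trans ?_
    rw [norm_smul, norm_smul, Real.norm_of_nonneg ha, Real.norm_of_nonneg hb]
  have key : ∀ p q p' q' : ℝ, p < p' → q < q' → a * p + b * q < a * p' + b * q' := by
    intro p q p' q' h1 h2
    rcases ha.eq_or_lt with rfl | ha'
    · have : b = 1 := by linarith
      subst this; linarith
    · have := mul_lt_mul_of_pos_left h1 ha'
      have := mul_le_mul_of_nonneg_left h2.le hb
      linarith
  constructor
  · have := key _ _ _ _ hu.1 hv.1
    have e : a * r + b * r = r := by rw [← add_mul, hab, one_mul]
    linarith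
  · have := key _ _ _ _ hu.2 hv.2
    have e : (a • u + b • v).im = a * u.im + b * v.im := by simp
    rw [e]
    have := mul_le_mul_of_nonneg_left hn hε.le
    nlinarith

namespace Sys
variable {S : Sys}

lemma geom {X : ℤ → ℂ → ℂ} (hX : ∀ j, DifferentiableOn ℂ (X j) (Metric.ball 0 1))
    (hO : ∀ z ∈ Metric.ball (0:ℂ) 1, S.IsOrb (fun j => X j z)) {K : Set ℂ}
    (hK : ∀ z, z ∈ K ↔ z ∈ Metric.ball (0:ℂ) 1 ∧ ∃ R : ℝ, ∀ n : ℕ, ‖X n z‖ ≤ R)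
    (hK1 : K.Nonempty) (hK2 : ¬ Metric.ball (0:ℂ) 1 ⊆ K) {I : Set ℝ} {η : ℝ → ℂ}
    (hI : IsOpen I) (hinj : Set.InjOn η I) (hη : ContDiffOn ℝ 1 η I) (hη' : ∀ t ∈ I, deriv η t ≠ 0)
    (him : η '' I = Metric.ball 0 1 ∩ frontier K) : False := by
  set E : Set ℂ := Metric.ball 0 1 ∩ frontier K with hE
  have hEne : E.Nonempty := by
    by_contra hcon
    rw [Set.not_nonempty_iff_eq_empty] at hcon
    rcases preconn_dich (K := K) (convex_ball (0:ℂ) 1).isPreconnected (fun z hz hf => by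
      have : z ∈ E := ⟨hz, hf⟩
      rw [hcon] at this; exact this) with h | h
    · exact hK2 h
    · obtain ⟨z, hz⟩ := hK1
      exact h z ((hK z).1 hz).1 hz
  have hElc : IsLocallyClosed E := Metric.isOpen_ball.isLocallyClosed.inter isClosed_frontier.isLocallyClosed
  obtain ⟨α, β, hab, O, hOo, ⟨e0, he0O, he0E⟩, hOE⟩ := baire_arc hElc hEne hI hη.continuousOn him
  obtain ⟨ρ0, hρ0, hball⟩ : ∃ ρ0 > 0, Metric.closedBall e0 ρ0 ⊆ O ∩ Metric.ball 0 1 :=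
    Metric.nhds_basis_closedBall.mem_iff.1 ((hOo.inter Metric.isOpen_ball).mem_nhds ⟨he0O, he0E.1⟩)
  -- constants
  obtain ⟨M0, hM0⟩ : ∃ M0, ∀ z ∈ Metric.closedBall e0 ρ0, ‖X (-1) z‖ ≤ M0 :=
    (isCompact_closedBall e0 ρ0).exists_bound_of_continuousOn
      ((hX (-1)).continuousOn.mono fun z hz => (hball hz).2)
  obtain ⟨M, B, C, hMM, hc⟩ := S.exists_cst M0
  have htame : ∀ z ∈ Metric.closedBall e0 ρ0, S.Tame M (fun j => X j z) 0 := by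
    intro z hz
    refine ⟨hO z (hball hz).2, ?_⟩
    exact le_max_of_le_left (by rw [zero_sub]; exact (hM0 z hz).trans hMM)
  set G : ℂ → ℝ := fun z => S.pot M (fun j => X j z) with hG
  have hGc : ContinuousOn G (Metric.closedBall e0 ρ0) :=
    pot_continuousOn hc (fun j => (hX j).continuousOn.mono fun z hz => (hball hz).2) htame
  have hGK : ∀ z ∈ Metric.closedBall e0 ρ0, (z ∈ K ↔ G z = 0) := by
    intro z hz
    rw [hK]
    constructor
    · rintro ⟨-, R, hR⟩
      refine pot_eq_zero_of_bdd hc (htame z hz) R (Eventually.frequently ?_)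
      filter_upwards [eventually_ge_atTop (0:ℤ)] with j hj
      obtain ⟨n, rfl⟩ := Int.eq_ofNat_of_zero_le hj
      exact hR n
    · intro h0
      refine ⟨(hball hz).2, Real.exp C, fun n => ?_⟩
      have h1 := norm_le_exp hc (htame z hz) (j := (n:ℤ)) (by omega)
      have h2 : S.pot M (fun j => X j z) = 0 := h0
      rw [h2, mul_zero, zero_add] at h1
      exact h1
  have hG0 : ∀ z ∈ Metric.closedBall e0 ρ0, 0 ≤ G z := fun z hz => pot_nonneg hc (htame z hz)
  have hGpos : ∀ z ∈ Metric.closedBall e0 ρ0, z ∉ K → 0 < G z := by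
    intro z hz hzK
    refine lt_of_le_of_ne (hG0 z hz) fun h => hzK ((hGK z hz).2 h.symm)
  set K' := Metric.closedBall e0 ρ0 ∩ G ⁻¹' {0} with hK'
  have hK'cl : IsClosed K' := hGc.preimage_isClosed_of_isClosed Metric.isClosed_closedBall isClosed_singleton
  have hK'c : IsCompact K' := (isCompact_closedBall e0 ρ0).of_isClosed_subset hK'cl Set.inter_subset_left
  -- E near e0 is in K
  have hEK : ∀ z ∈ Metric.ball e0 ρ0, z ∈ E → z ∈ K := by
    intro z hz hzE
    have h1 : z ∈ closure K := frontier_subset_closure hzE.2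
    have h2 : z ∈ closure (Metric.ball e0 ρ0 ∩ K) := Metric.isOpen_ball.inter_closure ⟨hz, h1⟩
    have h3 : Metric.ball e0 ρ0 ∩ K ⊆ K' := fun v hv =>
      ⟨Metric.ball_subset_closedBall hv.1, (hGK v (Metric.ball_subset_closedBall hv.1)).1 hv.2⟩
    have h4 : z ∈ K' := (hK'cl.closure_subset_iff.2 h3) h2
    exact (hGK z h4.1).2 h4.2
  have he0K : e0 ∈ K := hEK e0 (Metric.mem_ball_self hρ0) he0E
  -- a point outside K near e0
  obtain ⟨w, hw1, hw2⟩ : ∃ w, w ∈ Metric.ball e0 (ρ0 / 2) ∧ w ∉ K := by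
    have h1 : e0 ∈ closure Kᶜ := by
      have := he0E.2
      rw [frontier_eq_closure_inter_closure] at this
      exact this.2
    obtain ⟨w, hw, hwd⟩ := Metric.mem_closure_iff.1 h1 (ρ0 / 2) (by positivity)
    exact ⟨w, by rwa [Metric.mem_ball, dist_comm], hw⟩
  have he0K' : e0 ∈ K' := ⟨Metric.mem_closedBall_self hρ0.le, (hGK e0 (Metric.mem_closedBall_self hρ0.le)).1 he0K⟩
  obtain ⟨z0, hz0, hz0d⟩ := hK'c.exists_infDist_eq_dist ⟨e0, he0K'⟩ w
  set s := dist w z0 with hs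
  have hs_le : ∀ v ∈ K', s ≤ dist w v := fun v hv => by
    rw [← hz0d]; exact Metric.infDist_le_dist_of_mem hv
  rw [Metric.mem_ball] at hw1
  have hs1 : s < ρ0 / 2 := lt_of_le_of_lt (hs_le e0 he0K') hw1
  have hz0K : z0 ∈ K := (hGK z0 hz0.1).2 hz0.2
  have hs0 : 0 < s := dist_pos.2 fun h => hw2 (h ▸ hz0K)
  have hz0b : z0 ∈ Metric.ball e0 ρ0 := by
    rw [Metric.mem_ball]
    have := dist_triangle z0 w e0
    rw [dist_comm z0 w] at this
    linarith
  have hwsub : Metric.ball w s ⊆ Metric.closedBall e0 ρ0 := by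
    intro v hv
    rw [Metric.mem_ball] at hv
    rw [Metric.mem_closedBall]
    have := dist_triangle v w e0
    linarith
  have hwpos : ∀ v ∈ Metric.ball w s, 0 < G v := by
    intro v hv
    refine lt_of_le_of_ne (hG0 v (hwsub hv)) fun h => ?_
    have := hs_le v ⟨hwsub hv, h.symm⟩
    rw [Metric.mem_ball, dist_comm] at hv
    linarith
  have hz0E : z0 ∈ E := by
    refine ⟨(hball hz0.1).2, ?_⟩
    rw [frontier_eq_closure_inter_closure]
    refine ⟨subset_closure hz0K, ?_⟩
    have h1 : Metric.ball w s ⊆ Kᶜ := fun v hv hvK => (hwpos v hv).ne' ((hGK v (hwsub hv)).1 hvK)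
    have h2 := closure_mono h1
    rw [closure_ball w hs0.ne'] at h2
    exact h2 (by rw [Metric.mem_closedBall, dist_comm])
  obtain ⟨t0, ht0, hηt0⟩ := hOE ⟨(hball hz0.1).1, hz0E⟩
  have ht0I : t0 ∈ I := hab ht0
  set e := deriv η t0 with he
  have he0 : e ≠ 0 := hη' t0 ht0I
  have hen : 0 < ‖e‖ := norm_pos_iff.2 he0
  have hder : HasDerivAt η e t0 :=
    ((hη.contDiffAt (hI.mem_nhds ht0I)).differentiableAt one_ne_zero).hasDerivAt
  -- radius
  obtain ⟨r0', hr0', hr0b⟩ := Metric.isOpen_iff.1 Metric.isOpen_ball z0 hz0b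
  set r0 := r0' / ‖e‖ with hr0
  have hr0p : 0 < r0 := by positivity
  have hmap : ∀ ζ ∈ Metric.ball (0:ℂ) r0, z0 + e * ζ ∈ Metric.ball e0 ρ0 := by
    intro ζ hζ
    refine hr0b ?_
    rw [mem_ball_zero_iff, hr0, lt_div_iff₀ hen] at hζ
    rw [Metric.mem_ball, dist_eq_norm, add_sub_cancel_left, norm_mul, mul_comm]
    exact hζ
  have hmap' : ∀ ζ ∈ Metric.ball (0:ℂ) r0, z0 + e * ζ ∈ Metric.closedBall e0 ρ0 := fun ζ hζ =>
    Metric.ball_subset_closedBall (hmap ζ hζ)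
  have hLoc : S.Loc M (fun j ζ => X j (z0 + e * ζ)) r0 := by
    refine ⟨hr0p, ?_, ?_, ?_, ?_, ?_, ?_⟩
    · intro j
      refine (hX j).comp ?_ fun ζ hζ => (hball (hmap' ζ hζ)).2
      exact ((differentiable_id.const_mul e).const_add z0).differentiableOn
    · exact fun ζ hζ => htame _ (hmap' ζ hζ)
    · have : G z0 = 0 := hz0.2
      simpa using this
    · have hGw : 0 < G w := hwpos w (Metric.mem_ball_self hs0)
      refine ⟨G w * ‖e‖ / (2 * s), s / ‖e‖ / 2, by positivity, by positivity, fun r hr hr1 => ?_⟩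
      set u : ℝ := r * ‖e‖ / s with hu
      have hu0 : 0 < u := by positivity
      have hu1 : u ≤ 1 / 2 := by
        rw [hu, div_le_iff₀ hs0]
        rw [div_div, le_div_iff₀ (by positivity)] at hr1
        linarith
      have hd : ‖w - z0‖ = s := by rw [hs, dist_eq_norm]
      refine ⟨(w - z0) * u / e, ?_, ?_⟩
      · rw [norm_div, norm_mul, hd, Complex.norm_real, Real.norm_of_nonneg hu0.le, hu]
        apply le_of_eq; field_simp
      · have e1 : z0 + e * ((w - z0) * u / e) = z0 + (w - z0) * u := by field_simp
        rw [e1]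
        set v := z0 + (w - z0) * u with hv
        have hvd : dist v w = (1 - u) * s := by
          rw [dist_eq_norm, hv, show z0 + (w - z0) * (u:ℂ) - w = (w - z0) * ((u - 1 : ℝ) : ℂ) by push_cast; ring,
            norm_mul, hd, Complex.norm_real, Real.norm_eq_abs, abs_of_nonpos (by linarith)]
          ring
        have hvb : v ∈ Metric.ball w s := by
          rw [Metric.mem_ball, hvd]; nlinarith
        have hh := (harnack_pot hc (fun j => (hX j).mono fun z hz => (hball (hwsub hz)).2)
          (fun z hz => htame z (hwsub hz)) hwpos hvb).1
        rw [hvd] at hh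
        have hGv : 0 < G v := hwpos v hvb
        change G w * (s - (1 - u) * s) ≤ G v * (s + (1 - u) * s) at hh
        change G w * ‖e‖ / (2 * s) * r ≤ G v
        have e2 : G w * ‖e‖ / (2 * s) * r = G w * u / 2 := by rw [hu]; field_simp
        rw [e2]
        have h5 : G w * u * s ≤ G v * (2 * s) := by
          have : G v * (s + (1 - u) * s) ≤ G v * (2 * s) := by
            refine mul_le_mul_of_nonneg_left ?_ hGv.le
            nlinarith
          linarith [show G w * (s - (1 - u) * s) = G w * u * s by ring]
        have h6 : G w * u ≤ 2 * G v := by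
          refine le_of_mul_le_mul_right ?_ hs0
          linarith [show G v * (2 * s) = 2 * G v * s by ring]
        linarith
    · refine ⟨fun t => (η (t0 + t) - z0) / e, ?_, ?_⟩
      · have hcont : ContinuousAt (fun t : ℝ => t0 + t) 0 := by fun_prop
        have h1 : ∀ᶠ t in 𝓝 (0:ℝ), t0 + t ∈ I := hcont.eventually (by
          simpa using hI.mem_nhds ht0I)
        have h2 : ∀ᶠ t in 𝓝 (0:ℝ), η (t0 + t) ∈ Metric.ball e0 ρ0 := by
          have h3 : Tendsto (fun t : ℝ => t0 + t) (𝓝 0) (𝓝 t0) := by simpa using hcont.tendsto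
          exact (hder.continuousAt.tendsto.comp h3) (Metric.isOpen_ball.mem_nhds (by rw [hηt0]; exact hz0b))
        filter_upwards [h1, h2] with t ht1 ht2
        have e1 : z0 + e * ((η (t0 + t) - z0) / e) = η (t0 + t) := by field_simp; ring
        rw [e1]
        have hE' : η (t0 + t) ∈ E := by rw [← him]; exact ⟨_, ht1, rfl⟩
        exact (hGK _ (Metric.ball_subset_closedBall ht2)).1 (hEK _ ht2 hE')
      · have h1 := hasDerivAt_iff_isLittleO_nhds_zero.1 hder
        have h2 := h1.const_mul_left e⁻¹
        refine h2.congr_left fun t => ?_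
        rw [hηt0, Complex.real_smul]
        field_simp
    · intro σ hσ
      have hσa : |σ| = 1 := by rcases hσ with rfl | rfl <;> norm_num
      -- cones avoid E
      have hcone : ∀ ε : ℝ, 0 < ε → ∃ r, 0 < r ∧ r ≤ r0 ∧ ∀ ζ : ℂ, ‖ζ‖ < r → ε * ‖ζ‖ < σ * ζ.im → z0 + e * ζ ∉ E := by
        intro ε hε
        set ε' := ε / (1 + ε) with hε'
        have hε'0 : 0 < ε' := by positivity
        have hlo := (hasDerivAt_iff_isLittleO.1 hder).def (c := ε' * ‖e‖) (by positivity)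
        obtain ⟨τ, hτ, hτ'⟩ := Metric.eventually_nhds_iff.1 hlo
        obtain ⟨r, hr, hr'⟩ := arc_near (hη.continuousOn.mono hab) (hinj.mono hab) ht0 hτ
        refine ⟨min (r / ‖e‖) r0, by positivity, min_le_right _ _, fun ζ hζ1 hζ2 hζE => ?_⟩
        have hζr : ‖ζ‖ < r / ‖e‖ := lt_of_lt_of_le hζ1 (min_le_left _ _)
        have hζr0 : ‖ζ‖ < r0 := lt_of_lt_of_le hζ1 (min_le_right _ _)
        have hin : z0 + e * ζ ∈ O := (hball (hmap' ζ (by simpa using hζr0))).1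
        obtain ⟨t, ht, hte⟩ := hOE ⟨hin, hζE⟩
        rw [lt_div_iff₀ hen] at hζr
        have h1 : |t - t0| < τ := hr' t ht (by
          rw [hte, hηt0, dist_eq_norm, add_sub_cancel_left, norm_mul, mul_comm]; exact hζr)
        have h2 := hτ' (y := t) (by rw [Real.dist_eq]; exact h1)
        rw [hte, hηt0, Complex.real_smul, show z0 + e * ζ - z0 - ((t - t0 : ℝ):ℂ) * e = e * (ζ - (t - t0 : ℝ)) by ring,
          norm_mul, Real.norm_eq_abs] at h2
        have h3 : ‖ζ - (t - t0 : ℝ)‖ ≤ ε' * |t - t0| := by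
          refine le_of_mul_le_mul_left ?_ hen
          linarith [show ε' * ‖e‖ * |t - t0| = ‖e‖ * (ε' * |t - t0|) by ring]
        have h4 : |ζ.im| ≤ ε' * |t - t0| := by
          have := Complex.abs_im_le_norm (ζ - (t - t0 : ℝ))
          rw [Complex.sub_im, Complex.ofReal_im, sub_zero] at this
          linarith
        have h5 : |t - t0| ≤ ‖ζ‖ + ε' * |t - t0| := by
          have := norm_sub_norm_le ((t - t0 : ℝ):ℂ) ζ
          rw [norm_sub_rev, Complex.norm_real, Real.norm_eq_abs] at this
          linarith
        have h6 : ε' * |t - t0| ≤ ε * ‖ζ‖ := by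
          have e3 : ε * (1 - ε') = ε' := by rw [hε']; field_simp; ring
          have := mul_le_mul_of_nonneg_left h5 hε.le
          nlinarith
        have h7 : σ * ζ.im ≤ |ζ.im| := by
          refine (le_abs_self _).trans ?_
          rw [abs_mul, hσa, one_mul]
        linarith
      -- dichotomy per cone
      have hdich : ∀ ε : ℝ, 0 < ε → ∃ r, 0 < r ∧
          ((∀ ζ : ℂ, ‖ζ‖ < r → ε * ‖ζ‖ < σ * ζ.im → G (z0 + e * ζ) = 0) ∨
           (∀ ζ : ℂ, ‖ζ‖ < r → ε * ‖ζ‖ < σ * ζ.im → 0 < G (z0 + e * ζ))) := by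
        intro ε hε
        obtain ⟨r, hr, hrr0, hav⟩ := hcone ε hε
        refine ⟨r, hr, ?_⟩
        have hpre : IsPreconnected ((fun ζ : ℂ => z0 + e * ζ) '' {z : ℂ | ‖z‖ < r ∧ ε * ‖z‖ < σ * z.im}) :=
          (convex_cone ε σ r hε).isPreconnected.image _ (by fun_prop)
        have hin : ∀ ζ : ℂ, ‖ζ‖ < r → ζ ∈ Metric.ball (0:ℂ) r0 := fun ζ hζ => by
          rw [mem_ball_zero_iff]; linarith
        rcases preconn_dich (K := K) hpre (by
          rintro _ ⟨ζ, hζ, rfl⟩ hf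
          exact hav ζ hζ.1 hζ.2 ⟨(hball (hmap' ζ (hin ζ hζ.1))).2, hf⟩) with h | h
        · left
          intro ζ h1 h2
          exact (hGK _ (hmap' ζ (hin ζ h1))).1 (h ⟨ζ, ⟨h1, h2⟩, rfl⟩)
        · right
          intro ζ h1 h2
          exact hGpos _ (hmap' ζ (hin ζ h1)) (h _ ⟨ζ, ⟨h1, h2⟩, rfl⟩)
      by_cases hall : ∀ ε : ℝ, 0 < ε → ∃ r, 0 < r ∧ ∀ ζ : ℂ, ‖ζ‖ < r → ε * ‖ζ‖ < σ * ζ.im → G (z0 + e * ζ) = 0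
      · exact Or.inl hall
      · right
        push Not at hall
        obtain ⟨ε1, hε1, hno⟩ := hall
        intro ε hε
        obtain ⟨r, hr, hd⟩ := hdich (min ε ε1) (lt_min hε hε1)
        refine ⟨r, hr, ?_⟩
        rcases hd with hd | hd
        · exfalso
          obtain ⟨ζ, h1, h2, h3⟩ := hno r hr
          refine h3 (hd ζ h1 (lt_of_le_of_lt ?_ h2))
          exact mul_le_mul_of_nonneg_right (min_le_right _ _) (norm_nonneg _)
        · intro ζ h1 h2
          refine hd ζ h1 (lt_of_le_of_lt ?_ h2)
          exact mul_le_mul_of_nonneg_right (min_le_left _ _) (norm_nonneg _)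
  exact hLoc.false hc

end Sys


/-- forward steps of a sequence of Hénon maps -/
def fwd (p : ℕ → Polynomial ℂ) (a : ℕ → ℂ) : ℕ → ℂ × ℂ → ℂ × ℂ
  | 0, w => w
  | n + 1, w => ((p n).eval (fwd p a n w).1 - a n * (fwd p a n w).2, (fwd p a n w).1)

lemma fwd_congr {p p' : ℕ → Polynomial ℂ} {a a' : ℕ → ℂ} (n : ℕ)
    (h : ∀ i < n, p i = p' i ∧ a i = a' i) (w : ℂ × ℂ) : fwd p a n w = fwd p' a' n w := by
  induction n with
  | zero => rfl
  | succ n ih =>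
    have h1 := ih (fun i hi => h i (by omega))
    have h2 := h n (by omega)
    simp only [fwd]
    rw [h1, h2.1, h2.2]

lemma fwd_add {p : ℕ → Polynomial ℂ} {a : ℕ → ℂ} {m : ℕ}
    (hp : ∀ n, p (m + n) = p n) (ha : ∀ n, a (m + n) = a n) (n : ℕ) (w : ℂ × ℂ) :
    fwd p a (m + n) w = fwd p a n (fwd p a m w) := by
  induction n with
  | zero => rfl
  | succ n ih =>
    rw [← add_assoc]
    simp only [fwd]
    rw [ih, hp, ha]

lemma fwd_cont (p : ℕ → Polynomial ℂ) (a : ℕ → ℂ) (n : ℕ) : Continuous (fwd p a n) := by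
  induction n with
  | zero => exact continuous_id
  | succ n ih =>
    have h1 : Continuous fun w => (fwd p a n w).1 := continuous_fst.comp ih
    have h2 : Continuous fun w => (fwd p a n w).2 := continuous_snd.comp ih
    exact (((p n).continuous.comp h1).sub (continuous_const.mul h2)).prodMk h1

lemma foldr_fwd (hs : List (ℂ × ℂ → ℂ × ℂ)) (h : ∀ g ∈ hs, IsHenon g) :
    ∃ (p : ℕ → Polynomial ℂ) (a : ℕ → ℂ), (∀ i, a i ≠ 0) ∧ (∀ i, 2 ≤ (p i).natDegree) ∧
      ∀ w, hs.foldr (fun h acc => h ∘ acc) id w = fwd p a hs.length w := by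
  induction hs with
  | nil => exact ⟨fun _ => Polynomial.X ^ 2, fun _ => 1, by simp, by simp, fun w => rfl⟩
  | cons g t ih =>
    obtain ⟨p, a, ha, hp, H⟩ := ih (fun g hg => h g (List.mem_cons_of_mem _ hg))
    obtain ⟨q, b, hb, hq, G⟩ := h g List.mem_cons_self
    refine ⟨Function.update p t.length q, Function.update a t.length b, fun i => ?_, fun i => ?_,
      fun w => ?_⟩
    · by_cases hi : i = t.length
      · subst hi; simpa using hb
      · rw [Function.update_of_ne hi]; exact ha i
    · by_cases hi : i = t.length
      · subst hi; simpa using hq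
      · rw [Function.update_of_ne hi]; exact hp i
    · have e : fwd (Function.update p t.length q) (Function.update a t.length b) t.length w
          = fwd p a t.length w := fwd_congr _ (fun i hi => by
            rw [Function.update_of_ne (by omega), Function.update_of_ne (by omega)]
            exact ⟨rfl, rfl⟩) w
      simp only [List.foldr_cons, List.length_cons, Function.comp, fwd]
      rw [e, G, Function.update_self, Function.update_self]
      have := H w
      simp only [Function.comp_def] at this ⊢
      rw [this]

/-- degree products along `ℤ` -/
def degProd (d : ℤ → ℝ) : ℤ → ℝ
  | Int.ofNat n => ∏ i ∈ Finset.range n, d i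
  | Int.negSucc n => (∏ i ∈ Finset.range (n + 1), d (Int.negSucc i))⁻¹

lemma degProd_pos {d : ℤ → ℝ} (hd : ∀ j, 0 < d j) (j : ℤ) : 0 < degProd d j := by
  cases j with
  | ofNat n => exact Finset.prod_pos fun i _ => hd i
  | negSucc n => exact inv_pos.2 (Finset.prod_pos fun i _ => hd _)

lemma degProd_succ {d : ℤ → ℝ} (hd : ∀ j, 0 < d j) (j : ℤ) :
    degProd d (j + 1) = d j * degProd d j := by
  cases j with
  | ofNat n =>
    have : (Int.ofNat n + 1) = Int.ofNat (n + 1) := rfl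
    rw [this]
    simp only [degProd]
    rw [Finset.prod_range_succ, mul_comm]; rfl
  | negSucc n =>
    have h0 := (hd (Int.negSucc n)).ne'
    cases n with
    | zero =>
      have : (Int.negSucc 0 + 1) = Int.ofNat 0 := rfl
      rw [this]
      simp only [degProd, Finset.prod_range_succ, Finset.prod_range_zero, one_mul]
      rw [mul_inv_cancel₀ h0]
    | succ m =>
      have : (Int.negSucc (m + 1) + 1) = Int.negSucc m := rfl
      rw [this]
      simp only [degProd]
      rw [Finset.prod_range_succ _ (m + 1), mul_inv, mul_comm, mul_assoc, inv_mul_cancel₀ h0, mul_one]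

/-- periodic system from finitely many steps -/
def mkSys (p : ℕ → Polynomial ℂ) (a : ℕ → ℂ) (k : ℕ) (hk : 0 < k) (ha : ∀ i, a i ≠ 0)
    (hp : ∀ i, 2 ≤ (p i).natDegree) : Sys where
  p j := p (j % k).toNat
  a j := a (j % k).toNat
  k := k
  D := degProd fun j => ((p (j % k).toNat).natDegree : ℝ)
  kpos := hk
  hp j := by simp
  ha j := by simp
  ane j := ha _
  deg j := hp _
  D0 := by
    change degProd _ (Int.ofNat 0) = 1
    simp [degProd]
  Dpos j := degProd_pos (fun j => by
    have := hp (j % k).toNat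
    exact_mod_cast (by omega : 0 < (p (j % k).toNat).natDegree)) j
  Dsucc j := degProd_succ (fun j => by
    have := hp (j % k).toNat
    exact_mod_cast (by omega : 0 < (p (j % k).toNat).natDegree)) j

namespace Sys
variable (S : Sys)

/-- backward steps -/
def bwd : ℕ → ℂ × ℂ → ℂ × ℂ
  | 0, w => w
  | n + 1, w => ((bwd n w).2,
      ((S.p (Int.negSucc n)).eval (bwd n w).2 - (bwd n w).1) / S.a (Int.negSucc n))

/-- full orbit -/
def orb (w : ℂ × ℂ) : ℤ → ℂ
  | Int.ofNat n => (fwd (fun i => S.p i) (fun i => S.a i) n w).1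
  | Int.negSucc n => (S.bwd n w).2

lemma orb_isOrb (w : ℂ × ℂ) : S.IsOrb (S.orb w) := by
  intro j
  cases j with
  | ofNat n =>
    cases n with
    | zero => rfl
    | succ n => 
      have e1 : Int.ofNat (n + 1) + 1 = Int.ofNat (n + 1 + 1) := rfl
      have e2 : Int.ofNat (n + 1) - 1 = Int.ofNat n := by simp
      rw [e1, e2]
      simp only [orb, stp, fwd]
      rfl
  | negSucc n =>
    have h0 := S.ane (Int.negSucc n)
    have e2 : Int.negSucc n - 1 = Int.negSucc (n + 1) := by
      rw [Int.negSucc_eq, Int.negSucc_eq]; push_cast; ring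
    have e3 : S.orb w (Int.negSucc n + 1) = (S.bwd n w).1 := by
      cases n with
      | zero => rfl
      | succ n => rfl
    rw [e2, e3]
    simp only [orb, stp, bwd]
    field_simp
    ring

lemma orb_diff {g : ℂ → ℂ × ℂ} {U : Set ℂ} (hg : DifferentiableOn ℂ g U) (j : ℤ) :
    DifferentiableOn ℂ (fun z => S.orb (g z) j) U := by
  have F : ∀ n, DifferentiableOn ℂ (fun z => fwd (fun i => S.p i) (fun i => S.a i) n (g z)) U := by
    intro n
    induction n with
    | zero => exact hg
    | succ n ih =>
      have h1 := ih.fst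
      have h2 := ih.snd
      exact (((S.p n).differentiable.comp_differentiableOn h1).sub (h2.const_mul _)).prodMk h1
  have B : ∀ n, DifferentiableOn ℂ (fun z => S.bwd n (g z)) U := by
    intro n
    induction n with
    | zero => exact hg
    | succ n ih =>
      have h1 := ih.fst
      have h2 := ih.snd
      exact h2.prodMk ((((S.p (Int.negSucc n)).differentiable.comp_differentiableOn h2).sub h1).div_const _)
  cases j with
  | ofNat n => exact (F n).fst
  | negSucc n => exact (B n).snd

end Sys

lemma IsPolyMap.cont {F : ℂ × ℂ → ℂ × ℂ} (h : IsPolyMap F) : Differentiable ℂ F := by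
  obtain ⟨P, Q, H⟩ := h
  have key : ∀ P : MvPolynomial (Fin 2) ℂ,
      Differentiable ℂ fun z : ℂ × ℂ => MvPolynomial.eval ![z.1, z.2] P := by
    intro P
    induction P using MvPolynomial.induction_on with
    | C a => simp
    | add p q hp hq => simp only [map_add]; exact hp.add hq
    | mul_X p i hp =>
      simp only [map_mul, MvPolynomial.eval_X]
      refine hp.mul ?_
      fin_cases i
      · exact differentiable_fst
      · exact differentiable_snd
  have : F = fun z => (MvPolynomial.eval ![z.1, z.2] P, MvPolynomial.eval ![z.1, z.2] Q) := funext H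
  rw [this]
  exact (key P).prodMk (key Q)

lemma bdd_image {F : ℂ × ℂ → ℂ × ℂ} (h : Continuous F) (C : ℝ) :
    ∃ R : ℝ, ∀ w, ‖w‖ ≤ C → ‖F w‖ ≤ R := by
  obtain ⟨R, hR⟩ := (isCompact_closedBall (0 : ℂ × ℂ) C).exists_bound_of_continuousOn h.continuousOn
  exact ⟨R, fun w hw => hR w (by simpa using hw)⟩

lemma bdd_fwd {p : ℕ → Polynomial ℂ} {a : ℕ → ℂ} {k : ℕ} (hk : 0 < k)
    (hp : ∀ n, p (n + k) = p n) (ha : ∀ n, a (n + k) = a n) (w : ℂ × ℂ) :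
    (∃ C : ℝ, ∀ n : ℕ, ‖(fwd p a k)^[n] w‖ ≤ C) ↔ ∃ R : ℝ, ∀ n : ℕ, ‖(fwd p a n w).1‖ ≤ R := by
  have hp' : ∀ m n, p (m * k + n) = p n := by
    intro m n
    induction m with
    | zero => simp
    | succ m ih => rw [← ih, ← hp (m * k + n)]; congr 1; ring
  have ha' : ∀ m n, a (m * k + n) = a n := by
    intro m n
    induction m with
    | zero => simp
    | succ m ih => rw [← ih, ← ha (m * k + n)]; congr 1; ring
  have it : ∀ n, (fwd p a k)^[n] w = fwd p a (n * k) w := by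
    intro n
    induction n with
    | zero => simp [fwd]
    | succ n ih =>
      rw [Function.iterate_succ_apply', ih, add_mul, one_mul, fwd_add (hp' n) (ha' n)]
  constructor
  · rintro ⟨C, hC⟩
    choose R hR using fun i => bdd_image (fwd_cont p a i) C
    refine ⟨∑ i ∈ Finset.range k, |R i|, fun n => ?_⟩
    have e : n = n / k * k + n % k := by rw [mul_comm]; exact (Nat.div_add_mod n k).symm
    have h1 : fwd p a n w = fwd p a (n % k) ((fwd p a k)^[n / k] w) := by
      rw [it, ← fwd_add (hp' _) (ha' _), ← e]
    have h2 := hR (n % k) _ (hC (n / k))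
    rw [← h1] at h2
    refine ((norm_fst_le _).trans h2).trans ((le_abs_self _).trans ?_)
    exact Finset.single_le_sum (f := fun i : ℕ => |R i|) (fun _ _ => abs_nonneg _)
      (Finset.mem_range.2 (Nat.mod_lt _ hk))
  · rintro ⟨R, hR⟩
    refine ⟨max R ‖w‖, fun n => ?_⟩
    rw [it]
    cases h : n * k with
    | zero => exact le_max_right _ _
    | succ m =>
      rw [Prod.norm_def]
      exact (max_le (hR (m + 1)) (hR m)).trans (le_max_left _ _)

theorem julia_slice_not_C1_curve (f : ℂ × ℂ → ℂ × ℂ) (γ : ℂ → ℂ × ℂ)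
    (hf : IsLoxodromic f) (hγ : IsTransversal f γ) :
    ¬ ∃ (I : Set ℝ) (η : ℝ → ℂ), IsOpen I ∧ I.OrdConnected ∧
        Set.InjOn η I ∧ ContDiffOn ℝ 1 η I ∧ (∀ t ∈ I, deriv η t ≠ 0) ∧
        η '' I = juliaSlice f γ := by
  rintro ⟨I, η, hI, -, hinj, hη, hη', him⟩
  obtain ⟨-, u, uinv, hs, ⟨hu, G, hG, hGu, huG⟩, hiu, hui, hne, hH, hf⟩ := hf
  obtain ⟨-, hγd, ⟨z1, hz1, hz1'⟩, hγ2⟩ := hγ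
  have huc : Continuous u := hu.cont.continuous
  have hic : Continuous uinv := by
    have : uinv = G := funext fun z => by rw [← huG z, hiu, huG]
    rw [this]; exact hG.cont.continuous
  obtain ⟨p, a, ha, hp, hF⟩ := foldr_fwd hs hH
  have hk : 0 < hs.length := List.length_pos_iff.2 hne
  set k := hs.length with hkdef
  let S := mkSys p a k hk ha hp
  have hF' : ∀ w, hs.foldr (fun h acc => h ∘ acc) id w
      = fwd (fun i : ℕ => S.p i) (fun i : ℕ => S.a i) k w := by
    intro w
    rw [hF]
    refine fwd_congr _ (fun i hi => ?_) w
    have : ((i : ℤ) % (k : ℤ)).toNat = i := by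
      rw [← Int.natCast_mod, Int.toNat_natCast, Nat.mod_eq_of_lt hi]
    exact ⟨congrArg p this.symm, congrArg a this.symm⟩
  set H := fwd (fun i : ℕ => S.p i) (fun i : ℕ => S.a i) k with hHdef
  have hfi : ∀ n z, f^[n] z = uinv (H^[n] (u z)) := by
    intro n z
    induction n with
    | zero => simp [hiu]
    | succ n ih => rw [Function.iterate_succ_apply', Function.iterate_succ_apply', ih, hf, hui, hF']
  have hKp : ∀ z, z ∈ Kplus f ↔ ∃ R : ℝ, ∀ n : ℕ, ‖S.orb (u z) n‖ ≤ R := by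
    intro z
    have b := bdd_fwd (p := fun i : ℕ => S.p i) (a := fun i : ℕ => S.a i) hk
      (fun n => by have := S.hp n; push_cast; exact this) (fun n => by have := S.ha n; push_cast; exact this) (u z)
    refine Iff.trans ?_ b
    constructor
    · rintro ⟨C, hC⟩
      obtain ⟨R, hR⟩ := bdd_image huc C
      refine ⟨R, fun n => ?_⟩
      have := hR _ (hC n)
      rwa [hfi, hui] at this
    · rintro ⟨C, hC⟩
      obtain ⟨R, hR⟩ := bdd_image hic C
      refine ⟨R, fun n => ?_⟩
      have := hR _ (hC n)
      rwa [← hfi] at this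
  refine S.geom (X := fun j z => S.orb (u (γ z)) j)
    (K := {z | z ∈ unitDisk ∧ γ z ∈ Kplus f})
    (fun j => S.orb_diff (hu.cont.comp_differentiableOn hγd) j)
    (fun z _ => S.orb_isOrb _) (fun z => ?_) ⟨z1, hz1, hz1'⟩ (fun h => hγ2 fun z hz => (h hz).2)
    hI hinj hη hη' him
  exact and_congr Iff.rfl (hKp (γ z))
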